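/- arXiv:math/0603261 — 10 statements merged into one kernel-verified Lean document; each statement's English description precedes it below -/
import Mathlib

section
/- Birkhoff's lemma: Let k be a field and r ≥ 1. For every invertible r×r matrix M over the Laurent polynomial ring k[z,z⁻¹] (i.e. M ∈ GL(r, k[z,z⁻¹])) there exist an invertible matrix S ∈ GL(r, k[z]) (entries of S and of S⁻¹ lie in k[z]), an invertible matrix T ∈ GL(r, k[z⁻¹]) (entries of T and of T⁻¹ lie in k[z⁻¹]), and integers d₁,…,d_r such that T⁻¹·M·S is the diagonal matrix diag(z^{d₁},…,z^{d_r}). -/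
open LaurentPolynomial

/-- A Laurent polynomial lies in the subring `k[z]` of polynomials in `z`. -/
def InZ (k : Type*) [Field k] (f : LaurentPolynomial k) : Prop :=
  ∃ p : Polynomial k, Polynomial.aeval (LaurentPolynomial.T 1 : LaurentPolynomial k) p = f

/-- A Laurent polynomial lies in the subring `k[z⁻¹]` of polynomials in `z⁻¹`. -/
def InZInv (k : Type*) [Field k] (f : LaurentPolynomial k) : Prop :=
  ∃ p : Polynomial k, Polynomial.aeval (LaurentPolynomial.T (-1) : LaurentPolynomial k) p = f

open Polynomial in
/-- The inclusion of `k[z⁻¹]` factors through the involution `z ↦ z⁻¹`. -/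
lemma aeval_T_neg_one_eq_invert {k : Type*} [Field k] (p : k[X]) :
    aeval (T (-1) : LaurentPolynomial k) p = invert (toLaurent p) := by
  have h : (aeval (T (-1) : LaurentPolynomial k)) =
      (invert (R := k)).toAlgHom.comp toLaurentAlg := by
    ext
    simp
  exact congrArg (fun f => f p) h

open Polynomial in
lemma aeval_T_neg_one_injective (k : Type*) [Field k] :
    Function.Injective (aeval (R := k) (T (-1) : LaurentPolynomial k)) := by
  intro p q h
  rw [aeval_T_neg_one_eq_invert, aeval_T_neg_one_eq_invert] at h
  exact toLaurent_injective (invert.injective h)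

open Polynomial in
lemma exists_aeval_T_neg_one_eq_mul_T {k : Type*} [Field k] (f : LaurentPolynomial k) :
    ∃ n : ℕ, ∀ m : ℕ, n ≤ m → ∃ p : k[X], aeval (T (-1)) p = f * T (-(m : ℤ)) := by
  obtain ⟨n, p, hp⟩ := exists_T_pow (invert f)
  refine ⟨n, fun m hm => ⟨p * X ^ (m - n), ?_⟩⟩
  rw [map_mul, aeval_T_neg_one_eq_invert, hp, map_mul, map_pow, aeval_X, T_pow, invert_T,
    mul_assoc, ← T_add, involutive_invert f]
  congr 2
  push_cast [hm]
  ring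

open Polynomial in
lemma exists_matrix_map_aeval_T_neg_one_eq {k ι : Type*} [Field k] [Fintype ι] [DecidableEq ι]
    (M : Matrix ι ι (LaurentPolynomial k)) :
    ∃ (A : Matrix ι ι k[X]) (n : ℕ),
      M = A.map (aeval (T (-1))) * Matrix.diagonal fun _ => T (n : ℤ) := by
  choose n hn using fun x : ι × ι => exists_aeval_T_neg_one_eq_mul_T (M x.1 x.2)
  choose A hA using fun i j => hn (i, j) (Finset.univ.sup n) (Finset.le_sup (Finset.mem_univ _))
  refine ⟨Matrix.of A, Finset.univ.sup n, ?_⟩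
  ext1 i j
  rw [Matrix.mul_diagonal, Matrix.map_apply, Matrix.of_apply, hA, mul_assoc, ← T_add]
  simp

open Polynomial in
/-- If a matrix over `k[y]` is singular at `y = 0`, one of its columns can be replaced by a
combination of the columns divided by `y`; given weights `d` on the columns, the replaced column
may be taken of maximal weight among those entering the combination. -/
lemma exists_column_reduction {k ι : Type*} [Field k] [Fintype ι] [DecidableEq ι]
    (A : Matrix ι ι k[X]) (d : ι → ℤ) (h : A.det.eval 0 = 0) :
    ∃ (c : ι → k) (j : ι) (b : ι → k[X]), c j ≠ 0 ∧ (∀ l, c l ≠ 0 → d l ≤ d j) ∧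
      (A.mulVec fun l => Polynomial.C (c l)) = (X : k[X]) • b ∧
      X * (A.updateCol j b).det = Polynomial.C (c j) * A.det := by
  have h0 : (A.map (evalRingHom (0 : k))).det = 0 := by
    rw [← RingHom.mapMatrix_apply, ← RingHom.map_det]
    exact h
  obtain ⟨c, hc, hAc⟩ := Matrix.exists_mulVec_eq_zero_iff.mpr h0
  obtain ⟨i, hi⟩ := Function.ne_iff.mp hc
  classical
  obtain ⟨j, hj, hmax⟩ := (Finset.univ.filter fun l => c l ≠ 0).exists_max_image d
    ⟨i, by simpa using hi⟩
  have hdvd : ∀ i, X ∣ A.mulVec (fun l => Polynomial.C (c l)) i := by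
    intro i
    rw [X_dvd_iff, coeff_zero_eq_eval_zero]
    simpa [Matrix.mulVec, dotProduct, eval_finsetSum] using congrFun hAc i
  choose b hb using hdvd
  have hb' : (A.mulVec fun l => Polynomial.C (c l)) = (X : k[X]) • b := funext hb
  refine ⟨c, j, b, by simpa using hj, fun l hl => hmax l (by simpa using hl), hb', ?_⟩
  rw [← Matrix.det_updateCol_smul, ← hb', ← Matrix.cramer_apply,
    Matrix.cramer_eq_adjugate_mulVec, Matrix.mulVec_mulVec, Matrix.adjugate_mul]
  simp [Matrix.smul_mulVec, mul_comm]

open Polynomial in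
/-- The column reduction of `exists_column_reduction` is realised by right multiplication with an
invertible matrix over `k[z]`. -/
lemma mul_updateCol_eq_updateCol_mul {k ι : Type*} [Field k] [Fintype ι] [DecidableEq ι]
    (A : Matrix ι ι k[X]) (d : ι → ℤ) {c : ι → k} {j : ι} {b : ι → k[X]}
    (hmax : ∀ l, c l ≠ 0 → d l ≤ d j) (hb : (A.mulVec fun l => Polynomial.C (c l)) = (X : k[X]) • b) :
    A.map (aeval (T (-1) : LaurentPolynomial k)) * Matrix.diagonal (fun l => T (d l)) *
        ((1 : Matrix ι ι k[X]).updateCol j fun l => Polynomial.C (c l) * X ^ (d j - d l).toNat).map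
          (aeval (T 1)) =
      (A.updateCol j b).map (aeval (T (-1))) *
        Matrix.diagonal fun l => T (Function.update d j (d j - 1) l) := by
  ext1 i m
  rw [Matrix.mul_diagonal, Matrix.mul_apply]
  simp only [Matrix.mul_diagonal, Matrix.map_apply]
  by_cases hm : m = j
  · subst hm
    simp only [Matrix.updateCol_self, Function.update_self]
    have hsum : ∀ l, aeval (T (-1)) (A i l) * T (d l) *
        aeval (T 1 : LaurentPolynomial k) (Polynomial.C (c l) * X ^ (d m - d l).toNat) =
        aeval (T (-1)) (A i l * Polynomial.C (c l)) * T (d m) := by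
      intro l
      by_cases hl : c l = 0
      · simp [hl]
      · have hT : T (d l) * T (d m - d l) = (T (d m) : LaurentPolynomial k) := by
          rw [← T_add]
          congr 1
          ring
        rw [map_mul, map_mul, map_pow, aeval_X, T_pow, aeval_C, aeval_C, mul_one,
          Int.toNat_of_nonneg (sub_nonneg.mpr (hmax l hl)), ← hT]
        ring
    have hbi : ∑ l, A i l * Polynomial.C (c l) = X * b i := congrFun hb i
    rw [Finset.sum_congr rfl fun l _ => hsum l, ← Finset.sum_mul, ← map_sum, hbi, map_mul, aeval_X,
      sub_eq_neg_add, T_add]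
    ring
  · simp [Matrix.one_apply, apply_ite, hm]

open Polynomial in
lemma exists_reduced_columns {k ι : Type*} [Field k] [Fintype ι] [DecidableEq ι]
    (M : Matrix ι ι (LaurentPolynomial k)) (A : Matrix ι ι k[X]) (d : ι → ℤ) (S : Matrix ι ι k[X])
    (hA : A.det ≠ 0) (hS : IsUnit S.det)
    (h : M * S.map (aeval (T 1)) = A.map (aeval (T (-1))) * Matrix.diagonal fun i => T (d i)) :
    ∃ (A' : Matrix ι ι k[X]) (d' : ι → ℤ) (S' : Matrix ι ι k[X]),
      A'.det.eval 0 ≠ 0 ∧ IsUnit S'.det ∧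
      M * S'.map (aeval (T 1)) =
        A'.map (aeval (T (-1))) * Matrix.diagonal fun i => T (d' i) := by
  induction hn : A.det.natDegree generalizing A d S with
  | zero =>
    refine ⟨A, d, S, fun h0 => hA ?_, hS, h⟩
    rw [eq_C_of_natDegree_eq_zero hn] at h0 ⊢
    simpa using h0
  | succ n ih =>
    by_cases h0 : A.det.eval 0 = 0
    · obtain ⟨c, j, b, hc, hmax, hb, hdet⟩ := exists_column_reduction A d h0
      have hC : Polynomial.C (c j) ≠ 0 := C_ne_zero.mpr hc
      have hne : (A.updateCol j b).det ≠ 0 := by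
        intro hz
        rw [hz, mul_zero] at hdet
        exact mul_ne_zero hC hA hdet.symm
      refine ih (A.updateCol j b) (Function.update d j (d j - 1))
        (S * (1 : Matrix ι ι k[X]).updateCol j fun l => Polynomial.C (c l) * X ^ (d j - d l).toNat)
        hne ?_ ?_ ?_
      · rw [Matrix.det_mul, ← Matrix.cramer_apply, Matrix.cramer_one]
        refine hS.mul ?_
        simpa using hc
      · rw [← mul_updateCol_eq_updateCol_mul A d hmax hb, ← h, Matrix.map_mul, Matrix.mul_assoc]
      · have := congrArg natDegree hdet
        rw [natDegree_X_mul hne, natDegree_C_mul hc, hn] at this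
        omega
    · exact ⟨A, d, S, h0, hS, h⟩

open Polynomial in
lemma isUnit_of_isUnit_aeval_T_neg_one {k : Type*} [Field k] {p : k[X]}
    (h : IsUnit (aeval (T (-1) : LaurentPolynomial k) p)) (h0 : p.eval 0 ≠ 0) : IsUnit p := by
  obtain ⟨f, hf⟩ := h.exists_right_inv
  obtain ⟨n, hn⟩ := exists_aeval_T_neg_one_eq_mul_T f
  obtain ⟨q, hq⟩ := hn n le_rfl
  have hpq : p * q = X ^ n := by
    apply aeval_T_neg_one_injective k
    rw [map_mul, hq, ← mul_assoc, hf, one_mul, map_pow, aeval_X, T_pow]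
    congr 1
    ring
  have hX : ¬ X ∣ p := by rwa [X_dvd_iff, coeff_zero_eq_eval_zero]
  have hcop : IsCoprime p (X ^ n) :=
    ((irreducible_X.coprime_iff_not_dvd).mpr hX).symm.pow_right
  exact hcop.isUnit_of_dvd' dvd_rfl ⟨q, hpq.symm⟩

/-- **Birkhoff's lemma**: any `M ∈ GL(r, k[z,z⁻¹])` can be written as `T · D · S⁻¹`, i.e.
`T⁻¹ · M · S = D`, where `S ∈ GL(r, k[z])`, `T ∈ GL(r, k[z⁻¹])` and
`D = diag(z^{d₁}, …, z^{d_r})`. -/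
theorem birkhoff_lemma (k : Type*) [Field k] (r : ℕ) (hr : 1 ≤ r)
    (M N : Matrix (Fin r) (Fin r) (LaurentPolynomial k))
    (hMN : M * N = 1) (hNM : N * M = 1) :
    ∃ (S S' T T' : Matrix (Fin r) (Fin r) (LaurentPolynomial k)) (d : Fin r → ℤ),
      S * S' = 1 ∧ S' * S = 1 ∧
      (∀ i j, InZ k (S i j)) ∧ (∀ i j, InZ k (S' i j)) ∧
      T * T' = 1 ∧ T' * T = 1 ∧
      (∀ i j, InZInv k (T i j)) ∧ (∀ i j, InZInv k (T' i j)) ∧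
      T' * M * S = Matrix.diagonal (fun i => LaurentPolynomial.T (d i)) := by
  open Polynomial in
  have hM : IsUnit M.det := (Matrix.isUnit_iff_isUnit_det M).mp ⟨⟨M, N, hMN, hNM⟩, rfl⟩
  have hmap : ∀ (t : LaurentPolynomial k) (B : Matrix (Fin r) (Fin r) k[X]),
      (B.map (aeval t)).det = aeval t B.det := fun t B => ((aeval t).map_det B).symm
  have hinv : ∀ (t : LaurentPolynomial k) (B B' : Matrix (Fin r) (Fin r) k[X]), B * B' = 1 →
      B.map (aeval t) * B'.map (aeval t) = 1 := by
    intro t B B' hB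
    rw [← Matrix.map_mul, hB]
    exact Matrix.map_one _ (map_zero _) (map_one _)
  obtain ⟨A₀, n, hA₀⟩ := exists_matrix_map_aeval_T_neg_one_eq M
  have hA₀det : A₀.det ≠ 0 := by
    intro hz
    rw [hA₀, Matrix.det_mul, hmap, hz, map_zero, zero_mul] at hM
    exact not_isUnit_zero hM
  obtain ⟨A, d, S, hA, hS, h⟩ := exists_reduced_columns M A₀ (fun _ => n) 1 hA₀det (by simp)
    (by rw [Matrix.map_one _ (map_zero _) (map_one _), mul_one, ← hA₀])
  have hAdet : IsUnit A.det := by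
    refine isUnit_of_isUnit_aeval_T_neg_one ?_ hA
    rw [← hmap]
    have hdet := congrArg Matrix.det h
    rw [Matrix.det_mul, Matrix.det_mul, hmap] at hdet
    exact isUnit_of_mul_isUnit_left (hdet ▸ hM.mul (hS.map (aeval (T 1))))
  refine ⟨S.map (aeval (T 1)), S⁻¹.map (aeval (T 1)), A.map (aeval (T (-1))),
    A⁻¹.map (aeval (T (-1))), d, hinv _ _ _ (S.mul_nonsing_inv hS),
    hinv _ _ _ (S.nonsing_inv_mul hS), fun i j => ⟨S i j, rfl⟩, fun i j => ⟨S⁻¹ i j, rfl⟩,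
    hinv _ _ _ (A.mul_nonsing_inv hAdet), hinv _ _ _ (A.nonsing_inv_mul hAdet),
    fun i j => ⟨A i j, rfl⟩, fun i j => ⟨A⁻¹ i j, rfl⟩, ?_⟩
  rw [Matrix.mul_assoc, h, ← Matrix.mul_assoc, hinv _ _ _ (A.nonsing_inv_mul hAdet), one_mul]
end

section
/- Step 1 of Birkhoff's algorithm: Let k be a field and r ≥ 1. For every M ∈ GL(r, k[z,z⁻¹]) there exists S ∈ GL(r, k[z]) and integers m₁,…,m_r such that the product M·S is lower triangular and its (i,i)-th diagonal entry equals the monomial z^{m_i} for every i. -/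
open LaurentPolynomial

/-- Any `n` linear functionals on a free module of rank `n` over a principal ideal domain are
lower triangular with respect to some basis. -/
theorem exists_basis_forall_lt_apply_eq_zero {A : Type*} [CommRing A] [IsDomain A]
    [IsPrincipalIdealRing A] {n : ℕ} {V : Type*} [AddCommGroup V] [Module A V]
    (b : Module.Basis (Fin n) A V) (φ : Fin n → V →ₗ[A] A) :
    ∃ b' : Module.Basis (Fin n) A V, ∀ i j, i < j → φ i (b' j) = 0 := by
  induction n generalizing V with
  | zero => exact ⟨b, fun i => i.elim0⟩
  | succ n ih =>
    obtain ⟨ψ, hψ, hker⟩ : ∃ ψ : V →ₗ[A] A, ψ ≠ 0 ∧ LinearMap.ker ψ ≤ LinearMap.ker (φ 0) := by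
      by_cases h : φ 0 = 0
      · refine ⟨b.coord 0, fun h0 => ?_, by simp [h]⟩
        simpa using LinearMap.congr_fun h0 (b 0)
      · exact ⟨φ 0, h, le_rfl⟩
    obtain ⟨g, hg⟩ := (IsPrincipalIdealRing.principal (LinearMap.range ψ)).principal
    obtain ⟨y, hy⟩ : g ∈ LinearMap.range ψ := hg ▸ Submodule.mem_span_singleton_self g
    have hg0 : g ≠ 0 := by
      rintro rfl
      rw [Submodule.span_zero_singleton, LinearMap.range_eq_bot] at hg
      exact hψ hg
    have hli : ∀ c : A, ∀ x ∈ LinearMap.ker ψ, c • y + x = 0 → c = 0 := by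
      intro c x hx h
      have h' := congrArg ψ h
      rw [map_add, map_smul, hy, LinearMap.mem_ker.mp hx] at h'
      simpa [hg0] using h'
    have hsp : ∀ z : V, ∃ c : A, z + c • y ∈ LinearMap.ker ψ := by
      intro z
      have hz : ψ z ∈ LinearMap.range ψ := ⟨z, rfl⟩
      rw [hg, Submodule.mem_span_singleton] at hz
      obtain ⟨a, ha⟩ := hz
      exact ⟨-a, by simp [hy, ← ha]⟩
    obtain ⟨m, c⟩ := (LinearMap.ker ψ).basisOfPid b
    obtain rfl : m = n := by
      simpa using Fintype.card_congr ((c.mkFinCons y hli hsp).indexEquiv b)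
    obtain ⟨c', hc'⟩ := ih c fun i => φ i.succ ∘ₗ (LinearMap.ker ψ).subtype
    refine ⟨c'.mkFinCons y hli hsp, fun i j hij => ?_⟩
    rw [Module.Basis.coe_mkFinCons]
    cases j using Fin.cases with
    | zero => exact absurd hij (Fin.not_lt_zero i)
    | succ j =>
      cases i using Fin.cases with
      | zero => exact hker (c' j).2
      | succ i => exact hc' i j (Fin.succ_lt_succ_iff.mp hij)

/-- Every square matrix over a principal ideal domain becomes lower triangular after right
multiplication by an invertible matrix. -/
theorem Matrix.exists_mul_lowerTriangular {A : Type*} [CommRing A] [IsDomain A]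
    [IsPrincipalIdealRing A] {n : ℕ} (P : Matrix (Fin n) (Fin n) A) :
    ∃ U U' : Matrix (Fin n) (Fin n) A, U * U' = 1 ∧ U' * U = 1 ∧
      ∀ i j, i < j → (P * U) i j = 0 := by
  obtain ⟨b, hb⟩ := exists_basis_forall_lt_apply_eq_zero (Pi.basisFun A (Fin n))
    fun i => LinearMap.proj i ∘ₗ P.mulVecLin
  exact ⟨(Pi.basisFun A (Fin n)).toMatrix b, b.toMatrix (Pi.basisFun A (Fin n)),
    Module.Basis.toMatrix_mul_toMatrix_flip _ _, Module.Basis.toMatrix_mul_toMatrix_flip _ _, hb⟩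

/-- The units of `k[z,z⁻¹]` are the nonzero scalar multiples of monomials. -/
theorem LaurentPolynomial.exists_eq_C_mul_T_of_isUnit {k : Type*} [Field k]
    {f : LaurentPolynomial k} (hf : IsUnit f) : ∃ (c : k) (m : ℤ), c ≠ 0 ∧ f = C c * T m := by
  obtain ⟨g, hfg⟩ := hf.exists_right_inv
  obtain ⟨a, p, hp⟩ := f.exists_T_pow
  obtain ⟨b, q, hq⟩ := g.exists_T_pow
  have hpq : p * q = Polynomial.X ^ (a + b) := by
    apply Polynomial.toLaurent_injective
    rw [map_mul, hp, hq, Polynomial.toLaurent_X_pow, mul_mul_mul_comm, hfg, one_mul, ← T_add,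
      Nat.cast_add]
  obtain ⟨i, -, hi⟩ := (dvd_prime_pow Polynomial.prime_X _).mp (Dvd.intro q hpq)
  obtain ⟨u, hu⟩ := hi.symm
  obtain ⟨c, hc, hcu⟩ := Polynomial.isUnit_iff.mp u.isUnit
  refine ⟨c, i - a, hc.ne_zero, ?_⟩
  rw [← hcu] at hu
  rw [← hu, map_mul, Polynomial.toLaurent_X_pow, Polynomial.toLaurent_C] at hp
  rw [T_sub, ← mul_assoc, mul_comm (C c), hp, mul_T_assoc, add_neg_cancel, T_zero, mul_one]

theorem inZ_toLaurent {k : Type*} [Field k] (p : Polynomial k) : InZ k (Polynomial.toLaurent p) :=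
  ⟨p, by
    rw [← Polynomial.toLaurent_X, ← Polynomial.toLaurentAlg_apply, Polynomial.aeval_algHom_apply,
      Polynomial.aeval_X_left_apply, Polynomial.toLaurentAlg_apply]⟩

/-- **Step 1 of Birkhoff's algorithm**: any `M ∈ GL(r, k[z,z⁻¹])` can be brought, by right
multiplication with some `S ∈ GL(r, k[z])`, to a lower triangular form whose diagonal
entries are monomials `z^{m_i}`. -/
theorem birkhoff_step1 (k : Type*) [Field k] (r : ℕ) (hr : 1 ≤ r)
    (M N : Matrix (Fin r) (Fin r) (LaurentPolynomial k))
    (hMN : M * N = 1) (hNM : N * M = 1) :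
    ∃ (S S' : Matrix (Fin r) (Fin r) (LaurentPolynomial k)) (m : Fin r → ℤ),
      S * S' = 1 ∧ S' * S = 1 ∧
      (∀ i j, InZ k (S i j)) ∧ (∀ i j, InZ k (S' i j)) ∧
      (∀ i j : Fin r, i < j → (M * S) i j = 0) ∧
      (∀ i : Fin r, (M * S) i i = LaurentPolynomial.T (m i)) := by
  obtain ⟨⟨_, n, rfl⟩, hn⟩ := IsLocalization.exist_integer_multiples_of_finite
    (Submonoid.powers (Polynomial.X : Polynomial k)) fun x : Fin r × Fin r => M x.1 x.2
  choose P hP using fun i j => hn (i, j)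
  have hP' : (Matrix.of P).map Polynomial.toLaurent = (T n : LaurentPolynomial k) • M := by
    ext1 i j
    simpa [Algebra.smul_def, algebraMap_eq_toLaurent] using hP i j
  obtain ⟨U, U', hUU', hU'U, hU⟩ := (Matrix.of P).exists_mul_lowerTriangular
  set V := U.map Polynomial.toLaurent with hV
  set V' := U'.map Polynomial.toLaurent with hV'
  have hVV' : V * V' = 1 := by
    rw [hV, hV', ← Matrix.map_mul, hUU', Matrix.map_one _ (map_zero _) (map_one _)]
  have hlow : ∀ i j, i < j → (M * V) i j = 0 := by
    intro i j hij
    have h : (T n : LaurentPolynomial k) * (M * V) i j = 0 := by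
      rw [← smul_eq_mul, ← Matrix.smul_apply, ← Matrix.smul_mul, ← hP', ← Matrix.map_mul,
        Matrix.map_apply, hU i j hij, map_zero]
    exact (isUnit_T _).mul_right_eq_zero.mp h
  have hdet : IsUnit (M * V).det := by
    rw [Matrix.det_mul]
    exact (Matrix.isUnit_det_of_right_inverse hMN).mul (Matrix.isUnit_det_of_right_inverse hVV')
  rw [Matrix.det_of_isLowerTriangular _ fun i j hij => hlow i j hij,
    IsUnit.prod_univ_iff] at hdet
  choose c m hc hm using fun i => exists_eq_C_mul_T_of_isUnit (hdet i)
  let D : Matrix (Fin r) (Fin r) (Polynomial k) := Matrix.diagonal fun i => Polynomial.C (c i)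
  let D' : Matrix (Fin r) (Fin r) (Polynomial k) := Matrix.diagonal fun i => Polynomial.C (c i)⁻¹
  have hDD' : D * D' = 1 := by
    simp [D, D', ← Polynomial.C_mul, hc]
  have hD'D : D' * D = 1 := mul_eq_one_comm.mp hDD'
  have hS : ∀ i j, (M * (U * D').map Polynomial.toLaurent) i j = (M * V) i j * C (c j)⁻¹ := by
    intro i j
    rw [Matrix.map_mul, ← mul_assoc, Matrix.diagonal_map (map_zero _), Matrix.mul_diagonal,
      Polynomial.toLaurent_C]
  refine ⟨(U * D').map Polynomial.toLaurent, (D * U').map Polynomial.toLaurent, m, ?_, ?_,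
    fun i j => inZ_toLaurent _, fun i j => inZ_toLaurent _, fun i j hij => ?_, fun i => ?_⟩
  · rw [← Matrix.map_mul, mul_assoc, ← mul_assoc D', hD'D, one_mul, hUU',
      Matrix.map_one _ (map_zero _) (map_one _)]
  · rw [← Matrix.map_mul, mul_assoc, ← mul_assoc U', hU'U, one_mul, hDD',
      Matrix.map_one _ (map_zero _) (map_one _)]
  · rw [hS, hlow i j hij, zero_mul]
  · rw [hS, hm, mul_right_comm, ← map_mul, mul_inv_cancel₀ (hc i), map_one, one_mul]
end

section
/- Step 2 of Birkhoff's algorithm: Let k be a field, let m ≤ n be integers and let p ∈ k[z,z⁻¹] be any Laurent polynomial. Then there exist S ∈ GL(2, k[z]), T ∈ GL(2, k[z⁻¹]) and integers a, b with a + b = m + n such that T⁻¹·[[z^m, 0],[p, z^n]]·S = diag(z^a, z^b), i.e. the lower triangular matrix with diagonal entries z^m, z^n and lower-left entry p can be diagonalized to a matrix with monomial diagonal entries. -/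
open LaurentPolynomial

open Polynomial in
/-- `A` is brought to the form `diag(z^a, z^b)` with `a + b = s` by a row transformation of
determinant one over `k[z⁻¹]` and a column transformation of determinant one over `k[z]`. -/
def HasBirkhoffDiagonal (k : Type*) [Field k] (s : ℤ)
    (A : Matrix (Fin 2) (Fin 2) (LaurentPolynomial k)) : Prop :=
  ∃ (U S : Matrix (Fin 2) (Fin 2) k[X]) (a b : ℤ), U.det = 1 ∧ S.det = 1 ∧ a + b = s ∧
    (aeval (LaurentPolynomial.T (-1) : LaurentPolynomial k)).mapMatrix U * A *
      (aeval (LaurentPolynomial.T 1 : LaurentPolynomial k)).mapMatrix S =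
        Matrix.diagonal ![LaurentPolynomial.T a, LaurentPolynomial.T b]

namespace HasBirkhoffDiagonal

open Polynomial

variable {k : Type*} [Field k] {s : ℤ} {A B : Matrix (Fin 2) (Fin 2) (LaurentPolynomial k)}

theorem of_mul_right (S : Matrix (Fin 2) (Fin 2) k[X]) (hS : S.det = 1)
    (h : A * (aeval (LaurentPolynomial.T 1 : LaurentPolynomial k)).mapMatrix S = B)
    (hB : HasBirkhoffDiagonal k s B) : HasBirkhoffDiagonal k s A := by
  obtain ⟨U, S₁, a, b, hU, hS₁, hab, h₁⟩ := hB
  refine ⟨U, S * S₁, a, b, hU, by rw [Matrix.det_mul, hS, hS₁, one_mul], hab, ?_⟩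
  rw [← h₁, ← h, map_mul]
  simp only [mul_assoc]

theorem of_mul_left (U : Matrix (Fin 2) (Fin 2) k[X]) (hU : U.det = 1)
    (h : (aeval (LaurentPolynomial.T (-1) : LaurentPolynomial k)).mapMatrix U * A = B)
    (hB : HasBirkhoffDiagonal k s B) : HasBirkhoffDiagonal k s A := by
  obtain ⟨U₁, S, a, b, hU₁, hS, hab, h₁⟩ := hB
  refine ⟨U₁ * U, S, a, b, by rw [Matrix.det_mul, hU, hU₁, one_mul], hS, hab, ?_⟩
  rw [← h₁, ← h, map_mul]
  simp only [mul_assoc]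

theorem diagonal (m n : ℤ) :
    HasBirkhoffDiagonal k (m + n) !![LaurentPolynomial.T m, 0; 0, LaurentPolynomial.T n] := by
  refine ⟨1, 1, m, n, Matrix.det_one, Matrix.det_one, rfl, ?_⟩
  rw [map_one, map_one, one_mul, mul_one]
  ext i j : 1
  fin_cases i <;> fin_cases j <;> simp

/-- Multiples of `z^n` by `k[z]` in the lower-left entry may be dropped. -/
theorem of_add_right {m n : ℤ} {p : LaurentPolynomial k} (f : k[X])
    (h : HasBirkhoffDiagonal k s !![LaurentPolynomial.T m, 0; p, LaurentPolynomial.T n]) :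
    HasBirkhoffDiagonal k s !![LaurentPolynomial.T m, 0;
      p + LaurentPolynomial.T n * aeval (LaurentPolynomial.T 1 : LaurentPolynomial k) f,
      LaurentPolynomial.T n] := by
  refine of_mul_right !![1, 0; -f, 1] (by simp) ?_ h
  ext i j : 1
  fin_cases i <;> fin_cases j <;> simp [Matrix.mul_apply]

/-- Multiples of `z^m` by `k[z⁻¹]` in the lower-left entry may be dropped. -/
theorem of_add_left {m n : ℤ} {p : LaurentPolynomial k} (g : k[X])
    (h : HasBirkhoffDiagonal k s !![LaurentPolynomial.T m, 0; p, LaurentPolynomial.T n]) :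
    HasBirkhoffDiagonal k s !![LaurentPolynomial.T m, 0;
      p + LaurentPolynomial.T m * aeval (LaurentPolynomial.T (-1) : LaurentPolynomial k) g,
      LaurentPolynomial.T n] := by
  refine of_mul_left !![1, 0; -g, 1] (by simp) ?_ h
  ext i j : 1
  fin_cases i <;> fin_cases j <;> simp [Matrix.mul_apply]

end HasBirkhoffDiagonal

open Polynomial in
theorem LaurentPolynomial.aeval_T_X_pow {k : Type*} [Field k] (c : ℤ) (e : ℕ) :
    aeval (LaurentPolynomial.T c : LaurentPolynomial k) (X ^ e : k[X]) =
      LaurentPolynomial.T (e * c) := by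
  rw [map_pow, aeval_X, LaurentPolynomial.T_pow]

open Polynomial in
/-- A Laurent polynomial splits into its part of degree `> m` and its part of degree `≤ m`. -/
theorem LaurentPolynomial.exists_eq_add_aeval {k : Type*} [Field k] (m : ℤ)
    (p : LaurentPolynomial k) :
    ∃ f g : k[X], p =
      LaurentPolynomial.T (m + 1) * aeval (LaurentPolynomial.T 1 : LaurentPolynomial k) f +
      LaurentPolynomial.T m * aeval (LaurentPolynomial.T (-1) : LaurentPolynomial k) g := by
  induction p using LaurentPolynomial.induction_on' with
  | add p q hp hq =>
    obtain ⟨f, g, rfl⟩ := hp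
    obtain ⟨f', g', rfl⟩ := hq
    exact ⟨f + f', g + g', by simp only [map_add]; ring⟩
  | C_mul_T j a =>
    rcases le_or_gt j m with h | h
    · obtain ⟨e, he⟩ := Int.eq_ofNat_of_zero_le (sub_nonneg.2 h)
      refine ⟨0, Polynomial.C a * X ^ e, ?_⟩
      rw [map_zero, mul_zero, zero_add, map_mul, aeval_T_X_pow, aeval_C, mul_left_comm,
        ← LaurentPolynomial.T_add, show m + e * (-1 : ℤ) = j by lia]
      rfl
    · obtain ⟨e, he⟩ := Int.eq_ofNat_of_zero_le (show 0 ≤ j - (m + 1) by lia)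
      refine ⟨Polynomial.C a * X ^ e, 0, ?_⟩
      rw [map_zero, mul_zero, add_zero, map_mul, aeval_T_X_pow, aeval_C, mul_left_comm,
        ← LaurentPolynomial.T_add, show m + 1 + e * (1 : ℤ) = j by lia]
      rfl

open Polynomial in
theorem Polynomial.exists_eq_X_pow_mul_isCoprime {k : Type*} [Field k] {f : k[X]} (hf : f ≠ 0) :
    ∃ (e : ℕ) (u : k[X]), f = X ^ e * u ∧ IsCoprime u X := by
  obtain ⟨u, hu, hd⟩ := exists_eq_pow_rootMultiplicity_mul_and_not_dvd f hf 0
  rw [Polynomial.C_0, sub_zero] at hu hd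
  exact ⟨_, u, hu, ((irreducible_X.coprime_iff_not_dvd).2 hd).symm⟩

namespace HasBirkhoffDiagonal

open Polynomial

variable {k : Type*} [Field k]

/-- When `u` is prime to `z`, a Bézout relation between `u` and `z^e` trades the diagonal
`(z^m, z^(d+e))` for `(z^d, z^(m+e))`. -/
theorem of_isCoprime {s m d : ℤ} {e : ℕ} {u : k[X]} (hu : IsCoprime u X)
    (h : ∀ q, HasBirkhoffDiagonal k s
      !![LaurentPolynomial.T d, 0; q, LaurentPolynomial.T (m + e)]) :
    HasBirkhoffDiagonal k s !![LaurentPolynomial.T m, 0;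
      LaurentPolynomial.T d * aeval (LaurentPolynomial.T 1 : LaurentPolynomial k) u,
      LaurentPolynomial.T (d + e)] := by
  obtain ⟨a, b, hab⟩ := hu.pow_right (n := e)
  have hab' := congrArg (aeval (LaurentPolynomial.T 1 : LaurentPolynomial k)) hab
  rw [map_add, map_mul, map_mul, LaurentPolynomial.aeval_T_X_pow, mul_one, map_one] at hab'
  refine of_mul_right !![a, -X ^ e; b, u] ?_ rfl <| of_mul_left !![0, 1; -1, 0] (by simp) ?_ <|
    h (-(LaurentPolynomial.T m * aeval (LaurentPolynomial.T 1 : LaurentPolynomial k) a))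
  · rw [Matrix.det_fin_two_of, ← hab]
    ring
  · ext i j : 1
    fin_cases i <;> fin_cases j <;>
      simp [Matrix.mul_apply, Matrix.vecMul_eq_sum, -LaurentPolynomial.T_mul,
        LaurentPolynomial.T_add]
    · linear_combination LaurentPolynomial.T d * hab'
    · ring

theorem of_lowerTriangular (m n : ℤ) (p : LaurentPolynomial k) :
    HasBirkhoffDiagonal k (m + n) !![LaurentPolynomial.T m, 0; p, LaurentPolynomial.T n] := by
  induction hN : (n - m).toNat using Nat.strong_induction_on generalizing m n p with
  | _ N ih =>
  obtain ⟨f, g, rfl⟩ := LaurentPolynomial.exists_eq_add_aeval m p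
  apply of_add_left
  by_cases hf : f = 0
  · simpa [hf] using diagonal m n
  obtain ⟨e, u, rfl, hu⟩ := exists_eq_X_pow_mul_isCoprime hf
  rw [map_mul, LaurentPolynomial.aeval_T_X_pow, mul_one, ← mul_assoc, ← LaurentPolynomial.T_add]
  rcases le_or_gt n (m + 1 + e) with h | h
  · obtain ⟨c, hc⟩ := Int.eq_ofNat_of_zero_le (sub_nonneg.2 h)
    have := of_add_right (X ^ c * u) (diagonal (k := k) m n)
    rwa [zero_add, map_mul, LaurentPolynomial.aeval_T_X_pow, mul_one, ← mul_assoc,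
      ← LaurentPolynomial.T_add, show n + (c : ℤ) = m + 1 + e by lia] at this
  · obtain ⟨c, hc⟩ := Int.eq_ofNat_of_zero_le (sub_nonneg.2 h.le)
    obtain rfl : n = m + 1 + e + c := by lia
    refine of_isCoprime hu fun q => ?_
    have := ih _ (by lia) (m + 1 + e) (m + c) q rfl
    rwa [show m + 1 + e + (m + c) = m + (m + 1 + e + (c : ℤ)) by ring] at this

end HasBirkhoffDiagonal

/-- **Step 2 of Birkhoff's algorithm**: the lower triangular `2×2` matrix with diagonal
entries `z^m`, `z^n` (`m ≤ n`) and lower-left entry an arbitrary Laurent polynomial `p`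
can be diagonalized, by invertible transformations over `k[z]` (columns) and over `k[z⁻¹]`
(rows), to `diag(z^a, z^b)` with `a + b = m + n`. -/
theorem birkhoff_step2 (k : Type*) [Field k] (m n : ℤ) (hmn : m ≤ n)
    (p : LaurentPolynomial k) :
    ∃ (S S' U U' : Matrix (Fin 2) (Fin 2) (LaurentPolynomial k)) (a b : ℤ),
      a + b = m + n ∧
      S * S' = 1 ∧ S' * S = 1 ∧
      (∀ i j, InZ k (S i j)) ∧ (∀ i j, InZ k (S' i j)) ∧
      U * U' = 1 ∧ U' * U = 1 ∧
      (∀ i j, InZInv k (U i j)) ∧ (∀ i j, InZInv k (U' i j)) ∧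
      U' * !![LaurentPolynomial.T m, 0; p, LaurentPolynomial.T n] * S =
        Matrix.diagonal ![LaurentPolynomial.T a, LaurentPolynomial.T b] := by
  obtain ⟨U, S, a, b, hU, hS, hab, h⟩ := HasBirkhoffDiagonal.of_lowerTriangular m n p
  refine ⟨(Polynomial.aeval (LaurentPolynomial.T 1)).mapMatrix S,
    (Polynomial.aeval (LaurentPolynomial.T 1)).mapMatrix S.adjugate,
    (Polynomial.aeval (LaurentPolynomial.T (-1))).mapMatrix U.adjugate,
    (Polynomial.aeval (LaurentPolynomial.T (-1))).mapMatrix U, a, b, hab, ?_, ?_,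
    fun i j => ⟨S i j, rfl⟩, fun i j => ⟨S.adjugate i j, rfl⟩, ?_, ?_,
    fun i j => ⟨U.adjugate i j, rfl⟩, fun i j => ⟨U i j, rfl⟩, h⟩
  · rw [← map_mul, Matrix.mul_adjugate, hS, one_smul, map_one]
  · rw [← map_mul, Matrix.adjugate_mul, hS, one_smul, map_one]
  · rw [← map_mul, Matrix.adjugate_mul, hU, one_smul, map_one]
  · rw [← map_mul, Matrix.mul_adjugate, hU, one_smul, map_one]
end

section
/- Let A be an abelian category and M, N objects of A with Hom_A(M,N) = 0. Let ξ : 0 → M →^α K →^β N → 0 and ξ′ : 0 → M →^{α′} K′ →^{β′} N → 0 be two short exact sequences in A. Then K ≅ K′ if and only if there exist isomorphisms f : M → M and g : N → N and a morphism h : K → K′ such that h∘α = α′∘f and β′∘h = g∘β; moreover any such h is automatically an isomorphism. -/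
open CategoryTheory

/-- A morphism between the middle terms of short exact sequences extends to a morphism of short
complexes as soon as its component from the first left term to the second right term vanishes. -/
lemma CategoryTheory.ShortComplex.ShortExact.exists_hom_of_comp_eq_zero
    {C : Type*} [Category C] [Abelian C] {S T : ShortComplex C}
    (hS : S.ShortExact) (hT : T.ShortExact) (h : S.X₂ ⟶ T.X₂) (w : S.f ≫ h ≫ T.g = 0) :
    ∃ φ : S ⟶ T, φ.τ₂ = h := by
  have := hT.mono_f
  have := hS.epi_g
  exact ⟨{ τ₁ := hT.exact.lift (S.f ≫ h) (by simpa using w)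
           τ₂ := h
           τ₃ := hS.exact.desc (h ≫ T.g) w
           comm₁₂ := hT.exact.lift_f _ _
           comm₂₃ := (hS.exact.g_desc _ _).symm }, rfl⟩

/-- Morphisms of short exact sequences are determined by their middle component. -/
lemma CategoryTheory.ShortComplex.ShortExact.hom_ext_of_τ₂
    {C : Type*} [Category C] [Abelian C] {S T : ShortComplex C}
    (hS : S.ShortExact) (hT : T.ShortExact) {φ ψ : S ⟶ T} (h : φ.τ₂ = ψ.τ₂) : φ = ψ := by
  have := hT.mono_f
  have := hS.epi_g
  ext
  · rw [← cancel_mono T.f, φ.comm₁₂, ψ.comm₁₂, h]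
  · exact h
  · rw [← cancel_epi S.g, ← φ.comm₂₃, ← ψ.comm₂₃, h]

/-- Let `A` be an abelian category, `M, N` objects with `Hom(M,N) = 0`, and let
`0 → M →^α K →^β N → 0` and `0 → M →^{α'} K' →^{β'} N → 0` be two short exact sequences.
Then `K ≅ K'` iff there are isomorphisms `f : M → M`, `g : N → N` and a morphism
`h : K → K'` with `h ∘ α = α' ∘ f` and `β' ∘ h = g ∘ β`; moreover any such `h`
(for isomorphisms `f`, `g`) is automatically an isomorphism. -/
theorem ext_iso_criterion {A : Type*} [Category A] [Abelian A]
    (M N K K' : A) (hMN : ∀ φ : M ⟶ N, φ = 0)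
    (α : M ⟶ K) (β : K ⟶ N) (w : α ≫ β = 0)
    (α' : M ⟶ K') (β' : K' ⟶ N) (w' : α' ≫ β' = 0)
    (hse : (CategoryTheory.ShortComplex.mk α β w).ShortExact)
    (hse' : (CategoryTheory.ShortComplex.mk α' β' w').ShortExact) :
    (Nonempty (K ≅ K') ↔
      ∃ (f : M ≅ M) (g : N ≅ N) (h : K ⟶ K'),
        α ≫ h = f.hom ≫ α' ∧ h ≫ β' = β ≫ g.hom) ∧
    (∀ (f : M ⟶ M) (g : N ⟶ N) (h : K ⟶ K'), IsIso f → IsIso g →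
      α ≫ h = f ≫ α' → h ≫ β' = β ≫ g → IsIso h) := by
  have isIso_of_comm : ∀ (f : M ⟶ M) (g : N ⟶ N) (h : K ⟶ K'), IsIso f → IsIso g →
      α ≫ h = f ≫ α' → h ≫ β' = β ≫ g → IsIso h := fun f g h hf hg hα hβ =>
    ShortComplex.isIso₂_of_shortExact_of_isIso₁₃
      (S₁ := ShortComplex.mk α β w) (S₂ := ShortComplex.mk α' β' w')
      { τ₁ := f, τ₂ := h, τ₃ := g, comm₁₂ := hα.symm, comm₂₃ := hβ } hse hse'
  refine ⟨⟨?_, ?_⟩, isIso_of_comm⟩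
  · rintro ⟨e⟩
    obtain ⟨φ, hφ⟩ := hse.exists_hom_of_comp_eq_zero hse' e.hom (hMN _)
    obtain ⟨ψ, hψ⟩ := hse'.exists_hom_of_comp_eq_zero hse e.inv (hMN _)
    let E : ShortComplex.mk α β w ≅ ShortComplex.mk α' β' w' :=
      { hom := φ
        inv := ψ
        hom_inv_id := hse.hom_ext_of_τ₂ hse (by simp [hφ, hψ])
        inv_hom_id := hse'.hom_ext_of_τ₂ hse' (by simp [hφ, hψ]) }
    exact ⟨ShortComplex.π₁.mapIso E, ShortComplex.π₃.mapIso E, φ.τ₂, φ.comm₁₂.symm, φ.comm₂₃⟩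
  · rintro ⟨f, g, h, hα, hβ⟩
    have := isIso_of_comm f.hom g.hom h inferInstance inferInstance hα hβ
    exact ⟨asIso h⟩
end

section
/- (Dold) Let A be an abelian category of global dimension at most one, i.e. Ext²_A(X,Y) = 0 for all objects X and Y of A. Then every object F of the derived category of A whose cohomology objects H^i(F) vanish for all but finitely many i ∈ ℤ is isomorphic in the derived category to the finite direct sum ⊕_{i∈ℤ} H^i(F)[−i] of the shifts of its cohomology objects. -/
open CategoryTheory CategoryTheory.Limits

universe w v u

universe t

open Pretriangulated

namespace HomologicalComplex

variable {C : Type u} [Category.{v} C] [Abelian C]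

/-- If `K` is concentrated in degrees `≤ a`, a quasi-isomorphism from `K` to a single complex
in degree `a` is an epimorphism in degree `a`. -/
lemma epi_f_of_quasiIso_single {K : CochainComplex C ℤ} (a : ℤ) [K.IsStrictlyLE a] {X : C}
    (s : K ⟶ (single C (ComplexShape.up ℤ) a).obj X) [QuasiIso s] : Epi (s.f a) := by
  have hK : IsIso (K.iCycles a) :=
    K.isIso_iCycles a (a + 1) (by simp)
      ((K.isZero_of_isStrictlyLE a (a + 1) (by lia)).eq_of_tgt _ _)
  have hs : IsIso (((single C (ComplexShape.up ℤ) a).obj X).iCycles a) :=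
    isIso_iCycles _ a (a + 1) (by simp) (by simp)
  have hp : IsIso (((single C (ComplexShape.up ℤ) a).obj X).homologyπ a) :=
    isIso_homologyπ _ (a - 1) a (by simp) (by simp)
  have h₁ : Epi (cyclesMap s a) := by
    have : Epi (cyclesMap s a ≫ ((single C (ComplexShape.up ℤ) a).obj X).homologyπ a) := by
      rw [← homologyπ_naturality]
      infer_instance
    rw [← epi_comp_iff_of_isIso _ (((single C (ComplexShape.up ℤ) a).obj X).homologyπ a)]
    infer_instance
  have h₂ : Epi (K.iCycles a ≫ s.f a) := by
    rw [← cyclesMap_i]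
    infer_instance
  exact epi_of_epi (K.iCycles a) (s.f a)

end HomologicalComplex

namespace DerivedCategory

variable {C : Type u} [Category.{v} C] [Abelian C] [HasDerivedCategory.{w} C]

/-- A morphism of positive degree between objects of the heart is effaceable. -/
lemma exists_epi_singleFunctor_map_comp_eq_zero {X Y : C} {a b : ℤ} (hab : b < a)
    (f : (singleFunctor C a).obj X ⟶ (singleFunctor C b).obj Y) :
    ∃ (X' : C) (p : X' ⟶ X), Epi p ∧ (singleFunctor C a).map p ≫ f = 0 := by
  obtain ⟨K, _, s, hs, g, hg⟩ := right_fac_of_isStrictlyLE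
    (X := (HomologicalComplex.single C (ComplexShape.up ℤ) a).obj X)
    (Y := (HomologicalComplex.single C (ComplexShape.up ℤ) b).obj Y) f a
  have : QuasiIso s := by rwa [← isIso_Q_map_iff_quasiIso]
  have := HomologicalComplex.epi_f_of_quasiIso_single a s
  let i : (HomologicalComplex.single C (ComplexShape.up ℤ) a).obj (K.X a) ⟶ K :=
    HomologicalComplex.mkHomFromSingle (𝟙 _) (fun k hk ↦
      (K.isZero_of_isStrictlyLE a k (by simp at hk; lia)).eq_of_tgt _ _)
  let p : K.X a ⟶ X := s.f a ≫ (HomologicalComplex.singleObjXSelf (ComplexShape.up ℤ) a X).hom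
  refine ⟨K.X a, p, epi_comp _ _, ?_⟩
  have hi : (HomologicalComplex.single C (ComplexShape.up ℤ) a).map p = i ≫ s := by
    apply HomologicalComplex.from_single_hom_ext
    rw [HomologicalComplex.comp_f, HomologicalComplex.single_map_f_self,
      HomologicalComplex.mkHomFromSingle_f]
    simp [p]
  have hig : i ≫ g = 0 := by
    apply HomologicalComplex.from_single_hom_ext
    exact (HomologicalComplex.isZero_single_obj_X _ _ _ _ hab.ne').eq_of_tgt _ _
  have h : Q.map ((HomologicalComplex.single C (ComplexShape.up ℤ) a).map p) ≫
      inv (Q.map s) ≫ Q.map g = 0 := by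
    rw [hi, Q.map_comp, Category.assoc, IsIso.hom_inv_id_assoc, ← Q.map_comp, hig, Q.map_zero]
  rw [← hg] at h
  exact h

end DerivedCategory

namespace CategoryTheory.Abelian.Ext

open _root_.DerivedCategory

variable {C : Type u} [Category.{v} C] [Abelian C] [HasExt.{t} C]

/-- An `Ext`-class of positive degree is effaceable. -/
lemma exists_epi_mk₀_comp_eq_zero {X Y : C} {n : ℕ} (hn : 0 < n) (e : Ext X Y n) :
    ∃ (X' : C) (p : X' ⟶ X), Epi p ∧ (mk₀ p).comp e (zero_add n) = 0 := by
  let := HasDerivedCategory.standard C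
  let φ := ((singleFunctors C).shiftIso (n : ℤ) (-n) 0 (by simp)).app Y
  obtain ⟨X', p, hp, h⟩ := exists_epi_singleFunctor_map_comp_eq_zero (by lia) (e.hom ≫ φ.hom)
  refine ⟨X', p, hp, ext ?_⟩
  rw [comp_hom, mk₀_hom, ShiftedHom.mk₀_comp, zero_hom, ← cancel_mono φ.hom, Category.assoc, h,
    Limits.zero_comp]

/-- Vanishing of all `Ext` groups in degree `n` implies their vanishing in higher degrees. -/
lemma eq_zero_of_le {n : ℕ} (hn : ∀ (X Y : C) (e : Ext X Y n), e = 0) {m : ℕ} (hm : n ≤ m)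
    {X Y : C} (e : Ext X Y m) : e = 0 := by
  induction m, hm using Nat.le_induction generalizing X Y with
  | base => exact hn X Y e
  | succ m hm ih =>
    obtain ⟨X', p, hp, h⟩ := exists_epi_mk₀_comp_eq_zero (by lia) e
    have hS : (ShortComplex.mk (kernel.ι p) p (kernel.condition p)).ShortExact :=
      { exact := ShortComplex.exact_kernel p }
    obtain ⟨e', rfl⟩ := contravariant_sequence_exact₃ hS _ e h (add_comm 1 m)
    rw [ih e', comp_zero]

end CategoryTheory.Abelian.Ext

namespace DerivedCategory

variable {C : Type u} [Category.{v} C] [Abelian C] [HasDerivedCategory.{w} C]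

lemma singleFunctor_hom_eq_zero_of_ext [HasExt.{t} C] {X Y : C} {n : ℕ}
    (h : ∀ (e : Abelian.Ext X Y n), e = 0) {a b : ℤ} (hab : b + n = a)
    (f : (singleFunctor C a).obj X ⟶ (singleFunctor C b).obj Y) : f = 0 := by
  let φ := ((singleFunctors C).shiftIso a 0 a (by simp)).app X
  let ψ := ((singleFunctors C).shiftIso a (-n) b (by lia)).app Y
  let χ := ((singleFunctors C).shiftIso (n : ℤ) (-n) 0 (by simp)).app Y
  apply (shiftFunctor _ a).map_injective
  rw [← cancel_epi φ.inv, ← cancel_mono (ψ.hom ≫ χ.inv)]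
  simp only [Functor.map_zero, zero_comp, comp_zero]
  obtain ⟨e, he⟩ := Abelian.Ext.homEquiv.surjective
    ((φ.inv ≫ f⟦a⟧') ≫ ψ.hom ≫ χ.inv)
  rw [← he, h e]
  exact Abelian.Ext.zero_hom ..

section

variable {T : Triangle (DerivedCategory C)} (hT : T ∈ distTriang _) {a n : ℤ}
include hT

lemma isGE_obj₁_of_distTriang (h₂ : T.obj₂.IsGE a) (h₁ : T.obj₁.IsLE n)
    (h₃ : T.obj₃.IsGE (n + 1)) : T.obj₁.IsGE a := by
  rw [isGE_iff]
  intro i hi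
  by_cases hin : n < i
  · exact isZero_of_isLE _ n i hin
  · exact (HomologySequence.exact₁ T hT (i - 1) i).isZero_X₂
      ((isZero_of_isGE T.obj₃ (n + 1) (i - 1) (by lia)).eq_of_src _ _)
      ((isZero_of_isGE T.obj₂ a i hi).eq_of_tgt _ _)

lemma isLE_obj₃_of_distTriang (h₂ : T.obj₂.IsLE a) (h₁ : T.obj₁.IsLE n)
    (h₃ : T.obj₃.IsGE (n + 1)) : T.obj₃.IsLE a := by
  rw [isLE_iff]
  intro i hi
  by_cases hin : i < n + 1
  · exact isZero_of_isGE _ (n + 1) i hin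
  · exact (HomologySequence.exact₃ T hT i (i + 1)).isZero_X₂
      ((isZero_of_isLE T.obj₂ a i hi).eq_of_src _ _)
      ((isZero_of_isLE T.obj₁ n (i + 1) (by lia)).eq_of_tgt _ _)

end

lemma exists_distTriang (X : DerivedCategory C) (n : ℤ) :
    ∃ T ∈ distTriang (DerivedCategory C), T.obj₂ = X ∧ T.obj₁.IsLE n ∧ T.obj₃.IsGE (n + 1) := by
  obtain ⟨A, B, hA, hB, f, g, h, hT⟩ := TStructure.t.exists_triangle X n (n + 1) rfl
  exact ⟨_, hT, rfl, ⟨hA⟩, ⟨hB⟩⟩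

section

variable [HasExt.{t} C] (hdim : ∀ (X Y : C) (e : Abelian.Ext.{t} X Y 2), e = 0)
include hdim

/-- If `Ext²` vanishes, there are no nonzero morphisms from an object in degree `n` to
a bounded below object in degrees `≤ n - 2`. -/
lemma hom_eq_zero_of_ext_two_eq_zero {X : C} {n a : ℤ} (G : DerivedCategory C)
    (hG : G.IsGE a) (hG' : G.IsLE (n - 2)) (f : (singleFunctor C n).obj X ⟶ G) : f = 0 := by
  obtain ⟨k, hk⟩ : ∃ k : ℕ, n - 1 - k ≤ a := ⟨(n - 1 - a).toNat, by lia⟩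
  have := TStructure.t.isGE_of_ge G _ _ hk
  clear hG hk
  induction k generalizing G with
  | zero => exact (TStructure.t.isZero G (n - 2) (n - 1 - (0 : ℕ))).eq_of_tgt _ _
  | succ k ih =>
    obtain ⟨T, hT, rfl, h₁, h₃⟩ := exists_distTriang G (n - 1 - (k + 1 : ℕ))
    have h₁' := isGE_obj₁_of_distTriang hT this h₁ h₃
    have h₃' := isLE_obj₃_of_distTriang hT hG' h₁ h₃
    obtain ⟨g, rfl⟩ := Triangle.coyoneda_exact₂ T hT f
      (ih T.obj₃ h₃' _ (TStructure.t.isGE_of_ge _ _ (n - 1 - (k + 1 : ℕ) + 1) (by lia)))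
    obtain ⟨Y, ⟨e⟩⟩ := exists_iso_singleFunctor_obj_of_isGE_of_isLE T.obj₁
      (n - 1 - (k + 1 : ℕ))
    have hg : g ≫ e.hom = 0 :=
      singleFunctor_hom_eq_zero_of_ext (n := k + 2)
        (fun x ↦ Abelian.Ext.eq_zero_of_le hdim (by lia) x) (by lia) _
    rw [(cancel_mono e.hom).1 (hg.trans zero_comp.symm), zero_comp]

/-- If `Ext²` vanishes, each shifted cohomology object of a bounded below object `F` of the derived
category admits a morphism to `F` inducing an isomorphism on cohomology in the relevant degree. -/
lemma exists_singleFunctor_hom_isIso_homologyFunctor_map (F : DerivedCategory C) {a : ℤ}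
    (hF : F.IsGE a) (n : ℤ) :
    ∃ (f : (singleFunctor C n).obj ((homologyFunctor C n).obj F) ⟶ F),
      IsIso ((homologyFunctor C n).map f) := by
  obtain ⟨T, hT, rfl, h₁, h₃⟩ := exists_distTriang F n
  have h₁' := isGE_obj₁_of_distTriang hT hF h₁ h₃
  obtain ⟨T', hT', h, h₂, h₄⟩ := exists_distTriang T.obj₁ (n - 1)
  rw [← h] at h₁ h₁'
  have h₂' := isGE_obj₁_of_distTriang hT' h₁' h₂ h₄
  have h₄' := isLE_obj₃_of_distTriang hT' h₁ h₂ h₄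
  rw [sub_add_cancel] at h₄
  obtain ⟨Y, ⟨e⟩⟩ := exists_iso_singleFunctor_obj_of_isGE_of_isLE T'.obj₃ n
  have hδ : T'.mor₃ = 0 := by
    rw [← cancel_epi e.inv, comp_zero]
    exact hom_eq_zero_of_ext_two_eq_zero hdim _
      (TStructure.t.isGE_shift T'.obj₁ a 1 (a - 1))
      (TStructure.t.isLE_shift T'.obj₁ (n - 1) 1 (n - 2)) _
  obtain ⟨σ, hσ⟩ := Triangle.coyoneda_exact₃ T' hT' (𝟙 _) (by rw [hδ, comp_zero])
  have hmor₂ : IsIso ((homologyFunctor C n).map T'.mor₂) := by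
    have : Mono ((homologyFunctor C n).map T'.mor₂) :=
      (HomologySequence.mono_homologyMap_mor₂_iff T' hT' n).2
        ((isZero_of_isLE T'.obj₁ (n - 1) n (by lia)).eq_of_src _ _)
    have : Epi ((homologyFunctor C n).map T'.mor₂) :=
      (HomologySequence.epi_homologyMap_mor₂_iff T' hT' n (n + 1)).2
        ((isZero_of_isLE T'.obj₁ (n - 1) (n + 1) (by lia)).eq_of_tgt _ _)
    exact isIso_of_mono_of_epi _
  have hσ' : IsIso ((homologyFunctor C n).map σ) := by
    have : IsIso ((homologyFunctor C n).map σ ≫ (homologyFunctor C n).map T'.mor₂) := by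
      rw [← Functor.map_comp, ← hσ]
      infer_instance
    exact IsIso.of_isIso_comp_right _ ((homologyFunctor C n).map T'.mor₂)
  have hmor₁ : IsIso ((homologyFunctor C n).map T.mor₁) := by
    have : Mono ((homologyFunctor C n).map T.mor₁) :=
      (HomologySequence.mono_homologyMap_mor₁_iff T hT (n - 1) n).2
        ((isZero_of_isGE T.obj₃ (n + 1) (n - 1) (by lia)).eq_of_src _ _)
    have : Epi ((homologyFunctor C n).map T.mor₁) :=
      (HomologySequence.epi_homologyMap_mor₁_iff T hT n).2
        ((isZero_of_isGE T.obj₃ (n + 1) n (by lia)).eq_of_tgt _ _)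
    exact isIso_of_mono_of_epi _
  let g : (singleFunctor C n).obj Y ⟶ T.obj₂ := e.inv ≫ σ ≫ eqToHom h ≫ T.mor₁
  have hg : IsIso ((homologyFunctor C n).map g) := by
    simp only [g, Functor.map_comp]
    infer_instance
  let φ : (homologyFunctor C n).obj T.obj₂ ≅ Y :=
    (asIso ((homologyFunctor C n).map g)).symm ≪≫ (singleFunctorCompHomologyFunctorIso C n).app Y
  refine ⟨(singleFunctor C n).map φ.hom ≫ g, ?_⟩
  rw [Functor.map_comp]
  infer_instance

end

/-- A morphism from a finite direct sum of objects `G i` of the derived category is an isomorphism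
if `G i` has cohomology only in degree `i` and the morphism restricts to an isomorphism
on the cohomology of `G i` in degree `i`, assuming the target has no cohomology
in degrees outside the index set. -/
lemma isIso_biproduct_desc {s : Finset ℤ} (G : s → DerivedCategory C) {F : DerivedCategory C}
    (hG : ∀ (i : s) (j : ℤ), j ≠ i → IsZero ((homologyFunctor C j).obj (G i)))
    (hF : ∀ j : ℤ, j ∉ s → IsZero ((homologyFunctor C j).obj F))
    (f : ∀ i, G i ⟶ F) (hf : ∀ i : s, IsIso ((homologyFunctor C (i : ℤ)).map (f i))) :
    IsIso (biproduct.desc f) := by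
  rw [isIso_iff]
  intro j
  have hid : 𝟙 ((homologyFunctor C j).obj (⨁ G)) = ∑ i, (homologyFunctor C j).map
      (biproduct.π G i) ≫ (homologyFunctor C j).map (biproduct.ι G i) := by
    rw [← CategoryTheory.Functor.map_id, ← biproduct.total, Functor.map_sum]
    simp only [Functor.map_comp]
  have hz (i : s) (hij : j ≠ i) : (homologyFunctor C j).map (biproduct.π G i) ≫
      (homologyFunctor C j).map (biproduct.ι G i) = 0 := by
    rw [(hG i j hij).eq_of_tgt ((homologyFunctor C j).map (biproduct.π G i)) 0, zero_comp]
  by_cases hj : j ∈ s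
  · lift j to s using hj
    rw [Finset.sum_eq_single j (fun i _ hi ↦ hz i (fun h ↦ hi (Subtype.ext h.symm)))
      (by simp)] at hid
    have hι : IsIso ((homologyFunctor C (j : ℤ)).map (biproduct.ι G j)) :=
      ⟨_, by rw [← Functor.map_comp, biproduct.ι_π_self, CategoryTheory.Functor.map_id], hid.symm⟩
    have : IsIso ((homologyFunctor C (j : ℤ)).map (biproduct.ι G j) ≫
        (homologyFunctor C (j : ℤ)).map (biproduct.desc f)) := by
      rw [← Functor.map_comp, biproduct.ι_desc]
      exact hf j
    exact IsIso.of_isIso_comp_left ((homologyFunctor C (j : ℤ)).map (biproduct.ι G j)) _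
  · rw [Finset.sum_eq_zero (fun i _ ↦ hz i (fun h ↦ hj (h ▸ i.2)))] at hid
    exact isIso_of_source_target_iso_zero _
      ((IsZero.iff_id_eq_zero _).2 hid).isoZero (hF j hj).isoZero

end DerivedCategory

/-- **(Dold)** Let `A` be an abelian category of global dimension at most one, i.e. with
`Ext²(X,Y) = 0` for all objects `X, Y`.  Then every object `F` of the derived category of
`A` with only finitely many nonvanishing cohomology objects is isomorphic to the (finite)
direct sum `⊕ᵢ H^i(F)[-i]` of the shifts of its cohomology objects. -/
theorem dold_splitting (A : Type u) [Category.{v} A] [Abelian A]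
    [HasDerivedCategory.{w} A] [HasExt.{w} A]
    (hdim : ∀ (X Y : A) (e : Abelian.Ext X Y 2), e = 0)
    (F : DerivedCategory A)
    (hbound : ∃ s : Finset ℤ, ∀ i : ℤ, i ∉ s →
      IsZero ((DerivedCategory.homologyFunctor A i).obj F)) :
    ∃ s : Finset ℤ,
      (∀ i : ℤ, i ∉ s → IsZero ((DerivedCategory.homologyFunctor A i).obj F)) ∧
      Nonempty (F ≅ ⨁ (fun i : s => ((DerivedCategory.singleFunctor A 0).obj
        ((DerivedCategory.homologyFunctor A (i : ℤ)).obj F))⟦(-(i : ℤ))⟧)) := by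
  obtain ⟨s, hs⟩ := hbound
  obtain ⟨a, ha⟩ := s.bddBelow
  have hF : F.IsGE a := by
    rw [DerivedCategory.isGE_iff]
    exact fun i hi ↦ hs i fun h ↦ absurd (ha h) (by lia)
  choose f hf using
    DerivedCategory.exists_singleFunctor_hom_isIso_homologyFunctor_map hdim F hF
  let φ (i : ℤ) := ((DerivedCategory.singleFunctors A).shiftIso (-i) i 0 (by simp)).app
    ((DerivedCategory.homologyFunctor A i).obj F)
  have := DerivedCategory.isIso_biproduct_desc _ (fun (i : s) j hij ↦ ?_) hs
    (fun i : s ↦ (φ i).hom ≫ f i) (fun i ↦ ?_)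
  · exact ⟨s, hs, ⟨(asIso (biproduct.desc fun i : s ↦ (φ i).hom ≫ f i)).symm⟩⟩
  · refine IsZero.of_iso ?_ ((DerivedCategory.homologyFunctor A j).mapIso (φ i))
    rcases hij.lt_or_gt with h | h
    · exact DerivedCategory.isZero_of_isGE _ _ _ h
    · exact DerivedCategory.isZero_of_isLE _ _ _ h
  · have := hf i
    rw [Functor.map_comp]
    infer_instance
end

section
/- Let k be a field of characteristic zero and, for n ≥ 1, let J_n denote the n×n unipotent Jordan block over k (entries 1 on the diagonal and on the subdiagonal, 0 elsewhere). Then for all integers f ≥ g ≥ 1, the Kronecker (tensor) product J_f ⊗ J_g, an fg×fg matrix, is similar over k to the block-diagonal matrix ⊕_{j=1}^{g} J_{f−g−1+2j}, i.e. to the direct sum of the unipotent Jordan blocks of sizes f−g+1, f−g+3, …, f+g−1. -/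
open Kronecker

/-- The `n×n` unipotent Jordan block: entries `1` on the diagonal and on the subdiagonal,
`0` elsewhere. -/
def unipJordan (k : Type*) [Field k] (n : ℕ) : Matrix (Fin n) (Fin n) k :=
  Matrix.of fun i j => if (i : ℕ) = j then 1 else if (i : ℕ) = (j : ℕ) + 1 then 1 else 0

open Module

section Chains

variable {k V ι : Type*} [Field k] [AddCommGroup V] [Module k V] [Fintype ι]

/-- Chains of a nilpotent operator are linearly independent as soon as their last vectors are. -/
theorem linearIndependent_chains (s : ι → ℕ) (E : End k V) (w : ι → V)
    (hz : ∀ i, (E ^ s i) (w i) = 0)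
    (hli : LinearIndependent k fun i => (E ^ (s i - 1)) (w i)) :
    LinearIndependent k fun p : Σ i, Fin (s i) => (E ^ (p.2 : ℕ)) (w p.1) := by
  classical
  rw [Fintype.linearIndependent_iff]
  intro c hc
  by_contra! hne
  obtain ⟨p₀, hp₀⟩ := hne
  obtain ⟨q, hq, hmax⟩ := Finset.exists_max_image
    (Finset.univ.filter fun p : Σ i, Fin (s i) => c p ≠ 0) (fun p => s p.1 - 1 - (p.2 : ℕ))
    ⟨p₀, by simpa using hp₀⟩
  simp only [Finset.mem_filter, Finset.mem_univ, true_and] at hq hmax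
  set r := s q.1 - 1 - (q.2 : ℕ) with hr
  have hterm : ∀ p : Σ i, Fin (s i), c p • (E ^ (r + (p.2 : ℕ))) (w p.1) =
      (if r + (p.2 : ℕ) + 1 = s p.1 then c p else 0) • (E ^ (s p.1 - 1)) (w p.1) := by
    intro p
    by_cases hp : c p = 0
    · simp [hp]
    have h1 := hmax p hp
    have h2 := p.2.isLt
    split_ifs with h
    · rw [show r + (p.2 : ℕ) = s p.1 - 1 by omega]
    · obtain ⟨d, hd⟩ : ∃ d, r + (p.2 : ℕ) = d + s p.1 := ⟨r + p.2 - s p.1, by omega⟩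
      rw [hd, pow_add, End.mul_apply, hz]
      simp
  have hsum := congrArg (E ^ r) hc
  simp only [map_sum, map_smul, map_zero, ← End.mul_apply, ← pow_add, hterm] at hsum
  rw [Fintype.sum_sigma] at hsum
  simp only [← Finset.sum_smul] at hsum
  have h0 := Fintype.linearIndependent_iff.1 hli _ hsum q.1
  rw [Finset.sum_eq_single q.2] at h0
  · have := q.2.isLt
    rw [if_pos (by omega)] at h0
    exact hq h0
  · intro b _ hb
    have := q.2.isLt
    have : (b : ℕ) ≠ q.2 := fun h => hb (Fin.ext h)
    exact if_neg (by omega)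
  · simp

/-- An operator `1 + u E`, where `E` decomposes `V` into chains of lengths `s i` and `u` is an
invertible operator commuting with `E`, is a direct sum of unipotent Jordan blocks. -/
theorem exists_basis_toMatrix_eq_blockDiagonal [DecidableEq ι] (s : ι → ℕ) (E : End k V)
    (u : (End k V)ˣ) (hu : Commute (u : End k V) E) (w : ι → V)
    (hz : ∀ i, (E ^ s i) (w i) = 0)
    (hli : LinearIndependent k fun i => (E ^ (s i - 1)) (w i))
    [FiniteDimensional k V] (hcard : ∑ i, s i = finrank k V) :
    ∃ b : Basis (Σ i, Fin (s i)) k V,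
      LinearMap.toMatrix b b (1 + (u : End k V) * E) =
        Matrix.blockDiagonal' fun i => unipJordan k (s i) := by
  set N : End k V := u * E with hN
  set v : ι → V := fun i => ((u⁻¹ ^ (s i - 1) : (End k V)ˣ) : End k V) (w i) with hv
  have hu' : Commute ((u⁻¹ : (End k V)ˣ) : End k V) E := hu.units_inv_left
  have hz' : ∀ i, (N ^ s i) (v i) = 0 := by
    intro i
    have hcomm : Commute (E ^ s i) ((u⁻¹ ^ (s i - 1) : (End k V)ˣ) : End k V) := by
      rw [Units.val_pow_eq_pow_val]
      exact (hu'.symm.pow_pow _ _)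
    rw [hN, hu.mul_pow, hv, End.mul_apply, ← End.mul_apply (E ^ s i), hcomm.eq, End.mul_apply, hz]
    simp
  have htop : ∀ i, (N ^ (s i - 1)) (v i) = (E ^ (s i - 1)) (w i) := by
    intro i
    rw [hN, hu.mul_pow, (hu.pow_pow _ _).eq, hv, End.mul_apply, ← End.mul_apply _ _ (w i),
      ← Units.val_pow_eq_pow_val, ← Units.val_mul]
    simp
  have hli' := linearIndependent_chains s N v hz' (by simpa only [htop] using hli)
  let b := basisOfLinearIndependentOfCardEqFinrank' _ hli' (by simp [hcard])
  have hb : ∀ p, b p = (N ^ (p.2 : ℕ)) (v p.1) := fun p => by simp [b]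
  refine ⟨b, ?_⟩
  have hNb : ∀ p : Σ i, Fin (s i), N (b p) =
      if h : (p.2 : ℕ) + 1 < s p.1 then b ⟨p.1, ⟨p.2 + 1, h⟩⟩ else 0 := by
    intro p
    split_ifs with h
    · rw [hb, hb, ← End.mul_apply, ← pow_succ']
    · rw [hb, ← End.mul_apply, ← pow_succ', show (p.2 : ℕ) + 1 = s p.1 by omega, hz']
  ext ⟨i, a⟩ ⟨j, c⟩
  rw [LinearMap.toMatrix_apply, LinearMap.add_apply, End.one_apply, hNb,
    Matrix.blockDiagonal'_apply, map_add, Finsupp.add_apply, Basis.repr_self]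
  by_cases hij : i = j
  · subst hij
    have ha := a.isLt
    simp only [unipJordan, Matrix.of_apply, dite_true, cast_eq]
    by_cases h : (c : ℕ) + 1 < s i
    · simp only [h, dite_true, Basis.repr_self, Finsupp.single_apply, Sigma.mk.injEq, heq_eq_eq,
        true_and, Fin.ext_iff]
      split_ifs <;> first | omega | simp
    · simp only [h, dite_false, Finsupp.single_apply, Sigma.mk.injEq, heq_eq_eq,
        true_and, Fin.ext_iff, map_zero, Finsupp.zero_apply]
      split_ifs <;> first | omega | simp
  · by_cases h : (c : ℕ) + 1 < s j <;> simp [h, hij]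

end Chains

section Sl2

variable {k V : Type*} [Field k] [CharZero k] [AddCommGroup V] [Module k V]
  [FiniteDimensional k V]

/-- The string of a primitive vector of weight `n` in a finite-dimensional representation of
`sl₂` has length exactly `n + 1`. -/
theorem sl2_string {h e f : End k V} (hef : e * f - f * e = h)
    (hhe : h * e - e * h = 2 • e) (hhf : h * f - f * h = -(2 • f)) {p : V} (hp : p ≠ 0) {n : ℕ}
    (hhp : h p = (n : k) • p) (hep : e p = 0) :
    (f ^ (n + 1)) p = 0 ∧ h.HasEigenvector (-n : k) ((f ^ n) p) := by
  by_cases h0 : h = 0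
  · have hn : n = 0 := by simpa [h0, hp] using hhp.symm
    have hf : f = 0 := by
      have : (2 : k) • f = 0 := by
        rw [h0] at hhf
        rw [zero_mul, mul_zero, sub_zero, eq_comm, neg_eq_zero] at hhf
        rw [two_smul, ← two_nsmul, hhf]
      simpa using this
    subst hn
    refine ⟨by simp [hf], ?_⟩
    rw [End.hasEigenvector_iff, End.mem_eigenspace_iff]
    simp [h0, hp]
  · let _ : LieRing (End k V) := LieRing.ofAssociativeRing
    have t : IsSl2Triple h e f := ⟨h0, hef, hhe, hhf⟩
    have P : t.HasPrimitiveVectorWith p (n : k) := ⟨hp, hhp, hep⟩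
    have h1 := P.pow_toEnd_f_eq_zero_of_eq_nat rfl
    have h2 := P.pow_toEnd_f_ne_zero_of_eq_nat rfl le_rfl
    have h3 := P.lie_h_pow_toEnd_f n
    have hE : LieModule.toEnd k (End k V) V f = f := rfl
    rw [hE] at h1 h2 h3
    refine ⟨h1, ?_⟩
    rw [End.hasEigenvector_iff, End.mem_eigenspace_iff]
    refine ⟨?_, h2⟩
    rw [show (-n : k) = n - 2 * n by ring]
    exact h3

end Sl2

section Shift

variable (k : Type*) [Field k]

/-- The `a`-th standard vector of `kⁿ`, which is `0` for `a ≥ n`. -/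
def stdVec (n a : ℕ) : Fin n → k := fun j => if (j : ℕ) = a then 1 else 0

variable {k}

theorem stdVec_eq_zero {n a : ℕ} (h : n ≤ a) : stdVec k n a = 0 := by
  ext j
  have := j.isLt
  exact if_neg (by omega)

theorem stdVec_val {n : ℕ} (j : Fin n) : stdVec k n j = Pi.basisFun k (Fin n) j := by
  ext i
  simp [stdVec, Pi.single_apply, Fin.ext_iff]

theorem exists_linearMap_stdVec {V : Type*} [AddCommGroup V] [Module k V] {n : ℕ} (u : ℕ → V)
    (hu : ∀ a, n ≤ a → u a = 0) : ∃ L : (Fin n → k) →ₗ[k] V, ∀ a, L (stdVec k n a) = u a := by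
  refine ⟨(Pi.basisFun k (Fin n)).constr k fun a => u a, fun a => ?_⟩
  by_cases h : a < n
  · rw [show a = ((⟨a, h⟩ : Fin n) : ℕ) from rfl, stdVec_val, Basis.constr_basis]
  · rw [stdVec_eq_zero (not_lt.1 h), map_zero, hu a (not_lt.1 h)]

theorem linearMap_ext_stdVec {V : Type*} [AddCommGroup V] [Module k V] {n : ℕ}
    {L L' : (Fin n → k) →ₗ[k] V} (h : ∀ a, L (stdVec k n a) = L' (stdVec k n a)) : L = L' :=
  (Pi.basisFun k (Fin n)).ext fun j => by rw [← stdVec_val, h]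

/-- The `n`-dimensional irreducible representation of `sl₂`, with lowering operator the shift. -/
theorem exists_sl2_shift (k : Type*) [Field k] (n : ℕ) : ∃ h e f : End k (Fin n → k),
    e * f - f * e = h ∧ h * e - e * h = 2 • e ∧ h * f - f * h = -(2 • f) ∧
    (∀ a, f (stdVec k n a) = stdVec k n (a + 1)) ∧
    (∀ a, e (stdVec k n a) = ((a : k) * (n - a)) • stdVec k n (a - 1)) ∧
    ∀ a, h (stdVec k n a) = ((n : k) - 1 - 2 * a) • stdVec k n a := by
  obtain ⟨f, hf⟩ := exists_linearMap_stdVec (k := k) (n := n) (fun a => stdVec k n (a + 1))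
    fun a ha => stdVec_eq_zero (by omega)
  obtain ⟨e, he⟩ := exists_linearMap_stdVec (k := k) (n := n)
    (fun a => ((a : k) * (n - a)) • stdVec k n (a - 1)) fun a ha => by
      rcases ha.eq_or_lt with rfl | ha
      · simp
      · rw [stdVec_eq_zero (by omega), smul_zero]
  obtain ⟨h, hh⟩ := exists_linearMap_stdVec (k := k) (n := n)
    (fun a => ((n : k) - 1 - 2 * a) • stdVec k n a)
    fun a ha => by rw [stdVec_eq_zero ha, smul_zero]
  refine ⟨h, e, f, ?_, ?_, ?_, hf, he, hh⟩ <;> refine linearMap_ext_stdVec fun a => ?_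
  · rcases a with _ | a
    · simp [he, hf, hh]
    · simp only [LinearMap.sub_apply, End.mul_apply, he, hf, hh, map_smul, Nat.add_sub_cancel,
        ← sub_smul]
      congr 1
      push_cast
      ring
  · rcases a with _ | a
    · simp [he, hh]
    · simp only [LinearMap.sub_apply, LinearMap.smul_apply, End.mul_apply, he, hh, map_smul,
        Nat.add_sub_cancel, smul_smul, ← sub_smul, ← Nat.cast_smul_eq_nsmul k]
      congr 1
      push_cast
      ring
  · simp only [LinearMap.sub_apply, LinearMap.smul_apply, End.mul_apply, hf,
      hh, map_smul, ← sub_smul, ← Nat.cast_smul_eq_nsmul k, ← neg_smul]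
    congr 1
    push_cast
    ring

theorem shift_pow_stdVec {n : ℕ} {X : End k (Fin n → k)}
    (hX : ∀ a, X (stdVec k n a) = stdVec k n (a + 1)) (m a : ℕ) :
    (X ^ m) (stdVec k n a) = stdVec k n (a + m) := by
  induction m with
  | zero => simp
  | succ m ih => rw [pow_succ', End.mul_apply, ih, hX, add_assoc]

theorem shift_pow_eq_zero {n : ℕ} {X : End k (Fin n → k)}
    (hX : ∀ a, X (stdVec k n a) = stdVec k n (a + 1)) : X ^ n = 0 :=
  linearMap_ext_stdVec fun a => by
    rw [shift_pow_stdVec hX, stdVec_eq_zero (by omega), LinearMap.zero_apply]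

theorem exists_basis_toMatrix_eq_unipJordan {n : ℕ} (hn : 1 ≤ n) {X : End k (Fin n → k)}
    (hX : ∀ a, X (stdVec k n a) = stdVec k n (a + 1)) (u : (End k (Fin n → k))ˣ)
    (hu : Commute (u : End k (Fin n → k)) X) :
    ∃ b : Basis (Fin n) k (Fin n → k),
      LinearMap.toMatrix b b (1 + (u : End k (Fin n → k)) * X) = unipJordan k n := by
  obtain ⟨b, hb⟩ := exists_basis_toMatrix_eq_blockDiagonal (fun _ : Unit => n) X u hu
    (fun _ => stdVec k n 0) (fun _ => by simp [shift_pow_eq_zero hX])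
    (by
      rw [linearIndependent_unique_iff, shift_pow_stdVec hX]
      intro h
      have := congrFun h ⟨n - 1, by omega⟩
      simp [stdVec] at this)
    (by simp)
  refine ⟨b.reindex (Equiv.uniqueSigma _), ?_⟩
  ext i j
  have := congrFun (congrFun hb ⟨(), i⟩) ⟨(), j⟩
  simpa [LinearMap.toMatrix_apply, Matrix.blockDiagonal'_apply] using this

end Shift

section Tensor

open scoped TensorProduct

theorem commutator_rTensor_add_lTensor {k A B : Type*} [CommRing k] [AddCommGroup A] [Module k A]
    [AddCommGroup B] [Module k B] (x₁ y₁ : End k A) (x₂ y₂ : End k B) :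
    (x₁.rTensor B + x₂.lTensor A) * (y₁.rTensor B + y₂.lTensor A) -
      (y₁.rTensor B + y₂.lTensor A) * (x₁.rTensor B + x₂.lTensor A) =
      (x₁ * y₁ - y₁ * x₁).rTensor B + (x₂ * y₂ - y₂ * x₂).lTensor A := by
  refine TensorProduct.ext' fun a b => ?_
  simp only [LinearMap.sub_apply, End.mul_apply, LinearMap.add_apply, LinearMap.rTensor_tmul,
    LinearMap.lTensor_tmul, map_add, TensorProduct.sub_tmul, TensorProduct.tmul_sub]
  abel

theorem exists_primitive_coeff {k : Type*} [Field k] [CharZero k] {f i : ℕ} (hi : i < f) (g : ℕ) :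
    ∃ c : ℕ → k, c 0 = 1 ∧ c (i + 1) = 0 ∧ ∀ a < i,
      c a * ((i - a) * (g - (i - a))) = -(c (a + 1) * ((a + 1) * (f - (a + 1)))) := by
  refine ⟨fun a => ∏ l ∈ Finset.range a,
    -(((i : k) - l) * (g - (i - l)) / ((l + 1) * (f - (l + 1)))), by simp, ?_, fun a ha => ?_⟩
  · simp [Finset.prod_range_succ]
  · have h1 : (a : k) + 1 ≠ 0 := by exact_mod_cast Nat.succ_ne_zero a
    have h2 : (f : k) - (a + 1) ≠ 0 := by
      rw [sub_ne_zero]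
      exact_mod_cast (by omega : f ≠ a + 1)
    simp only [Finset.prod_range_succ]
    field_simp

/-- Existence of primitive vectors in the tensor product of two irreducible representations. -/
theorem exists_primitive {k : Type*} [Field k] [CharZero k] {f g i : ℕ} (hif : i < f) (hig : i < g)
    {h₁ e₁ : End k (Fin f → k)} {h₂ e₂ : End k (Fin g → k)}
    (he₁ : ∀ a, e₁ (stdVec k f a) = ((a : k) * (f - a)) • stdVec k f (a - 1))
    (hh₁ : ∀ a, h₁ (stdVec k f a) = ((f : k) - 1 - 2 * a) • stdVec k f a)
    (he₂ : ∀ a, e₂ (stdVec k g a) = ((a : k) * (g - a)) • stdVec k g (a - 1))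
    (hh₂ : ∀ a, h₂ (stdVec k g a) = ((g : k) - 1 - 2 * a) • stdVec k g a) :
    ∃ p : (Fin f → k) ⊗[k] (Fin g → k), p ≠ 0 ∧
      (h₁.rTensor (Fin g → k) + h₂.lTensor (Fin f → k)) p = ((f : k) + g - 2 - 2 * i) • p ∧
      (e₁.rTensor (Fin g → k) + e₂.lTensor (Fin f → k)) p = 0 := by
  obtain ⟨c, hc0, hci, hc⟩ := exists_primitive_coeff (k := k) hif g
  refine ⟨∑ a ∈ Finset.range (i + 1), c a • (stdVec k f a ⊗ₜ[k] stdVec k g (i - a)), ?_, ?_, ?_⟩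
  · intro h
    have := congrArg ((TensorProduct.lid k k).toLinearMap ∘ₗ TensorProduct.map
      (LinearMap.proj (R := k) (φ := fun _ : Fin f => k) ⟨0, by omega⟩)
      (LinearMap.proj (R := k) (φ := fun _ : Fin g => k) ⟨i, hig⟩)) h
    rw [map_sum, Finset.sum_eq_single 0] at this
    · simp [stdVec, hc0] at this
    · intro a _ ha
      simp [stdVec, ha.symm]
    · simp
  · rw [map_sum, Finset.smul_sum]
    refine Finset.sum_congr rfl fun a ha => ?_
    have hai : a ≤ i := Nat.lt_succ_iff.1 (Finset.mem_range.1 ha)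
    rw [map_smul, LinearMap.add_apply, LinearMap.rTensor_tmul, LinearMap.lTensor_tmul, hh₁, hh₂,
      TensorProduct.tmul_smul, ← TensorProduct.smul_tmul', ← add_smul, smul_comm]
    congr 1
    push_cast [Nat.cast_sub hai]
    ring
  · rw [map_sum, Finset.sum_congr rfl (g := fun a =>
      c a • (e₁ (stdVec k f a) ⊗ₜ[k] stdVec k g (i - a)) -
        c (a + 1) • (e₁ (stdVec k f (a + 1)) ⊗ₜ[k] stdVec k g (i - (a + 1)))),
      Finset.sum_range_sub', hci, he₁]
    · simp
    · intro a ha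
      rw [map_smul, LinearMap.add_apply, LinearMap.rTensor_tmul, LinearMap.lTensor_tmul, smul_add,
        sub_eq_add_neg]
      congr 1
      rcases (Nat.lt_succ_iff.1 (Finset.mem_range.1 ha)).eq_or_lt with rfl | hai
      · simp [he₂, hci]
      · rw [he₁, he₂, TensorProduct.tmul_smul, ← TensorProduct.smul_tmul', smul_smul, smul_smul,
          ← neg_smul, Nat.add_sub_cancel, Nat.sub_sub, Nat.cast_sub hai.le, hc a hai]
        push_cast
        rfl

/-- If `u (1 - Y) = 1`, then `(1 + X) ⊗ (1 + u Y)` differs from the identity by the product of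
`1 ⊗ u` with `X ⊗ 1 + 1 ⊗ Y`. -/
theorem map_one_add_one_add_mul {k A B : Type*} [CommRing k] [AddCommGroup A] [Module k A]
    [AddCommGroup B] [Module k B] (X : End k A) {u Y : End k B} (hu : u * (1 - Y) = 1) :
    TensorProduct.map (1 + X) (1 + u * Y) =
      1 + u.lTensor A * (X.rTensor B + Y.lTensor A) := by
  have hu' : ∀ y, u y = y + u (Y y) := fun y => by
    have := LinearMap.congr_fun hu y
    simp only [End.mul_apply, LinearMap.sub_apply, End.one_apply, map_sub] at this
    exact sub_eq_iff_eq_add.1 this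
  refine TensorProduct.ext' fun x y => ?_
  simp only [TensorProduct.map_tmul, LinearMap.add_apply, End.mul_apply, End.one_apply,
    LinearMap.rTensor_tmul, LinearMap.lTensor_tmul, map_add, ← hu', TensorProduct.add_tmul]
  rw [← add_assoc, add_right_comm, ← TensorProduct.tmul_add, ← hu']

end Tensor

theorem toMatrix_eq_conj_reindex {k V ι κ : Type*} [CommRing k] [AddCommGroup V] [Module k V]
    [Fintype ι] [DecidableEq ι] [Fintype κ] [DecidableEq κ] (b : Basis ι k V) (b' : Basis κ k V)
    (e : ι ≃ κ) (T : End k V) :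
    LinearMap.toMatrix b' b' T = b'.toMatrix (b.reindex e) *
      Matrix.reindex e e (LinearMap.toMatrix b b T) * (b.reindex e).toMatrix b' := by
  have h : Matrix.reindex e e (LinearMap.toMatrix b b T) =
      LinearMap.toMatrix (b.reindex e) (b.reindex e) T := by
    ext i j
    simp only [Matrix.reindex_apply, Matrix.submatrix_apply, LinearMap.toMatrix_apply,
      Basis.reindex_apply, Basis.repr_reindex_apply]
  rw [h, basis_toMatrix_mul_linearMap_toMatrix_mul_basis_toMatrix]

theorem sum_range_add_one_add_two_mul (d m : ℕ) :
    ∑ j ∈ Finset.range m, (d + 1 + 2 * j) = (m + d) * m := by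
  induction m with
  | zero => simp
  | succ m ih =>
    rw [Finset.sum_range_succ, ih]
    ring

/-- **Clebsch–Gordan rule for unipotent Jordan blocks**: over a field of characteristic
zero, for `f ≥ g ≥ 1` the Kronecker product `J_f ⊗ J_g` is similar to the block-diagonal
direct sum `⊕_{j=1}^{g} J_{f−g−1+2j}` of the unipotent Jordan blocks of sizes
`f−g+1, f−g+3, …, f+g−1`. -/
theorem kronecker_unipJordan_similar (k : Type*) [Field k] [CharZero k]
    (f g : ℕ) (hg : 1 ≤ g) (hgf : g ≤ f) :
    ∃ (e : (Σ j : Fin g, Fin (f + 2 * ((j : ℕ) + 1) - g - 1)) ≃ (Fin f × Fin g))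
      (P Q : Matrix (Fin f × Fin g) (Fin f × Fin g) k),
      P * Q = 1 ∧ Q * P = 1 ∧
      unipJordan k f ⊗ₖ unipJordan k g =
        P * (Matrix.reindex e e
          (Matrix.blockDiagonal' (fun j : Fin g => unipJordan k (f + 2 * ((j : ℕ) + 1) - g - 1)))) * Q := by
  obtain ⟨h₁, e₁, X, hef₁, hhe₁, hhf₁, hX, he₁, hh₁⟩ := exists_sl2_shift k f
  obtain ⟨h₂, e₂, Y, hef₂, hhe₂, hhf₂, hY, he₂, hh₂⟩ := exists_sl2_shift k g
  obtain ⟨v, hv⟩ := IsNilpotent.isUnit_one_sub ⟨g, shift_pow_eq_zero hY⟩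
  have hvY : Commute (v : End k (Fin g → k)) Y := by
    rw [hv]
    exact (Commute.one_left Y).sub_left (Commute.refl Y)
  obtain ⟨b₁, hb₁⟩ := exists_basis_toMatrix_eq_unipJordan (hg.trans hgf) hX 1 (Commute.one_left X)
  obtain ⟨b₂, hb₂⟩ := exists_basis_toMatrix_eq_unipJordan hg hY v⁻¹ hvY.units_inv_left
  let A := Fin f → k
  let B := Fin g → k
  have prim : ∀ j : Fin g, ∃ p : TensorProduct k A B, p ≠ 0 ∧
      (h₁.rTensor B + h₂.lTensor A) p = ((f + 2 * ((j : ℕ) + 1) - g - 1 - 1 : ℕ) : k) • p ∧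
      (e₁.rTensor B + e₂.lTensor A) p = 0 := fun j => by
    have hj := j.isLt
    obtain ⟨p, hp0, hph, hpe⟩ := exists_primitive (i := g - 1 - j) (by omega) (by omega)
      he₁ hh₁ he₂ hh₂
    refine ⟨p, hp0, hph.trans ?_, hpe⟩
    have hcast : f + 2 * ((j : ℕ) + 1) - g - 1 - 1 + 2 + 2 * (g - 1 - j) = f + g := by omega
    have hcast' := congrArg (Nat.cast (R := k)) hcast
    rw [Nat.cast_add, Nat.cast_add, Nat.cast_add f, Nat.cast_mul, Nat.cast_two] at hcast'
    rw [← hcast', add_sub_right_comm, add_sub_cancel_right, add_sub_cancel_right]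
  choose w hw0 hwh hwe using prim
  have hstr := fun j => sl2_string (h := h₁.rTensor B + h₂.lTensor A)
    (e := e₁.rTensor B + e₂.lTensor A) (f := X.rTensor B + Y.lTensor A)
    (by rw [commutator_rTensor_add_lTensor, hef₁, hef₂])
    (by rw [commutator_rTensor_add_lTensor, hhe₁, hhe₂]
        simp only [two_nsmul, LinearMap.rTensor_add, LinearMap.lTensor_add]
        abel)
    (by rw [commutator_rTensor_add_lTensor, hhf₁, hhf₂]
        simp only [two_nsmul, LinearMap.rTensor_add, LinearMap.lTensor_add, LinearMap.rTensor_neg,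
          LinearMap.lTensor_neg]
        abel)
    (hw0 j) (hwh j) (hwe j)
  have hpos : ∀ j : Fin g, f + 2 * ((j : ℕ) + 1) - g - 1 - 1 + 1 = f + 2 * ((j : ℕ) + 1) - g - 1 :=
    fun j => by omega
  let u := Units.map (Module.End.lTensorAlgHom k B A : End k B →* End k (TensorProduct k A B)) v⁻¹
  have huE : Commute (u : End k (TensorProduct k A B)) (X.rTensor B + Y.lTensor A) := by
    refine Commute.add_right ?_ (hvY.units_inv_left.map (Module.End.lTensorAlgHom k B A))
    exact TensorProduct.ext' fun a b => rfl
  obtain ⟨b, hb⟩ := exists_basis_toMatrix_eq_blockDiagonal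
    (fun j : Fin g => f + 2 * ((j : ℕ) + 1) - g - 1) (X.rTensor B + Y.lTensor A) u huE w
    (fun j => by simpa only [hpos] using (hstr j).1)
    (End.eigenvectors_linearIndependent' _ _ (fun j j' h => by
      have h := Nat.cast_injective (neg_injective h)
      exact Fin.ext (by omega)) _ fun j => (hstr j).2)
    (by
      rw [Module.finrank_tensorProduct, Module.finrank_fin_fun, Module.finrank_fin_fun]
      obtain ⟨d, rfl⟩ := Nat.exists_eq_add_of_le hgf
      rw [← sum_range_add_one_add_two_mul, Finset.sum_range]
      exact Finset.sum_congr rfl fun j _ => by omega)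
  have hT := map_one_add_one_add_mul X
    (show ((v⁻¹ : (End k B)ˣ) : End k B) * (1 - Y) = 1 by rw [← hv, v.inv_mul])
  rw [Units.val_one, one_mul] at hb₁
  let e := b.indexEquiv (b₁.tensorProduct b₂)
  refine ⟨e, (b₁.tensorProduct b₂).toMatrix (b.reindex e), (b.reindex e).toMatrix
    (b₁.tensorProduct b₂), Basis.toMatrix_mul_toMatrix_flip _ _,
    Basis.toMatrix_mul_toMatrix_flip _ _, ?_⟩
  rw [← hb, ← hb₁, ← hb₂, ← TensorProduct.toMatrix_map, hT]
  exact toMatrix_eq_conj_reindex b _ e _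
end

section
/- In the category BM(r₁,r₂) of block matrices over an algebraically closed field k: BM(r₁,r₂) contains a simple object if and only if gcd(r₁,r₂) = 1. In particular, if r₁ = r₂ = r > 1 then BM(r,r) has no simple objects. -/
/-- An object of the category `BM(r₁,r₂)` of block matrices: a triple `(B₁, B₁₂, B₂)` of
matrices of sizes `r₁×r₁`, `r₁×r₂` and `r₂×r₂`. -/
structure BMObj (k : Type*) [Field k] (r₁ r₂ : ℕ) where
  B1 : Matrix (Fin r₁) (Fin r₁) k
  B12 : Matrix (Fin r₁) (Fin r₂) k
  B2 : Matrix (Fin r₂) (Fin r₂) k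

/-- A morphism `C : B → B'` in `BM(r₁,r₂)`: a triple `(C₁, C₂₁, C₂)` of matrices of sizes
`r₁×r₁`, `r₂×r₁` and `r₂×r₂` satisfying `C₁B₁ = B′₁C₁ + B′₁₂C₂₁`, `C₁B₁₂ = B′₁₂C₂` and
`C₂B₂ + C₂₁B₁₂ = B′₂C₂`. -/
structure BMHom {k : Type*} [Field k] {r₁ r₂ : ℕ} (B B' : BMObj k r₁ r₂) where
  C1 : Matrix (Fin r₁) (Fin r₁) k
  C21 : Matrix (Fin r₂) (Fin r₁) k
  C2 : Matrix (Fin r₂) (Fin r₂) k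
  eq1 : C1 * B.B1 = B'.B1 * C1 + B'.B12 * C21
  eq2 : C1 * B.B12 = B'.B12 * C2
  eq3 : C2 * B.B2 + C21 * B.B12 = B'.B2 * C2

/-- An endomorphism of `B` is scalar if it equals `(λ·I, 0, λ·I)` for some `λ ∈ k`. -/
def BMHom.IsScalar {k : Type*} [Field k] {r₁ r₂ : ℕ} {B : BMObj k r₁ r₂}
    (C : BMHom B B) : Prop :=
  ∃ lam : k, C.C1 = lam • (1 : Matrix (Fin r₁) (Fin r₁) k) ∧ C.C21 = 0 ∧
    C.C2 = lam • (1 : Matrix (Fin r₂) (Fin r₂) k)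

/-- An object `B` of `BM(r₁,r₂)` is simple if every endomorphism of `B` is scalar. -/
def BMObj.Simple {k : Type*} [Field k] {r₁ r₂ : ℕ} (B : BMObj k r₁ r₂) : Prop :=
  ∀ C : BMHom B B, C.IsScalar

/-- Two objects `B, B'` of `BM(r₁,r₂)` are equivalent if there is a morphism `C : B → B'`
with both `C₁` and `C₂` invertible. -/
def BMEquiv {k : Type*} [Field k] {r₁ r₂ : ℕ} (B B' : BMObj k r₁ r₂) : Prop :=
  ∃ C : BMHom B B', IsUnit C.C1 ∧ IsUnit C.C2

/-- The set of equivalence classes of simple objects of `BM(r₁,r₂)`. -/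
def BMSimpleClasses (k : Type*) [Field k] (r₁ r₂ : ℕ) : Type _ :=
  Quot (fun B B' : {B : BMObj k r₁ r₂ // B.Simple} => BMEquiv B.1 B'.1)

namespace BMObj

open Matrix

variable {k : Type*} [Field k]

/-- Matrices exhibiting `k ^ n` as the direct sum of the image of `S`, mapped isomorphically
to `k ^ r` by `b`, and the image of `i`, mapped isomorphically to `k ^ s` by `p`. -/
structure IsSplitting {r s n : ℕ} (b : Matrix (Fin r) (Fin n) k) (S : Matrix (Fin n) (Fin r) k)
    (i : Matrix (Fin n) (Fin s) k) (p : Matrix (Fin s) (Fin n) k) : Prop where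
  b_mul_S : b * S = 1
  b_mul_i : b * i = 0
  p_mul_i : p * i = 1
  p_mul_S : p * S = 0
  sum_eq : i * p + S * b = 1

/-- The object of `BM(r,s)` obtained from an object of `BM(r,n)` by splitting off the part of
`k ^ n` mapped isomorphically to `k ^ r` by `B12`. -/
def reduce {r s n : ℕ} (B : BMObj k r n) (S : Matrix (Fin n) (Fin r) k)
    (i : Matrix (Fin n) (Fin s) k) (p : Matrix (Fin s) (Fin n) k) : BMObj k r s :=
  ⟨B.B1 + B.B12 * B.B2 * S, B.B12 * B.B2 * i, p * B.B2 * i⟩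

namespace IsSplitting

variable {r s n m : ℕ} {b : Matrix (Fin r) (Fin n) k} {S : Matrix (Fin n) (Fin r) k}
  {i : Matrix (Fin n) (Fin s) k} {p : Matrix (Fin s) (Fin n) k}

theorem decompose (h : IsSplitting b S i p) (x : Matrix (Fin n) (Fin m) k) :
    x = i * (p * x) + S * (b * x) := by
  rw [← Matrix.mul_assoc, ← Matrix.mul_assoc, ← Matrix.add_mul, h.sum_eq, Matrix.one_mul]

theorem decompose_right (h : IsSplitting b S i p) (x : Matrix (Fin m) (Fin n) k) :
    x = x * i * p + x * S * b := by
  rw [Matrix.mul_assoc, Matrix.mul_assoc, ← Matrix.mul_add, h.sum_eq, Matrix.mul_one]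

theorem eq_of_mul_eq (h : IsSplitting b S i p) {x y : Matrix (Fin n) (Fin m) k}
    (hp : p * x = p * y) (hb : b * x = b * y) : x = y := by
  rw [h.decompose x, hp, hb, ← h.decompose y]

theorem b_mul_S_mul (h : IsSplitting b S i p) (x : Matrix (Fin r) (Fin m) k) :
    b * (S * x) = x := by
  rw [← Matrix.mul_assoc, h.b_mul_S, Matrix.one_mul]

theorem b_mul_i_mul (h : IsSplitting b S i p) (x : Matrix (Fin s) (Fin m) k) :
    b * (i * x) = 0 := by
  rw [← Matrix.mul_assoc, h.b_mul_i, Matrix.zero_mul]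

theorem p_mul_i_mul (h : IsSplitting b S i p) (x : Matrix (Fin s) (Fin m) k) :
    p * (i * x) = x := by
  rw [← Matrix.mul_assoc, h.p_mul_i, Matrix.one_mul]

theorem p_mul_S_mul (h : IsSplitting b S i p) (x : Matrix (Fin r) (Fin m) k) :
    p * (S * x) = 0 := by
  rw [← Matrix.mul_assoc, h.p_mul_S, Matrix.zero_mul]

end IsSplitting

/-- A simple object has a simple reduction. -/
theorem Simple.reduce {r s n : ℕ} {B : BMObj k r n} {S : Matrix (Fin n) (Fin r) k}
    {i : Matrix (Fin n) (Fin s) k} {p : Matrix (Fin s) (Fin n) k}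
    (h : IsSplitting B.B12 S i p) (hB : B.Simple) : (B.reduce S i p).Simple := by
  rintro ⟨C1, X, E, e1, e2, e3⟩
  obtain ⟨B1, b, B2⟩ := B
  simp only [BMObj.reduce, Matrix.mul_assoc, Matrix.mul_add, Matrix.add_mul] at h e1 e2 e3
  obtain ⟨C2, hC2⟩ : ∃ C2, C2 = i * (E * p) + i * (X * b) + S * (C1 * b) := ⟨_, rfl⟩
  have hb : b * C2 = C1 * b := by
    simp only [hC2, Matrix.mul_add, h.b_mul_i_mul, h.b_mul_S_mul, zero_add]
  have hp : p * C2 = E * p + X * b := by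
    simp only [hC2, Matrix.mul_add, h.p_mul_i_mul, h.p_mul_S_mul, add_zero]
  have hi : C2 * i = i * E := by
    simp only [hC2, Matrix.add_mul, Matrix.mul_assoc, h.b_mul_i, h.p_mul_i, Matrix.mul_zero,
      Matrix.mul_one, add_zero]
  have hS : C2 * S = i * X + S * C1 := by
    simp only [hC2, Matrix.add_mul, Matrix.mul_assoc, h.b_mul_S, h.p_mul_S, Matrix.mul_zero,
      Matrix.mul_one, zero_add]
  have hbC (m : ℕ) (x : Matrix (Fin n) (Fin m) k) : b * (C2 * x) = C1 * (b * x) := by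
    rw [← Matrix.mul_assoc, hb, Matrix.mul_assoc]
  have hpC (m : ℕ) (x : Matrix (Fin n) (Fin m) k) :
      p * (C2 * x) = E * (p * x) + X * (b * x) := by
    rw [← Matrix.mul_assoc, hp, Matrix.add_mul, Matrix.mul_assoc, Matrix.mul_assoc]
  have hcomm : (B2 * C2 - C2 * B2) * i = 0 := by
    rw [Matrix.sub_mul, sub_eq_zero, Matrix.mul_assoc, Matrix.mul_assoc, hi]
    refine h.eq_of_mul_eq ?_ ?_
    · rw [hpC, e3]
    · rw [hbC, e2]
  obtain ⟨l, h1, -, h2⟩ := hB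
    { C1 := C1
      C21 := (B2 * C2 - C2 * B2) * S
      C2 := C2
      eq1 := by
        simp only [Matrix.sub_mul, Matrix.mul_sub, Matrix.mul_assoc, hS, hbC, Matrix.mul_add]
        rw [← sub_eq_zero] at e1 ⊢
        rw [← e1]
        abel
      eq2 := hb.symm
      eq3 := by
        have h4 := h.decompose_right (B2 * C2 - C2 * B2)
        rw [hcomm, Matrix.zero_mul, zero_add] at h4
        change C2 * B2 + (B2 * C2 - C2 * B2) * S * b = B2 * C2
        rw [← h4]
        abel }
  simp only at h1 h2
  refine ⟨l, h1, ?_, ?_⟩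
  · have := congrArg (p * ·) hS
    simpa [h2, Matrix.mul_add, h.p_mul_i_mul, h.p_mul_S_mul, h.p_mul_S] using this.symm
  · have := congrArg (p * ·) hi
    simpa [h2, h.p_mul_i_mul, h.p_mul_i] using this.symm

/-- An object with a simple reduction is simple. -/
theorem Simple.of_reduce {r s n : ℕ} {B : BMObj k r n} {S : Matrix (Fin n) (Fin r) k}
    {i : Matrix (Fin n) (Fin s) k} {p : Matrix (Fin s) (Fin n) k}
    (h : IsSplitting B.B12 S i p) (hB : (B.reduce S i p).Simple) : B.Simple := by
  rintro ⟨C1, C21, C2, e1, e2, e3⟩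
  obtain ⟨B1, b, B2⟩ := B
  simp only at h e1 e2 e3
  have hC (m : ℕ) (x : Matrix (Fin n) (Fin m) k) : C1 * (b * x) = b * (C2 * x) := by
    rw [← Matrix.mul_assoc, e2, Matrix.mul_assoc]
  have hCB (m : ℕ) (x : Matrix (Fin n) (Fin m) k) :
      C2 * (B2 * x) = B2 * (C2 * x) - C21 * (b * x) := by
    rw [eq_sub_iff_add_eq, ← Matrix.mul_assoc, ← Matrix.mul_assoc, ← Matrix.add_mul, e3,
      Matrix.mul_assoc]
  have hi : b * (C2 * i) = 0 := by rw [← hC, h.b_mul_i, Matrix.mul_zero]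
  have hS : b * (C2 * S) = C1 := by rw [← hC, h.b_mul_S, Matrix.mul_one]
  have hdi : C2 * i = i * (p * (C2 * i)) := by
    have := h.decompose (C2 * i)
    rwa [hi, Matrix.mul_zero, add_zero] at this
  have hdS : C2 * S = i * (p * (C2 * S)) + S * C1 := by
    have := h.decompose (C2 * S)
    rwa [hS] at this
  obtain ⟨l, h1, h2, h3⟩ := hB
    { C1 := C1
      C21 := p * (C2 * S)
      C2 := p * (C2 * i)
      eq1 := by
        simp only [BMObj.reduce, Matrix.mul_add, Matrix.add_mul, Matrix.mul_assoc]
        rw [hC, hCB, h.b_mul_S, Matrix.mul_one, Matrix.mul_sub, e1]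
        nth_rw 1 [hdS]
        simp only [Matrix.mul_add]
        abel
      eq2 := by
        simp only [BMObj.reduce, Matrix.mul_assoc]
        rw [hC, hCB, h.b_mul_i, Matrix.mul_zero, sub_zero, ← hdi]
      eq3 := by
        simp only [BMObj.reduce, Matrix.mul_assoc]
        rw [← hdi, ← Matrix.mul_add, ← Matrix.mul_add, ← h.decompose, hCB, h.b_mul_i,
          Matrix.mul_zero, sub_zero] }
  simp only at h1 h2 h3
  have hl : C2 = l • (1 : Matrix (Fin n) (Fin n) k) := by
    rw [h.decompose_right C2, hdi, hdS, h1, h2, h3]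
    simp only [Matrix.mul_zero, zero_add, Matrix.mul_smul, Matrix.smul_mul, Matrix.mul_one,
      ← smul_add, h.sum_eq]
  refine ⟨l, h1, ?_, hl⟩
  have h4 : C21 * b = 0 := by simpa [hl] using e3
  change C21 = 0
  rw [← Matrix.mul_one C21, ← h.b_mul_S, ← Matrix.mul_assoc, h4, Matrix.zero_mul]

/-- The coordinate splitting of `k ^ (s + r)`. -/
theorem exists_isSplitting (k : Type*) [Field k] (r s : ℕ) :
    ∃ (b : Matrix (Fin r) (Fin (s + r)) k) (S : Matrix (Fin (s + r)) (Fin r) k)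
      (i : Matrix (Fin (s + r)) (Fin s) k) (p : Matrix (Fin s) (Fin (s + r)) k),
      IsSplitting b S i p := by
  refine ⟨(1 : Matrix (Fin (s + r)) (Fin (s + r)) k).submatrix (Fin.natAdd s) id,
    (1 : Matrix (Fin (s + r)) (Fin (s + r)) k).submatrix id (Fin.natAdd s),
    (1 : Matrix (Fin (s + r)) (Fin (s + r)) k).submatrix id (Fin.castAdd r),
    (1 : Matrix (Fin (s + r)) (Fin (s + r)) k).submatrix (Fin.castAdd r) id,
    ⟨?_, ?_, ?_, ?_, ?_⟩⟩
  · rw [← Matrix.submatrix_mul _ _ _ _ _ Function.bijective_id, Matrix.one_mul]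
    ext x y
    simp [Matrix.one_apply]
  · rw [← Matrix.submatrix_mul _ _ _ _ _ Function.bijective_id, Matrix.one_mul]
    ext x y
    simp [Matrix.one_apply, Fin.ext_iff]
    lia
  · rw [← Matrix.submatrix_mul _ _ _ _ _ Function.bijective_id, Matrix.one_mul]
    ext x y
    simp [Matrix.one_apply]
  · rw [← Matrix.submatrix_mul _ _ _ _ _ Function.bijective_id, Matrix.one_mul]
    ext x y
    simp [Matrix.one_apply, Fin.ext_iff]
    lia
  · ext x y
    have h := congrFun (congrFun (Matrix.mul_one (1 : Matrix (Fin (s + r)) (Fin (s + r)) k)) x) y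
    rw [Matrix.mul_apply, Fin.sum_univ_add] at h
    exact h

/-- A surjective matrix `b` is part of a splitting. -/
theorem exists_isSplitting_of_surjective {r s : ℕ} {b : Matrix (Fin r) (Fin (s + r)) k}
    (hb : Function.Surjective b.mulVecLin) :
    ∃ (S : Matrix (Fin (s + r)) (Fin r) k) (i : Matrix (Fin (s + r)) (Fin s) k)
      (p : Matrix (Fin s) (Fin (s + r)) k), IsSplitting b S i p := by
  obtain ⟨f, hf⟩ : ∃ f, f = b.mulVecLin := ⟨_, rfl⟩
  rw [← hf] at hb
  have hfb : LinearMap.toMatrix' f = b := by rw [hf, ← Matrix.toLin'_apply', LinearMap.toMatrix'_toLin']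
  obtain ⟨g, hg⟩ := f.exists_rightInverse_of_surjective (LinearMap.range_eq_top.2 hb)
  have hfin : Module.finrank k (Fin s → k) = Module.finrank k (LinearMap.ker f) := by
    have := f.finrank_range_add_finrank_ker
    rw [LinearMap.range_eq_top.2 hb, finrank_top] at this
    simp only [Module.finrank_fin_fun] at this ⊢
    lia
  let e := LinearEquiv.ofFinrankEq _ _ hfin
  have hfg (x) : f (g x) = x := LinearMap.congr_fun hg x
  let q : (Fin (s + r) → k) →ₗ[k] LinearMap.ker f :=
    (LinearMap.id - g ∘ₗ f).codRestrict (LinearMap.ker f) fun x => by simp [hfg]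
  have hq (x) : (q x : Fin (s + r) → k) = x - g (f x) := rfl
  refine ⟨LinearMap.toMatrix' g, LinearMap.toMatrix' ((LinearMap.ker f).subtype ∘ₗ e.toLinearMap),
    LinearMap.toMatrix' (e.symm.toLinearMap ∘ₗ q), ?_⟩
  rw [← hfb]
  have hz (x : LinearMap.ker f) : f x = 0 := x.2
  constructor <;> rw [← LinearMap.toMatrix'_comp]
  · rw [hg, LinearMap.toMatrix'_id]
  · rw [← map_zero LinearMap.toMatrix']
    congr 1
    refine LinearMap.ext fun x => ?_
    simp [hz]
  · rw [← LinearMap.toMatrix'_id]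
    congr 1
    refine LinearMap.ext fun x => ?_
    have : q (e x) = e x := by
      apply Subtype.ext
      rw [hq, hz, map_zero, sub_zero]
    simp [this]
  · rw [← map_zero LinearMap.toMatrix']
    congr 1
    refine LinearMap.ext fun x => ?_
    have : q (g x) = 0 := by
      apply Subtype.ext
      rw [hq, hfg, sub_self]
      rfl
    simp [this]
  · rw [← LinearMap.toMatrix'_comp, ← map_add, ← LinearMap.toMatrix'_id]
    congr 1
    refine LinearMap.ext fun x => ?_
    simp [hq]

/-- If `B` is simple then `B12` is injective or surjective. -/
theorem Simple.injective_or_surjective {r n : ℕ} {B : BMObj k r n} (hB : B.Simple) :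
    Function.Injective B.B12.mulVecLin ∨ Function.Surjective B.B12.mulVecLin := by
  by_contra! ⟨hinj, hsurj⟩
  rw [← LinearMap.ker_eq_bot, Submodule.eq_bot_iff] at hinj
  push Not at hinj
  obtain ⟨u, hu, hu0⟩ := hinj
  rw [← LinearMap.range_eq_top, ← ne_eq, ← lt_top_iff_ne_top] at hsurj
  obtain ⟨f, hf0, hf⟩ := Submodule.exists_le_ker_of_lt_top _ hsurj
  obtain ⟨g, hg⟩ : ∃ g, g = (LinearMap.toSpanSingleton k (Fin n → k) u) ∘ₗ f := ⟨_, rfl⟩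
  have hbg : B.B12 * LinearMap.toMatrix' g = 0 := by
    rw [← LinearMap.toMatrix'_toLin' B.B12, ← LinearMap.toMatrix'_comp,
      ← map_zero LinearMap.toMatrix']
    congr 1
    refine LinearMap.ext fun x => ?_
    have : Matrix.toLin' B.B12 u = 0 := hu
    rw [hg, LinearMap.comp_apply, LinearMap.comp_apply, LinearMap.toSpanSingleton_apply, map_smul,
      this, smul_zero, LinearMap.zero_apply]
  have hgb : LinearMap.toMatrix' g * B.B12 = 0 := by
    rw [← LinearMap.toMatrix'_toLin' B.B12, ← LinearMap.toMatrix'_comp,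
      ← map_zero LinearMap.toMatrix']
    congr 1
    refine LinearMap.ext fun x => ?_
    have : f (Matrix.toLin' B.B12 x) = 0 := hf (LinearMap.mem_range_self _ x)
    rw [hg, LinearMap.comp_apply, LinearMap.comp_apply, this, map_zero, LinearMap.zero_apply]
  obtain ⟨-, -, h, -⟩ := hB
    { C1 := 0
      C21 := LinearMap.toMatrix' g
      C2 := 0
      eq1 := by simp [hbg]
      eq2 := by simp
      eq3 := by simp [hgb] }
  have hg0 : g = 0 := LinearMap.toMatrix'.map_eq_zero_iff.1 h
  apply hf0
  refine LinearMap.ext fun x => ?_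
  have := LinearMap.congr_fun hg0 x
  rw [hg, LinearMap.comp_apply, LinearMap.toSpanSingleton_apply, LinearMap.zero_apply] at this
  exact (smul_eq_zero.1 this).resolve_right hu0

theorem exists_simple_add_iff (k : Type*) [Field k] (r s : ℕ) :
    (∃ B : BMObj k r (s + r), B.Simple) ↔ ∃ B : BMObj k r s, B.Simple := by
  constructor
  · rintro ⟨B, hB⟩
    have hsurj : Function.Surjective B.B12.mulVecLin := by
      refine hB.injective_or_surjective.elim (fun hinj => ?_) id
      have hs := LinearMap.finrank_le_finrank_of_injective hinj
      simp only [Module.finrank_fin_fun] at hs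
      refine (LinearMap.injective_iff_surjective_of_finrank_eq_finrank ?_).1 hinj
      simp only [Module.finrank_fin_fun]
      lia
    obtain ⟨S, i, p, h⟩ := exists_isSplitting_of_surjective hsurj
    exact ⟨_, hB.reduce h⟩
  · rintro ⟨B, hB⟩
    obtain ⟨b, S, i, p, h⟩ := exists_isSplitting k r s
    refine ⟨⟨0, b, i * B.B2 * p + S * B.B1 * b + S * B.B12 * p⟩,
      Simple.of_reduce (S := S) (i := i) (p := p) h ?_⟩
    convert hB
    obtain ⟨B1, B12, B2⟩ := B
    simp only [reduce, Matrix.mul_add, Matrix.add_mul, Matrix.mul_assoc, h.b_mul_S_mul,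
      h.b_mul_i_mul, h.p_mul_S_mul, h.p_mul_i_mul, h.b_mul_S, h.b_mul_i, h.p_mul_S, h.p_mul_i,
      Matrix.mul_zero, Matrix.mul_one, zero_add, add_zero]

theorem exists_simple_swap {r s : ℕ} (h : ∃ B : BMObj k r s, B.Simple) :
    ∃ B : BMObj k s r, B.Simple := by
  obtain ⟨B, hB⟩ := h
  refine ⟨⟨B.B2ᵀ, B.B12ᵀ, B.B1ᵀ⟩, ?_⟩
  rintro ⟨C1, C21, C2, e1, e2, e3⟩
  simp only at e1 e2 e3
  obtain ⟨l, h1, h2, h3⟩ := hB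
    { C1 := C2ᵀ
      C21 := C21ᵀ
      C2 := C1ᵀ
      eq1 := by
        have := congrArg Matrix.transpose e3
        simpa using this.symm
      eq2 := by
        have := congrArg Matrix.transpose e2
        simpa using this.symm
      eq3 := by
        have := congrArg Matrix.transpose e1
        simpa using this.symm }
  refine ⟨l, ?_, ?_, ?_⟩
  · simpa using congrArg Matrix.transpose h3
  · simpa using congrArg Matrix.transpose h2
  · simpa using congrArg Matrix.transpose h1

theorem exists_simple_zero_iff (k : Type*) [Field k] {r : ℕ} (hr : 0 < r) :
    (∃ B : BMObj k r 0, B.Simple) ↔ r = 1 := by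
  constructor
  · rintro ⟨B, hB⟩
    by_contra hr1
    obtain ⟨l, hl, -, -⟩ := hB
      ⟨B.B1, 0, 0, by simp, Subsingleton.elim _ _, Subsingleton.elim _ _⟩
    simp only at hl
    obtain ⟨m, hm, -, -⟩ := hB
      ⟨Matrix.single ⟨0, hr⟩ ⟨0, hr⟩ 1, 0, 0, by simp [hl], Subsingleton.elim _ _,
        Subsingleton.elim _ _⟩
    simp only at hm
    have h0 := congrFun (congrFun hm ⟨0, hr⟩) ⟨0, hr⟩
    have h1 := congrFun (congrFun hm ⟨1, by lia⟩) ⟨1, by lia⟩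
    simp [Matrix.single] at h0 h1
    simp [← h1] at h0
  · rintro rfl
    refine ⟨⟨0, 0, 0⟩, fun C => ⟨C.C1 0 0, ?_, Subsingleton.elim _ _, Subsingleton.elim _ _⟩⟩
    ext x y
    fin_cases x
    fin_cases y
    simp

theorem exists_simple_iff_gcd (k : Type*) [Field k] (r s : ℕ) (h : 0 < r + s) :
    (∃ B : BMObj k r s, B.Simple) ↔ Nat.gcd r s = 1 := by
  induction hN : r + s using Nat.strong_induction_on generalizing r s with
  | _ N ih =>
    wlog hle : r ≤ s generalizing r s
    · rw [Nat.gcd_comm, ← this s r (by lia) (by lia) (by lia)]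
      exact ⟨exists_simple_swap, exists_simple_swap⟩
    rcases Nat.eq_zero_or_pos r with rfl | hr
    · rw [Nat.gcd_zero_left, ← exists_simple_zero_iff k (by lia)]
      exact ⟨exists_simple_swap, exists_simple_swap⟩
    · obtain ⟨t, rfl⟩ := Nat.exists_eq_add_of_le' hle
      rw [exists_simple_add_iff, Nat.gcd_add_self_right]
      exact ih (r + t) (by lia) r t (by lia) rfl

end BMObj

/-- Over an algebraically closed field, `BM(r₁,r₂)` contains a simple object if and only
if `gcd(r₁,r₂) = 1`; in particular for `r₁ = r₂ = r > 1` there are no simple objects. -/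
theorem bm_simple_iff_coprime (k : Type*) [Field k] [IsAlgClosed k] :
    (∀ r₁ r₂ : ℕ, 0 < r₁ → 0 < r₂ →
      ((∃ B : BMObj k r₁ r₂, B.Simple) ↔ Nat.gcd r₁ r₂ = 1)) ∧
    (∀ r : ℕ, 1 < r → ¬ ∃ B : BMObj k r r, B.Simple) := by
  refine ⟨fun r₁ r₂ h₁ _ => BMObj.exists_simple_iff_gcd k r₁ r₂ (by lia), fun r hr => ?_⟩
  rw [BMObj.exists_simple_iff_gcd k r r (by lia), Nat.gcd_self]
  exact hr.ne'
end

section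
/- In the category BM(r₁,r₂) of block matrices over an algebraically closed field k: if gcd(r₁,r₂) = 1, then the set of equivalence classes of simple objects of BM(r₁,r₂) is in bijection with the field k (the affine line 𝔸¹ over k). -/
open Matrix

/-- A triple `(B₁, B₁₂, B₂)` of matrices with rows and columns indexed by arbitrary types. -/
@[ext]
structure BlockTriple (k m n : Type*) where
  B1 : Matrix m m k
  B12 : Matrix m n k
  B2 : Matrix n n k

namespace BlockTriple

variable {k : Type*} [Field k]
variable {m n m' n' m'' n'' p : Type} [Fintype m] [Fintype n] [Fintype m'] [Fintype n']
  [Fintype m''] [Fintype n''] [Fintype p] [DecidableEq m] [DecidableEq n] [DecidableEq m']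
  [DecidableEq n'] [DecidableEq m''] [DecidableEq n''] [DecidableEq p]

/-- A morphism of block triples, possibly between triples of different sizes. -/
structure Hom (B : BlockTriple k m n) (B' : BlockTriple k m' n') where
  C1 : Matrix m' m k
  C21 : Matrix n' m k
  C2 : Matrix n' n k
  eq1 : C1 * B.B1 = B'.B1 * C1 + B'.B12 * C21
  eq2 : C1 * B.B12 = B'.B12 * C2
  eq3 : C2 * B.B2 + C21 * B.B12 = B'.B2 * C2

/-- Composition of morphisms, given by the product of block lower-triangular matrices. -/
def Hom.comp {B : BlockTriple k m n} {B' : BlockTriple k m' n'} {B'' : BlockTriple k m'' n''}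
    (D : Hom B' B'') (C : Hom B B') : Hom B B'' where
  C1 := D.C1 * C.C1
  C21 := D.C21 * C.C1 + D.C2 * C.C21
  C2 := D.C2 * C.C2
  eq1 := by
    rw [Matrix.mul_assoc, C.eq1, Matrix.mul_add, ← Matrix.mul_assoc, D.eq1, ← Matrix.mul_assoc,
      D.eq2]
    simp only [Matrix.add_mul, Matrix.mul_add, Matrix.mul_assoc, add_assoc]
  eq2 := by
    rw [Matrix.mul_assoc, C.eq2, ← Matrix.mul_assoc, D.eq2, Matrix.mul_assoc]
  eq3 := by
    rw [← Matrix.mul_assoc, ← D.eq3, Matrix.add_mul _ _ C.C2, Matrix.mul_assoc D.C21, ← C.eq2,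
      Matrix.mul_assoc D.C2 B'.B2, ← C.eq3]
    simp only [Matrix.mul_add, Matrix.add_mul, Matrix.mul_assoc]
    abel

/-- A block triple is simple if all its endomorphisms are scalar. -/
def Simple (B : BlockTriple k m n) : Prop :=
  ∀ C : Hom B B, ∃ c : k, C.C1 = c • (1 : Matrix m m k) ∧ C.C21 = 0 ∧
    C.C2 = c • (1 : Matrix n n k)

/-- Two block triples are isomorphic if there is a morphism with invertible diagonal blocks. -/
def IsIso (B : BlockTriple k m n) (B' : BlockTriple k m' n') : Prop :=
  ∃ (C : Hom B B') (D1 : Matrix m m' k) (D2 : Matrix n n' k),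
    D1 * C.C1 = 1 ∧ C.C1 * D1 = 1 ∧ D2 * C.C2 = 1 ∧ C.C2 * D2 = 1

/-- The sum of the traces of the diagonal blocks. -/
def trace (B : BlockTriple k m n) : k := B.B1.trace + B.B2.trace

theorem Hom.mul_B12_eq {B : BlockTriple k m n} {B' : BlockTriple k m' n'} (C : Hom B B')
    {D1 : Matrix m m' k} {D2 : Matrix n n' k} (h1 : D1 * C.C1 = 1) (h2' : C.C2 * D2 = 1) :
    D1 * B'.B12 = B.B12 * D2 := by
  calc D1 * B'.B12 = D1 * B'.B12 * (C.C2 * D2) := by rw [h2', Matrix.mul_one]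
    _ = (D1 * C.C1) * B.B12 * D2 := by
      rw [Matrix.mul_assoc D1 C.C1, C.eq2]; simp only [Matrix.mul_assoc]
    _ = _ := by rw [h1, Matrix.one_mul]

/-- The inverse of a morphism whose diagonal blocks have inverses `D1`, `D2`. -/
def Hom.inv {B : BlockTriple k m n} {B' : BlockTriple k m' n'} (C : Hom B B')
    {D1 : Matrix m m' k} {D2 : Matrix n n' k} (h1 : D1 * C.C1 = 1) (h1' : C.C1 * D1 = 1)
    (h2 : D2 * C.C2 = 1) (h2' : C.C2 * D2 = 1) : Hom B' B where
  C1 := D1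
  C21 := -(D2 * C.C21 * D1)
  C2 := D2
  eq1 := by
    have e1 : B.B1 * D1 = D1 * B'.B1 + D1 * B'.B12 * C.C21 * D1 := by
      calc B.B1 * D1 = (D1 * C.C1) * B.B1 * D1 := by rw [h1, Matrix.one_mul]
        _ = D1 * B'.B1 * (C.C1 * D1) + D1 * B'.B12 * C.C21 * D1 := by
          rw [Matrix.mul_assoc D1, C.eq1]
          simp only [Matrix.mul_assoc, Matrix.add_mul, Matrix.mul_add]
        _ = _ := by rw [h1', Matrix.mul_one]
    rw [e1, Matrix.mul_neg, ← Matrix.mul_assoc, ← Matrix.mul_assoc,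
      ← C.mul_B12_eq h1 h2']
    abel
  eq2 := C.mul_B12_eq h1 h2'
  eq3 := by
    have e3 : D2 * B'.B2 = B.B2 * D2 + D2 * C.C21 * B.B12 * D2 := by
      calc D2 * B'.B2 = D2 * (B'.B2 * C.C2) * D2 := by
            rw [Matrix.mul_assoc, Matrix.mul_assoc, h2', Matrix.mul_one]
        _ = (D2 * C.C2) * B.B2 * D2 + D2 * C.C21 * B.B12 * D2 := by
          rw [← C.eq3]
          simp only [Matrix.mul_assoc, Matrix.add_mul, Matrix.mul_add]
        _ = _ := by rw [h2, Matrix.one_mul]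
    rw [e3, Matrix.neg_mul, Matrix.mul_assoc _ D1, C.mul_B12_eq h1 h2']
    simp only [Matrix.mul_assoc]
    abel

theorem IsIso.refl (B : BlockTriple k m n) : IsIso B B :=
  ⟨⟨1, 0, 1, by simp, by simp, by simp⟩, 1, 1, by simp, by simp, by simp, by simp⟩

theorem IsIso.symm {B : BlockTriple k m n} {B' : BlockTriple k m' n'} (h : IsIso B B') :
    IsIso B' B := by
  obtain ⟨C, D1, D2, h1, h1', h2, h2'⟩ := h
  exact ⟨C.inv h1 h1' h2 h2', C.C1, C.C2, h1', h1, h2', h2⟩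

theorem IsIso.trans {B : BlockTriple k m n} {B' : BlockTriple k m' n'}
    {B'' : BlockTriple k m'' n''} (h : IsIso B B') (h' : IsIso B' B'') : IsIso B B'' := by
  obtain ⟨C, D1, D2, h1, h1', h2, h2'⟩ := h
  obtain ⟨E, F1, F2, g1, g1', g2, g2'⟩ := h'
  have cancel {a b c : Type} [Fintype a] [Fintype b] [Fintype c] [DecidableEq a] [DecidableEq b]
      [DecidableEq c] {P : Matrix a b k} {Q : Matrix b c k} {Q' : Matrix c b k}
      {P' : Matrix b a k} (hQ : Q * Q' = 1) (hP : P * P' = 1) : P * Q * (Q' * P') = 1 := by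
    rw [Matrix.mul_assoc, ← Matrix.mul_assoc Q, hQ, Matrix.one_mul, hP]
  exact ⟨E.comp C, D1 * F1, D2 * F2, cancel g1 h1, cancel h1' g1', cancel g2 h2, cancel h2' g2'⟩

theorem IsIso.trace_eq {B : BlockTriple k m n} {B' : BlockTriple k m' n'} (h : IsIso B B') :
    B.trace = B'.trace := by
  obtain ⟨C, D1, D2, h1, h1', h2, h2'⟩ := h
  have t1 : B.B1.trace = B'.B1.trace + (C.C21 * D1 * B'.B12).trace := by
    calc B.B1.trace = (D1 * (C.C1 * B.B1)).trace := by
          rw [← Matrix.mul_assoc, h1, Matrix.one_mul]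
      _ = (D1 * (B'.B1 * C.C1)).trace + (D1 * (B'.B12 * C.C21)).trace := by
          rw [C.eq1, Matrix.mul_add, Matrix.trace_add]
      _ = _ := by
          rw [Matrix.trace_mul_comm D1, Matrix.mul_assoc, h1', Matrix.mul_one,
            ← Matrix.mul_assoc, Matrix.trace_mul_comm _ C.C21, ← Matrix.mul_assoc]
  have t2 : B'.B2.trace = B.B2.trace + (C.C21 * D1 * B'.B12).trace := by
    calc B'.B2.trace = (B'.B2 * C.C2 * D2).trace := by
          rw [Matrix.mul_assoc, h2', Matrix.mul_one]
      _ = (C.C2 * B.B2 * D2).trace + (C.C21 * (D1 * C.C1) * B.B12 * D2).trace := by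
          rw [← C.eq3, Matrix.add_mul, Matrix.trace_add, h1, Matrix.mul_one]
      _ = _ := by
          rw [Matrix.trace_mul_comm, ← Matrix.mul_assoc, h2, Matrix.one_mul,
            Matrix.mul_assoc C.C21, Matrix.mul_assoc D1, C.eq2, ← Matrix.mul_assoc D1,
            Matrix.mul_assoc C.C21, Matrix.mul_assoc _ C.C2, h2', Matrix.mul_one,
            ← Matrix.mul_assoc]
  rw [trace, trace, t1, t2]
  ring

theorem Simple.of_isIso {B : BlockTriple k m n} {B' : BlockTriple k m' n'} (hB : B.Simple)
    (h : IsIso B B') : B'.Simple := by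
  obtain ⟨C, D1, D2, h1, h1', h2, h2'⟩ := h
  intro E
  obtain ⟨c, e1, e21, e2⟩ := hB ((C.inv h1 h1' h2 h2').comp (E.comp C))
  simp only [Hom.comp, Hom.inv] at e1 e21 e2
  have f1 : E.C1 = c • (1 : Matrix m' m' k) := by
    calc E.C1 = (C.C1 * D1) * E.C1 * (C.C1 * D1) := by simp [h1']
      _ = C.C1 * (D1 * (E.C1 * C.C1)) * D1 := by simp only [Matrix.mul_assoc]
      _ = _ := by simp [e1, h1']
  have f2 : E.C2 = c • (1 : Matrix n' n' k) := by
    calc E.C2 = (C.C2 * D2) * E.C2 * (C.C2 * D2) := by simp [h2']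
      _ = C.C2 * (D2 * (E.C2 * C.C2)) * D2 := by simp only [Matrix.mul_assoc]
      _ = _ := by simp [e2, h2']
  refine ⟨c, f1, ?_, f2⟩
  have f21 : D2 * (E.C21 * C.C1) = 0 := by
    rw [← e21, f1, f2]
    simp [Matrix.mul_add, Matrix.mul_assoc, h1]
  calc E.C21 = (C.C2 * D2) * E.C21 * (C.C1 * D1) := by simp [h1', h2']
    _ = C.C2 * (D2 * (E.C21 * C.C1)) * D1 := by simp only [Matrix.mul_assoc]
    _ = 0 := by simp [f21]

/-- The transposed block triple. -/
def dual (B : BlockTriple k m n) : BlockTriple k n m := ⟨B.B2ᵀ, B.B12ᵀ, B.B1ᵀ⟩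

/-- The transposed morphism. -/
def Hom.dual {B : BlockTriple k m n} {B' : BlockTriple k m' n'} (C : Hom B B') :
    Hom B'.dual B.dual where
  C1 := C.C2ᵀ
  C21 := C.C21ᵀ
  C2 := C.C1ᵀ
  eq1 := by
    simp only [BlockTriple.dual, ← Matrix.transpose_mul, ← Matrix.transpose_add, C.eq3]
  eq2 := by simp only [BlockTriple.dual, ← Matrix.transpose_mul, C.eq2]
  eq3 := by
    simp only [BlockTriple.dual, ← Matrix.transpose_mul, ← Matrix.transpose_add, C.eq1]

theorem trace_dual (B : BlockTriple k m n) : B.dual.trace = B.trace := by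
  simp [trace, dual, add_comm]

theorem Simple.dual {B : BlockTriple k m n} (h : B.Simple) : B.dual.Simple := by
  intro C
  obtain ⟨c, e1, e21, e2⟩ := h C.dual
  refine ⟨c, ?_, ?_, ?_⟩
  · simpa [Hom.dual] using congrArg Matrix.transpose e2
  · simpa [Hom.dual] using congrArg Matrix.transpose e21
  · simpa [Hom.dual] using congrArg Matrix.transpose e1

theorem IsIso.dual {B : BlockTriple k m n} {B' : BlockTriple k m' n'} (h : IsIso B B') :
    IsIso B'.dual B.dual := by
  obtain ⟨C, D1, D2, h1, h1', h2, h2'⟩ := h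
  refine ⟨C.dual, D2ᵀ, D1ᵀ, ?_, ?_, ?_, ?_⟩ <;>
    simp only [Hom.dual, ← Matrix.transpose_mul, h1, h1', h2, h2', Matrix.transpose_one]

/-- The block triple with `B₁ = 0` and `B₁₂ = (1 0)` whose last block is built from `A`. -/
def extend (A : BlockTriple k m p) : BlockTriple k m (m ⊕ p) :=
  ⟨0, fromCols 1 0, fromBlocks A.B1 A.B12 0 A.B2⟩

theorem trace_extend (A : BlockTriple k m p) : A.extend.trace = A.trace := by
  simp [trace, extend, Matrix.trace]

/-- The functoriality of `extend`. -/
def Hom.extend {A : BlockTriple k m p} {A' : BlockTriple k m p} (C : Hom A A') :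
    Hom A.extend A'.extend where
  C1 := C.C1
  C21 := fromRows 0 (A'.B2 * C.C21 - C.C21 * A.B1)
  C2 := fromBlocks C.C1 0 C.C21 C.C2
  eq1 := by simp [BlockTriple.extend, fromCols_mul_fromRows]
  eq2 := by
    simp [BlockTriple.extend, Matrix.mul_fromCols, ← fromRows_fromCols_eq_fromBlocks,
      fromCols_mul_fromRows]
  eq3 := by
    simp only [BlockTriple.extend, fromBlocks_multiply, fromRows_mul_fromCols, fromBlocks_add,
      C.eq1, C.eq2, ← C.eq3]
    simp [add_comm]

theorem Simple.of_extend {A : BlockTriple k m p} (h : A.extend.Simple) : A.Simple := by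
  intro C
  obtain ⟨c, e1, -, e2⟩ := h C.extend
  simp only [Hom.extend, ← fromBlocks_one, fromBlocks_smul, fromBlocks_inj, smul_zero] at e1 e2
  exact ⟨c, e1, e2.2.2.1, e2.2.2.2⟩

theorem Simple.extend {A : BlockTriple k m p} (h : A.Simple) : A.extend.Simple := by
  rintro ⟨C1, C21, C2, eq1, eq2, eq3⟩
  obtain ⟨X, Y, rfl⟩ : ∃ X Y, C21 = fromRows X Y := ⟨_, _, (fromRows_toRows C21).symm⟩
  obtain ⟨P, Q, R, S, rfl⟩ : ∃ P Q R S, C2 = fromBlocks P Q R S :=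
    ⟨_, _, _, _, (fromBlocks_toBlocks C2).symm⟩
  have hX : X = 0 := by
    simpa [BlockTriple.extend, fromCols_mul_fromRows] using eq1.symm
  have hPQ : C1 = P ∧ 0 = Q := by
    simpa [BlockTriple.extend, Matrix.mul_fromCols, ← fromRows_fromCols_eq_fromBlocks,
      fromCols_mul_fromRows, fromCols_inj.eq_iff] using eq2
  obtain ⟨rfl, rfl⟩ := hPQ
  subst hX
  simp only [BlockTriple.extend, fromBlocks_multiply, fromRows_mul_fromCols, fromBlocks_add,
    fromBlocks_inj] at eq3
  simp only [Matrix.mul_zero, Matrix.zero_mul, Matrix.mul_one, add_zero, zero_add] at eq3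
  obtain ⟨a, b, d, e⟩ := eq3
  obtain ⟨c, rfl, rfl, rfl⟩ := h ⟨C1, R, S, a, b, by rw [← e, add_comm]⟩
  have hY : Y = 0 := by simpa using d
  subst hY
  refine ⟨c, rfl, by simp, ?_⟩
  simp [← fromBlocks_one, fromBlocks_smul]

theorem IsIso.extend {A A' : BlockTriple k m p} (h : IsIso A A') :
    IsIso A.extend A'.extend := by
  obtain ⟨C, D1, D2, h1, h1', h2, h2'⟩ := h
  refine ⟨C.extend, D1, fromBlocks D1 0 (-(D2 * C.C21 * D1)) D2, h1, h1', ?_, ?_⟩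
  · simp [Hom.extend, fromBlocks_multiply, h1, h2, Matrix.mul_assoc]
  · simp [Hom.extend, fromBlocks_multiply, h1', h2', ← Matrix.mul_assoc]

/-- A simple triple with at least as many columns as rows in its off-diagonal block has
linearly independent rows there. -/
theorem Simple.linearIndependent_row {B : BlockTriple k m n} (h : B.Simple)
    (hmn : Fintype.card m ≤ Fintype.card n) : LinearIndependent k B.B12.row := by
  by_contra hrow
  have hw : ∃ w : m → k, w ≠ 0 ∧ w ᵥ* B.B12 = 0 := by
    by_contra! hw
    refine hrow (Matrix.vecMul_injective_iff.1 ?_)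
    exact (injective_iff_map_eq_zero (Matrix.vecMulLinear B.B12)).2 fun w hw' =>
      by_contra fun hne => hw w hne hw'
  have hv : ∃ v : n → k, v ≠ 0 ∧ B.B12 *ᵥ v = 0 := by
    by_contra! hv
    have hcol : LinearIndependent k B.B12.col := by
      refine Matrix.mulVec_injective_iff.1 ?_
      exact (injective_iff_map_eq_zero B.B12.mulVecLin).2 fun v hv' =>
        by_contra fun hne => hv v hne hv'
    refine hrow (linearIndependent_iff_card_le_finrank_span.2 (hmn.trans ?_))
    rw [Set.finrank, ← Matrix.rank_eq_finrank_span_row, ← Matrix.rank_transpose]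
    exact (LinearIndependent.rank_matrix (M := B.B12ᵀ) hcol).ge
  obtain ⟨w, hw0, hw⟩ := hw
  obtain ⟨v, hv0, hv⟩ := hv
  obtain ⟨c, -, h0, -⟩ := h ⟨0, vecMulVec v w, 0, by simp [Matrix.mul_vecMulVec, hv], by simp,
    by simp [Matrix.vecMulVec_mul, hw]⟩
  obtain ⟨i, hi⟩ := Function.ne_iff.mp hv0
  obtain ⟨j, hj⟩ := Function.ne_iff.mp hw0
  exact mul_ne_zero hi hj (congrFun (congrFun h0 i) j)

/-- A matrix with linearly independent rows can be completed to an invertible matrix. -/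
theorem _root_.Matrix.exists_fromRows_invertible {A : Matrix m n k}
    (hA : LinearIndependent k A.row) (e : m ⊕ p ≃ n) :
    ∃ (Q : Matrix p n k) (N : Matrix n (m ⊕ p) k),
      fromRows A Q * N = 1 ∧ N * fromRows A Q = 1 := by
  let b := Module.Basis.sumExtend hA
  have hb : ∀ i, b (Sum.inl i) = A.row i := fun i => by
    simp only [b, Module.Basis.sumExtend, Module.Basis.reindex_apply, Module.Basis.coe_extend]
    rfl
  have : Finite (m ⊕ Module.Basis.sumExtendIndex hA) := Module.Finite.finite_basis b
  have : Finite (Module.Basis.sumExtendIndex hA) := Finite.sum_right m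
  have : Fintype (Module.Basis.sumExtendIndex hA) := Fintype.ofFinite _
  have hcard : Fintype.card (Module.Basis.sumExtendIndex hA) = Fintype.card p := by
    have h1 := Module.finrank_eq_card_basis b
    rw [Module.finrank_fintype_fun_eq_card, ← Fintype.card_congr e, Fintype.card_sum,
      Fintype.card_sum] at h1
    omega
  let c := b.reindex (Equiv.sumCongr (Equiv.refl m) (Fintype.equivOfCardEq hcard))
  have hc : fromRows A (Matrix.of fun j => c (Sum.inr j)) = ((Pi.basisFun k n).toMatrix c)ᵀ := by
    ext (i | j) l
    · simp [c, hb, Module.Basis.toMatrix_apply]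
    · simp [Module.Basis.toMatrix_apply]
  refine ⟨of fun j => c (Sum.inr j), (c.toMatrix (Pi.basisFun k n))ᵀ, ?_, ?_⟩
  · rw [hc, ← Matrix.transpose_mul, Module.Basis.toMatrix_mul_toMatrix_flip, Matrix.transpose_one]
  · rw [hc, ← Matrix.transpose_mul, Module.Basis.toMatrix_mul_toMatrix_flip, Matrix.transpose_one]

theorem Simple.exists_isIso_extend {B : BlockTriple k m n} (h : B.Simple) (e : m ⊕ p ≃ n) :
    ∃ A : BlockTriple k m p, IsIso B A.extend := by
  have hc : Fintype.card m ≤ Fintype.card n := by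
    rw [← Fintype.card_congr e, Fintype.card_sum]; exact Nat.le_add_right _ _
  obtain ⟨Q, N, hN, hN'⟩ := Matrix.exists_fromRows_invertible (h.linearIndependent_row hc) e
  set M := fromRows B.B12 Q with hM
  obtain ⟨P, R, S, T, hX⟩ : ∃ P R S T, M * B.B2 * N = fromBlocks P R S T :=
    ⟨_, _, _, _, (fromBlocks_toBlocks _).symm⟩
  have hB12 : B.B12 = (fromCols 1 0 : Matrix m (m ⊕ p) k) * M := by
    simp [hM, fromCols_mul_fromRows]
  refine ⟨⟨P + B.B1, R, T⟩, ⟨1, fromRows B.B1 (-S), M, ?_, ?_, ?_⟩, 1, N, ?_, ?_, hN', hN⟩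
  · simp [BlockTriple.extend, fromCols_mul_fromRows]
  · simpa [BlockTriple.extend] using hB12
  · have : M * B.B2 = M * B.B2 * N * M := by rw [Matrix.mul_assoc _ N, hN', Matrix.mul_one]
    rw [this, hX, hB12, ← Matrix.mul_assoc, ← Matrix.add_mul]
    congr 1
    ext (i | i) (j | j) <;> simp [BlockTriple.extend]
  · simp
  · simp

theorem exists_isIso_of_equiv (B : BlockTriple k m n) (e : n ≃ n') :
    ∃ B' : BlockTriple k m n', IsIso B B' := by
  have h : (1 : Matrix n n k).submatrix id e.symm * (1 : Matrix n n k).submatrix e.symm id = 1 := by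
    rw [Matrix.submatrix_mul_equiv]; simp
  have h' : (1 : Matrix n n k).submatrix e.symm id * (1 : Matrix n n k).submatrix id e.symm
      = 1 := by
    rw [← Matrix.submatrix_mul _ _ _ _ _ Function.bijective_id]; simp
  set P := (1 : Matrix n n k).submatrix id e.symm
  set Q := (1 : Matrix n n k).submatrix e.symm id
  refine ⟨⟨B.B1, B.B12 * P, Q * B.B2 * P⟩, ⟨1, 0, Q, ?_, ?_, ?_⟩, 1, P, ?_, ?_, h, h'⟩
  · simp
  · simp [Matrix.mul_assoc, h]
  · simp [Matrix.mul_assoc, h]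
  · simp
  · simp

variable (k m n p) in
/-- The trace is a complete invariant of simple triples of given sizes and takes all values. -/
def TraceClassifies : Prop :=
  (∀ t : k, ∃ B : BlockTriple k m n, B.Simple ∧ B.trace = t) ∧
    ∀ B B' : BlockTriple k m n, B.Simple → B'.Simple → B.trace = B'.trace → IsIso B B'

theorem TraceClassifies.dual (h : TraceClassifies k m n) : TraceClassifies k n m := by
  refine ⟨fun t => ?_, fun B B' hB hB' ht => ?_⟩
  · obtain ⟨B, hB, rfl⟩ := h.1 t
    exact ⟨B.dual, hB.dual, B.trace_dual⟩
  · exact (h.2 _ _ hB'.dual hB.dual (by rw [trace_dual, trace_dual, ht])).dual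

theorem TraceClassifies.of_sum (h : TraceClassifies k m p) (e : m ⊕ p ≃ n) :
    TraceClassifies k m n := by
  refine ⟨fun t => ?_, fun B B' hB hB' ht => ?_⟩
  · obtain ⟨A, hA, rfl⟩ := h.1 t
    obtain ⟨B, hB⟩ := A.extend.exists_isIso_of_equiv e
    exact ⟨B, hA.extend.of_isIso hB, by rw [← hB.trace_eq, trace_extend]⟩
  · obtain ⟨A, hA⟩ := hB.exists_isIso_extend e
    obtain ⟨A', hA'⟩ := hB'.exists_isIso_extend e
    refine hA.trans (IsIso.trans (IsIso.extend ?_) hA'.symm)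
    refine h.2 _ _ (hB.of_isIso hA).of_extend (hB'.of_isIso hA').of_extend ?_
    rw [← trace_extend, ← trace_extend A', ← hA.trace_eq, ← hA'.trace_eq, ht]

theorem traceClassifies_of_unique_of_isEmpty [Unique m] [IsEmpty n] : TraceClassifies k m n := by
  refine ⟨fun t => ⟨⟨fun _ _ => t, 0, 0⟩, fun C => ⟨C.C1 default default, ?_, ?_, ?_⟩, ?_⟩,
    fun B B' _ _ ht => ?_⟩
  · ext i j
    simp [Subsingleton.elim i default, Subsingleton.elim j default]
  · exact Subsingleton.elim _ _
  · exact Subsingleton.elim _ _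
  · simp [trace, Matrix.trace, Matrix.diag]
  · obtain rfl : B = B' := by
      ext i j
      · simpa [trace, Matrix.trace, Subsingleton.elim i default, Subsingleton.elim j default]
          using ht
      · exact isEmptyElim j
      · exact isEmptyElim j
    exact IsIso.refl B

theorem traceClassifies_of_coprime (a b : ℕ) (h : Nat.Coprime a b) :
    TraceClassifies k (Fin a) (Fin b) := by
  induction hN : a + b using Nat.strong_induction_on generalizing a b with
  | _ N ih =>
    wlog hab : a ≤ b generalizing a b
    · exact (this b a h.symm (by omega) (by omega)).dual
    rcases Nat.eq_zero_or_pos a with rfl | ha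
    · obtain rfl : b = 1 := by simpa using h
      exact traceClassifies_of_unique_of_isEmpty.dual
    · refine (ih (a + (b - a)) (by omega) a (b - a) ((Nat.coprime_sub_self_right hab).2 h)
        rfl).of_sum (finSumFinEquiv.trans (finCongr (by omega)))

end BlockTriple

/-- A `BMObj` seen as a block triple indexed by `Fin r₁` and `Fin r₂`. -/
def BMObj.toBlockTriple {k : Type*} [Field k] {r₁ r₂ : ℕ} (B : BMObj k r₁ r₂) :
    BlockTriple k (Fin r₁) (Fin r₂) := ⟨B.B1, B.B12, B.B2⟩

theorem BMObj.simple_toBlockTriple {k : Type*} [Field k] {r₁ r₂ : ℕ} {B : BMObj k r₁ r₂} :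
    B.toBlockTriple.Simple ↔ B.Simple :=
  ⟨fun h C => h ⟨C.C1, C.C21, C.C2, C.eq1, C.eq2, C.eq3⟩,
    fun h C => h ⟨C.C1, C.C21, C.C2, C.eq1, C.eq2, C.eq3⟩⟩

theorem BMObj.isIso_toBlockTriple {k : Type*} [Field k] {r₁ r₂ : ℕ} {B B' : BMObj k r₁ r₂} :
    B.toBlockTriple.IsIso B'.toBlockTriple ↔ BMEquiv B B' := by
  constructor
  · rintro ⟨C, D1, D2, h1, h1', h2, h2'⟩
    exact ⟨⟨C.C1, C.C21, C.C2, C.eq1, C.eq2, C.eq3⟩, ⟨⟨_, D1, h1', h1⟩, rfl⟩,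
      ⟨⟨_, D2, h2', h2⟩, rfl⟩⟩
  · rintro ⟨C, ⟨u, hu⟩, ⟨v, hv⟩⟩
    exact ⟨⟨C.C1, C.C21, C.C2, C.eq1, C.eq2, C.eq3⟩, ↑u⁻¹, ↑v⁻¹, by simp [← hu], by simp [← hu],
      by simp [← hv], by simp [← hv]⟩

/-- Over an algebraically closed field `k`, if `gcd(r₁,r₂) = 1` then the equivalence
classes of simple objects of `BM(r₁,r₂)` are in bijection with `k` (the affine line). -/
theorem bm_simple_classes_bijective_to_affine_line (k : Type*) [Field k] [IsAlgClosed k]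
    (r₁ r₂ : ℕ) (hr₁ : 0 < r₁) (hr₂ : 0 < r₂) (hg : Nat.gcd r₁ r₂ = 1) :
    Nonempty (BMSimpleClasses k r₁ r₂ ≃ k) := by
  obtain ⟨hsurj, hinj⟩ := BlockTriple.traceClassifies_of_coprime (k := k) r₁ r₂ hg
  let f : BMSimpleClasses k r₁ r₂ → k := Quot.lift (fun B => B.1.toBlockTriple.trace)
    fun _ _ h => (BMObj.isIso_toBlockTriple.2 h).trace_eq
  refine ⟨Equiv.ofBijective f ⟨?_, fun t => ?_⟩⟩
  · rintro ⟨B⟩ ⟨B'⟩ h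
    exact Quot.sound (BMObj.isIso_toBlockTriple.1 (hinj _ _ (BMObj.simple_toBlockTriple.2 B.2)
      (BMObj.simple_toBlockTriple.2 B'.2) h))
  · obtain ⟨B, hB, ht⟩ := hsurj t
    exact ⟨Quot.mk _ ⟨⟨B.B1, B.B12, B.B2⟩, BMObj.simple_toBlockTriple.1 hB⟩, ht⟩
end

section
/- Self-reproduction of the matrix problem BM: let k be an algebraically closed field and r₁, r₂ positive integers. If r₁ > r₂, then there is a bijection between the set of equivalence classes of simple objects of BM(r₁,r₂) and the set of equivalence classes of simple objects of BM(r₁−r₂, r₂); symmetrically, if r₂ > r₁, then there is a bijection between the sets of equivalence classes of simple objects of BM(r₁,r₂) and of BM(r₁, r₂−r₁). -/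
namespace BMHom

variable {k : Type*} [Field k] {r₁ r₂ : ℕ} {B B' B'' : BMObj k r₁ r₂}

/-- The identity morphism. -/
def id (B : BMObj k r₁ r₂) : BMHom B B where
  C1 := 1
  C21 := 0
  C2 := 1
  eq1 := by simp
  eq2 := by simp
  eq3 := by simp

/-- Composition of morphisms, first `C`, then `D`. -/
def comp (D : BMHom B' B'') (C : BMHom B B') : BMHom B B'' where
  C1 := D.C1 * C.C1
  C21 := D.C21 * C.C1 + D.C2 * C.C21
  C2 := D.C2 * C.C2
  eq1 := by
    have h := congrArg (· * C.C1) D.eq1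
    have h' := congrArg (· * C.C21) D.eq2
    simp only [add_mul, Matrix.mul_assoc] at h h'
    rw [Matrix.mul_assoc, C.eq1, Matrix.mul_add, h, h', Matrix.mul_add, add_assoc]
  eq2 := by
    rw [Matrix.mul_assoc, C.eq2, ← Matrix.mul_assoc, D.eq2, Matrix.mul_assoc]
  eq3 := by
    have h := congrArg (D.C2 * ·) C.eq3
    have h' := congrArg (· * C.C2) D.eq3
    simp only [Matrix.mul_add, Matrix.add_mul, Matrix.mul_assoc] at h h' ⊢
    rw [C.eq2, ← h', ← h]
    abel

/-- A morphism with invertible diagonal blocks has an inverse. -/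
theorem exists_inverse (C : BMHom B B') (h1 : IsUnit C.C1) (h2 : IsUnit C.C2) :
    ∃ D : BMHom B' B, D.C1 * C.C1 = 1 ∧ C.C1 * D.C1 = 1 ∧ D.C2 * C.C2 = 1 ∧
      C.C2 * D.C2 = 1 ∧ D.C21 = -(D.C2 * C.C21 * D.C1) := by
  obtain ⟨P, hP, hP'⟩ := isUnit_iff_exists.1 h1
  obtain ⟨Q, hQ, hQ'⟩ := isUnit_iff_exists.1 h2
  have cP' : ∀ {n : ℕ} (X : Matrix (Fin r₁) (Fin n) k), P * (C.C1 * X) = X := fun X => by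
    rw [← Matrix.mul_assoc, hP', Matrix.one_mul]
  have cQ : ∀ {n : ℕ} (X : Matrix (Fin r₂) (Fin n) k), C.C2 * (Q * X) = X := fun X => by
    rw [← Matrix.mul_assoc, hQ, Matrix.one_mul]
  have cQ' : ∀ {n : ℕ} (X : Matrix (Fin r₂) (Fin n) k), Q * (C.C2 * X) = X := fun X => by
    rw [← Matrix.mul_assoc, hQ', Matrix.one_mul]
  have e2 : P * B'.B12 = B.B12 * Q := by
    have h := congrArg (fun X => P * (X * Q)) C.eq2
    simp only [Matrix.mul_assoc, cP', hQ, Matrix.mul_one] at h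
    exact h.symm
  refine ⟨⟨P, -(Q * C.C21 * P), Q, ?_, e2, ?_⟩, hP', hP, hQ', hQ, rfl⟩
  · have h := congrArg (fun X => P * (X * P)) C.eq1
    simp only [Matrix.mul_assoc, Matrix.mul_add, Matrix.add_mul, cP', hP, Matrix.mul_one] at h
    rw [h, Matrix.mul_neg, Matrix.mul_assoc, ← Matrix.mul_assoc B.B12, ← e2, Matrix.mul_assoc]
    abel
  · have h := congrArg (fun X => Q * (X * Q)) C.eq3
    simp only [Matrix.mul_assoc, Matrix.mul_add, Matrix.add_mul, cQ', hQ, Matrix.mul_one] at h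
    rw [← h, Matrix.neg_mul, Matrix.mul_assoc, Matrix.mul_assoc, e2]
    abel

end BMHom

namespace BMEquiv

variable {k : Type*} [Field k] {r₁ r₂ : ℕ} {B B' B'' : BMObj k r₁ r₂}

theorem refl (B : BMObj k r₁ r₂) : BMEquiv B B := ⟨BMHom.id B, isUnit_one, isUnit_one⟩

theorem symm (h : BMEquiv B B') : BMEquiv B' B := by
  obtain ⟨C, h1, h2⟩ := h
  obtain ⟨D, e1, e1', e2, e2', -⟩ := C.exists_inverse h1 h2
  exact ⟨D, isUnit_iff_exists.2 ⟨_, e1, e1'⟩, isUnit_iff_exists.2 ⟨_, e2, e2'⟩⟩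

theorem trans (h : BMEquiv B B') (h' : BMEquiv B' B'') : BMEquiv B B'' := by
  obtain ⟨C, h1, h2⟩ := h
  obtain ⟨D, h1', h2'⟩ := h'
  exact ⟨D.comp C, h1'.mul h1, h2'.mul h2⟩

theorem simple (h : BMEquiv B B') (hB : B.Simple) : B'.Simple := by
  intro E
  obtain ⟨C, h1, h2⟩ := h
  obtain ⟨D, e1, e1', e2, e2', e21⟩ := C.exists_inverse h1 h2
  obtain ⟨c, s1, s21, s2⟩ := hB (D.comp (E.comp C))
  have cancel : ∀ {n : ℕ} (P P' X : Matrix (Fin n) (Fin n) k), P * P' = 1 →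
      P' * (X * P) = c • (1 : Matrix (Fin n) (Fin n) k) → X = c • 1 := by
    intro n P P' X h h'
    have := congrArg (fun Y => P * (Y * P')) h'
    simpa [Matrix.mul_assoc, h, ← Matrix.mul_assoc P P'] using this
  have f1 := cancel _ _ _ e1' s1
  have f2 := cancel _ _ _ e2' s2
  refine ⟨c, f1, ?_, f2⟩
  have s := congrArg (fun Y => C.C2 * (Y * D.C1)) s21
  simp only [BMHom.comp, f1, f2, e21] at s
  simpa [Matrix.mul_add, Matrix.add_mul, Matrix.mul_assoc, e1', ← Matrix.mul_assoc C.C2 D.C2,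
    e2', ← Matrix.mul_assoc D.C1 C.C1, e1] using s

theorem equivalence : Equivalence (fun B B' : {B : BMObj k r₁ r₂ // B.Simple} =>
    BMEquiv B.1 B'.1) :=
  ⟨fun _ => refl _, symm, trans⟩

end BMEquiv

/-- An essentially surjective (on simple objects) assignment preserving and reflecting simplicity
and equivalence induces a bijection on equivalence classes of simple objects. -/
theorem BMSimpleClasses.nonempty_equiv {k : Type*} [Field k] {r₁ r₂ s₁ s₂ : ℕ}
    (F : BMObj k s₁ s₂ → BMObj k r₁ r₂)
    (hs : ∀ A, (F A).Simple ↔ A.Simple)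
    (he : ∀ A A', BMEquiv (F A) (F A') ↔ BMEquiv A A')
    (hsurj : ∀ B : BMObj k r₁ r₂, B.Simple → ∃ A, BMEquiv B (F A)) :
    Nonempty (BMSimpleClasses k s₁ s₂ ≃ BMSimpleClasses k r₁ r₂) := by
  let G : BMSimpleClasses k s₁ s₂ → BMSimpleClasses k r₁ r₂ :=
    Quot.map (fun A => ⟨F A.1, (hs A.1).2 A.2⟩) (fun A A' h => (he A.1 A'.1).2 h)
  refine ⟨Equiv.ofBijective G ⟨?_, ?_⟩⟩
  · rintro ⟨A⟩ ⟨A'⟩ h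
    exact Quot.sound ((he _ _).1 (BMEquiv.equivalence.eqvGen_iff.1 (Quot.eqvGen_exact h)))
  · rintro ⟨B, hB⟩
    obtain ⟨A, hA⟩ := hsurj B hB
    exact ⟨Quot.mk _ ⟨A, (hs A).1 (hA.simple hB)⟩, Quot.sound hA.symm⟩

section Duality

variable {k : Type*} [Field k] {r₁ r₂ : ℕ}

/-- The dual object, given by transposing and exchanging the two diagonal blocks. -/
def BMObj.dual (B : BMObj k r₁ r₂) : BMObj k r₂ r₁ :=
  ⟨B.B2.transpose, B.B12.transpose, B.B1.transpose⟩

/-- Duality on morphisms is contravariant. -/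
def BMHom.dual {B B' : BMObj k r₁ r₂} (C : BMHom B B') : BMHom B'.dual B.dual where
  C1 := C.C2.transpose
  C21 := C.C21.transpose
  C2 := C.C1.transpose
  eq1 := by simpa [BMObj.dual] using (congrArg Matrix.transpose C.eq3).symm
  eq2 := by simpa [BMObj.dual] using (congrArg Matrix.transpose C.eq2).symm
  eq3 := by simpa [BMObj.dual] using (congrArg Matrix.transpose C.eq1).symm

theorem BMObj.Simple.of_dual {B : BMObj k r₁ r₂} (h : B.dual.Simple) : B.Simple := by
  intro C
  obtain ⟨c, h1, h21, h2⟩ := h C.dual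
  refine ⟨c, ?_, ?_, ?_⟩
  · simpa [BMHom.dual] using congrArg Matrix.transpose h2
  · simpa [BMHom.dual] using congrArg Matrix.transpose h21
  · simpa [BMHom.dual] using congrArg Matrix.transpose h1

theorem BMEquiv.dual {B B' : BMObj k r₁ r₂} (h : BMEquiv B B') : BMEquiv B.dual B'.dual := by
  obtain ⟨C, h1, h2⟩ := h.symm
  exact ⟨C.dual, (Matrix.isUnit_transpose _).2 h2, (Matrix.isUnit_transpose _).2 h1⟩

theorem BMSimpleClasses.nonempty_equiv_swap (k : Type*) [Field k] (r₁ r₂ : ℕ) :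
    Nonempty (BMSimpleClasses k r₁ r₂ ≃ BMSimpleClasses k r₂ r₁) :=
  nonempty_equiv BMObj.dual
    (fun A => ⟨BMObj.Simple.of_dual, fun h => BMObj.Simple.of_dual (B := A.dual) h⟩)
    (fun _ _ => ⟨BMEquiv.dual, BMEquiv.dual⟩)
    (fun B _ => ⟨B.dual, BMEquiv.refl B⟩)

end Duality

/-- A decomposition of `k ^ r` as a direct sum of copies of `k ^ n` and `k ^ m`, given by the
matrices of the inclusions `J`, `K` and of the projections `J'`, `K'`. -/
structure BlockFrame (k : Type*) [Field k] (r n m : ℕ) where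
  J : Matrix (Fin r) (Fin n) k
  K : Matrix (Fin r) (Fin m) k
  J' : Matrix (Fin n) (Fin r) k
  K' : Matrix (Fin m) (Fin r) k
  J'_J : J' * J = 1
  K'_K : K' * K = 1
  J'_K : J' * K = 0
  K'_J : K' * J = 0
  sum_eq : J * J' + K * K' = 1

namespace BlockFrame

variable {k : Type*} [Field k] {r n m q : ℕ}

/-- The frame attached to a linear isomorphism `k ^ n × k ^ m ≃ k ^ r`. -/
def ofLinearEquiv (φ : ((Fin n → k) × (Fin m → k)) ≃ₗ[k] (Fin r → k)) : BlockFrame k r n m where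
  J := (φ.toLinearMap ∘ₗ LinearMap.inl k _ _).toMatrix'
  K := (φ.toLinearMap ∘ₗ LinearMap.inr k _ _).toMatrix'
  J' := (LinearMap.fst k _ _ ∘ₗ φ.symm.toLinearMap).toMatrix'
  K' := (LinearMap.snd k _ _ ∘ₗ φ.symm.toLinearMap).toMatrix'
  J'_J := by
    rw [← LinearMap.toMatrix'_comp, ← LinearMap.toMatrix'_id]
    exact congrArg _ (LinearMap.ext fun x => by simp)
  K'_K := by
    rw [← LinearMap.toMatrix'_comp, ← LinearMap.toMatrix'_id]
    exact congrArg _ (LinearMap.ext fun x => by simp)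
  J'_K := by
    rw [← LinearMap.toMatrix'_comp, ← map_zero LinearMap.toMatrix']
    exact congrArg _ (LinearMap.ext fun x => by simp)
  K'_J := by
    rw [← LinearMap.toMatrix'_comp, ← map_zero LinearMap.toMatrix']
    exact congrArg _ (LinearMap.ext fun x => by simp)
  sum_eq := by
    rw [← LinearMap.toMatrix'_comp, ← LinearMap.toMatrix'_comp, ← map_add,
      ← LinearMap.toMatrix'_id]
    congr 1
    refine LinearMap.ext fun x => ?_
    simp [← map_add]

theorem nonempty (h : n + m = r) : Nonempty (BlockFrame k r n m) :=
  ⟨ofLinearEquiv (LinearEquiv.ofFinrankEq _ _ (by simp [h]))⟩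

theorem exists_of_injective (h : n + m = r) (M : Matrix (Fin r) (Fin n) k)
    (hM : Function.Injective M.mulVec) : ∃ F : BlockFrame k r n m, F.J = M := by
  have hf : Function.Injective (Matrix.toLin' M) := hM
  obtain ⟨W, hW⟩ := (LinearMap.range (Matrix.toLin' M)).exists_isCompl
  have hd := Submodule.finrank_add_eq_of_isCompl hW
  rw [LinearMap.finrank_range_of_inj hf] at hd
  simp only [Module.finrank_fin_fun] at hd
  let ψ : (Fin m → k) ≃ₗ[k] W := LinearEquiv.ofFinrankEq _ _ (by
    rw [Module.finrank_fin_fun]; omega)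
  refine ⟨ofLinearEquiv (((LinearEquiv.ofInjective _ hf).prodCongr ψ).trans
    (Submodule.prodEquivOfIsCompl _ _ hW)), ?_⟩
  refine Eq.trans (congrArg LinearMap.toMatrix' (LinearMap.ext fun x => ?_))
    (LinearMap.toMatrix'_toLin' M)
  simp

variable (F : BlockFrame k r n m)

theorem J'_J_mul (X : Matrix (Fin n) (Fin q) k) : F.J' * (F.J * X) = X := by
  rw [← Matrix.mul_assoc, F.J'_J, Matrix.one_mul]

theorem K'_K_mul (X : Matrix (Fin m) (Fin q) k) : F.K' * (F.K * X) = X := by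
  rw [← Matrix.mul_assoc, F.K'_K, Matrix.one_mul]

theorem J'_K_mul (X : Matrix (Fin m) (Fin q) k) : F.J' * (F.K * X) = 0 := by
  rw [← Matrix.mul_assoc, F.J'_K, Matrix.zero_mul]

theorem K'_J_mul (X : Matrix (Fin n) (Fin q) k) : F.K' * (F.J * X) = 0 := by
  rw [← Matrix.mul_assoc, F.K'_J, Matrix.zero_mul]

/-- Two matrices with `r` rows agree if their components in a frame do. -/
theorem ext_left {X Y : Matrix (Fin r) (Fin q) k} (hJ : F.J' * X = F.J' * Y)
    (hK : F.K' * X = F.K' * Y) : X = Y := by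
  rw [← Matrix.one_mul X, ← Matrix.one_mul Y, ← F.sum_eq]
  simp only [Matrix.add_mul, Matrix.mul_assoc, hJ, hK]

/-- Two matrices with `r` columns agree if their components in a frame do. -/
theorem ext_right {X Y : Matrix (Fin q) (Fin r) k} (hJ : X * F.J = Y * F.J)
    (hK : X * F.K = Y * F.K) : X = Y := by
  rw [← Matrix.mul_one X, ← Matrix.mul_one Y, ← F.sum_eq]
  simp only [Matrix.mul_add, ← Matrix.mul_assoc, hJ, hK]

/-- Two square matrices agree if their four blocks in a frame do. -/
theorem ext_block {X Y : Matrix (Fin r) (Fin r) k}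
    (h11 : F.J' * (X * F.J) = F.J' * (Y * F.J)) (h12 : F.J' * (X * F.K) = F.J' * (Y * F.K))
    (h21 : F.K' * (X * F.J) = F.K' * (Y * F.J)) (h22 : F.K' * (X * F.K) = F.K' * (Y * F.K)) :
    X = Y :=
  F.ext_right (F.ext_left h11 h21) (F.ext_left h12 h22)

theorem block_mul (X Y : Matrix (Fin r) (Fin r) k) {p : ℕ} (P : Matrix (Fin p) (Fin r) k)
    (Q : Matrix (Fin r) (Fin q) k) :
    P * (X * (Y * Q)) =
      P * (X * (F.J * (F.J' * (Y * Q)))) + P * (X * (F.K * (F.K' * (Y * Q)))) := by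
  have h : Y * Q = (F.J * F.J' + F.K * F.K') * (Y * Q) := by rw [F.sum_eq, Matrix.one_mul]
  conv_lhs => rw [h]
  simp only [Matrix.add_mul, Matrix.mul_add, Matrix.mul_assoc]

/-- The object of `BM(r, n)` with `B₁₂` the inclusion `J`, `B₂ = 0`, and `B₁` having blocks
`B₂, 0, B₁₂, B₁` of the object `A` of `BM(m, n)`. -/
def enlarge (A : BMObj k m n) : BMObj k r n where
  B1 := F.J * (A.B2 * F.J') + F.K * (A.B12 * F.J') + F.K * (A.B1 * F.K')
  B12 := F.J
  B2 := 0

/-- The action of `enlarge` on morphisms. -/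
def enlargeHom {A A' : BMObj k m n} (C : BMHom A A') :
    BMHom (F.enlarge A) (F.enlarge A') where
  C1 := F.J * (C.C2 * F.J') + F.J * (C.C21 * F.K') + F.K * (C.C1 * F.K')
  C21 := (C.C21 * A.B1 - A'.B2 * C.C21) * F.K'
  C2 := C.C2
  eq1 := by
    have h1 := C.eq1
    have h2 := C.eq2
    have h3 := C.eq3
    apply F.ext_block <;>
    simp [enlarge, Matrix.mul_add, Matrix.add_mul, Matrix.sub_mul, Matrix.mul_sub,
      Matrix.mul_assoc, J'_J_mul, K'_K_mul, J'_K_mul, K'_J_mul, J'_J, J'_K, K'_J, K'_K, h1, h2, ← h3]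
    try abel
  eq2 := by
    simp [enlarge, Matrix.add_mul, Matrix.mul_assoc, J'_J, K'_J]
  eq3 := by
    simp [enlarge, Matrix.mul_assoc, K'_J]

theorem K'_C1_J {A A' : BMObj k m n} (D : BMHom (F.enlarge A) (F.enlarge A')) :
    F.K' * (D.C1 * F.J) = 0 := by
  rw [show D.C1 * F.J = F.J * D.C2 from D.eq2, K'_J_mul]

theorem J'_C1_J {A A' : BMObj k m n} (D : BMHom (F.enlarge A) (F.enlarge A')) :
    F.J' * (D.C1 * F.J) = D.C2 := by
  rw [show D.C1 * F.J = F.J * D.C2 from D.eq2, J'_J_mul]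

theorem C21_J {A A' : BMObj k m n} (D : BMHom (F.enlarge A) (F.enlarge A')) :
    D.C21 * F.J = 0 := by
  simpa [enlarge] using D.eq3

/-- The blocks of the first equation satisfied by a morphism between enlarged objects. -/
theorem block_eqs {A A' : BMObj k m n} (D : BMHom (F.enlarge A) (F.enlarge A')) :
    D.C2 * A.B2 + F.J' * (D.C1 * F.K) * A.B12 = A'.B2 * D.C2 ∧
    F.J' * (D.C1 * F.K) * A.B1 = A'.B2 * (F.J' * (D.C1 * F.K)) + D.C21 * F.K ∧
    F.K' * (D.C1 * F.K) * A.B12 = A'.B12 * D.C2 ∧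
    F.K' * (D.C1 * F.K) * A.B1 =
      A'.B1 * (F.K' * (D.C1 * F.K)) + A'.B12 * (F.J' * (D.C1 * F.K)) := by
  have hC : D.C1 = F.J * (D.C2 * F.J') + F.J * (F.J' * (D.C1 * F.K) * F.K') +
      F.K * (F.K' * (D.C1 * F.K) * F.K') := by
    apply F.ext_block <;>
    simp [Matrix.mul_add, Matrix.add_mul, Matrix.mul_assoc, J'_J_mul, K'_K_mul, J'_K_mul,
      K'_J_mul, J'_J, J'_K, K'_J, K'_K, K'_C1_J, J'_C1_J]
  have h := D.eq1
  have hJ := F.C21_J D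
  generalize F.J' * (D.C1 * F.K) = x at *
  generalize F.K' * (D.C1 * F.K) = y at *
  rw [hC] at h
  refine ⟨?_, ?_, ?_, ?_⟩
  · have := congrArg (fun X => F.J' * (X * F.J)) h
    simpa [enlarge, Matrix.mul_add, Matrix.add_mul, Matrix.mul_assoc, J'_J_mul, K'_K_mul,
      J'_K_mul, K'_J_mul, J'_J, J'_K, K'_J, K'_K, hJ] using this
  · have := congrArg (fun X => F.J' * (X * F.K)) h
    simpa [enlarge, Matrix.mul_add, Matrix.add_mul, Matrix.mul_assoc, J'_J_mul, K'_K_mul,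
      J'_K_mul, K'_J_mul, J'_J, J'_K, K'_J, K'_K, hJ] using this
  · have := congrArg (fun X => F.K' * (X * F.J)) h
    simpa [enlarge, Matrix.mul_add, Matrix.add_mul, Matrix.mul_assoc, J'_J_mul, K'_K_mul,
      J'_K_mul, K'_J_mul, J'_J, J'_K, K'_J, K'_K, hJ] using this
  · have := congrArg (fun X => F.K' * (X * F.K)) h
    simpa [enlarge, Matrix.mul_add, Matrix.add_mul, Matrix.mul_assoc, J'_J_mul, K'_K_mul,
      J'_K_mul, K'_J_mul, J'_J, J'_K, K'_J, K'_K, hJ, add_comm] using this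

/-- The morphism between the original objects induced by one between the enlarged ones. -/
def restrictHom {A A' : BMObj k m n} (D : BMHom (F.enlarge A) (F.enlarge A')) : BMHom A A' where
  C1 := F.K' * (D.C1 * F.K)
  C21 := F.J' * (D.C1 * F.K)
  C2 := D.C2
  eq1 := (F.block_eqs D).2.2.2
  eq2 := (F.block_eqs D).2.2.1
  eq3 := (F.block_eqs D).1

theorem enlarge_simple_iff (A : BMObj k m n) : (F.enlarge A).Simple ↔ A.Simple := by
  constructor
  · intro h C
    obtain ⟨c, h1, h21, h2⟩ := h (F.enlargeHom C)
    refine ⟨c, ?_, ?_, h2⟩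
    · have := congrArg (fun X => F.K' * (X * F.K)) h1
      simpa [enlargeHom, Matrix.mul_add, Matrix.add_mul, Matrix.mul_assoc, J'_J_mul, K'_K_mul,
        J'_K_mul, K'_J_mul, J'_J, J'_K, K'_J, K'_K] using this
    · have := congrArg (fun X => F.J' * (X * F.K)) h1
      simpa [enlargeHom, Matrix.mul_add, Matrix.add_mul, Matrix.mul_assoc, J'_J_mul, K'_K_mul,
        J'_K_mul, K'_J_mul, J'_J, J'_K, K'_J, K'_K] using this
  · intro h D
    obtain ⟨c, h1, h21, h2⟩ := h (F.restrictHom D)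
    simp only [restrictHom] at h1 h21 h2
    have hb := (F.block_eqs D).2.1
    refine ⟨c, ?_, ?_, h2⟩
    · apply F.ext_block <;> simp [h1, h21, h2, K'_C1_J, J'_C1_J, J'_J, J'_K, K'_J, K'_K]
    · apply F.ext_right
      · simp [C21_J]
      · simpa [h21, eq_comm] using hb

theorem enlarge_equiv_iff (A A' : BMObj k m n) :
    BMEquiv (F.enlarge A) (F.enlarge A') ↔ BMEquiv A A' := by
  constructor
  · rintro ⟨D, h1, h2⟩
    refine ⟨F.restrictHom D, ?_, h2⟩
    obtain ⟨E, -, e1, -⟩ := D.exists_inverse h1 h2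
    refine IsUnit.of_mul_eq_one (F.K' * (E.C1 * F.K)) ?_
    have h := F.block_mul D.C1 E.C1 F.K' F.K
    have h0 : F.K' * (D.C1 * (F.J * (F.J' * (E.C1 * F.K)))) = 0 := by
      rw [← Matrix.mul_assoc D.C1, ← Matrix.mul_assoc F.K', K'_C1_J, Matrix.zero_mul]
    rw [h0, zero_add, ← Matrix.mul_assoc D.C1 E.C1, e1, Matrix.one_mul, K'_K] at h
    simp only [restrictHom, Matrix.mul_assoc]
    exact h.symm
  · rintro ⟨C, h1, h2⟩
    refine ⟨F.enlargeHom C, ?_, h2⟩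
    obtain ⟨D, -, e1, -, e2, e21⟩ := C.exists_inverse h1 h2
    have e2' : ∀ {q : ℕ} (X : Matrix (Fin n) (Fin q) k), C.C2 * (D.C2 * X) = X := fun X => by
      rw [← Matrix.mul_assoc, e2, Matrix.one_mul]
    refine IsUnit.of_mul_eq_one (F.enlargeHom D).C1 ?_
    apply F.ext_block <;>
    simp [enlargeHom, Matrix.mul_add, Matrix.add_mul, Matrix.mul_assoc, J'_J_mul, K'_K_mul,
        J'_K_mul, K'_J_mul, J'_J, J'_K, K'_J, K'_K, e1, e2', e21]

/-- An object whose `B₁₂` is the inclusion `J` of a frame is equivalent to an enlarged one. -/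
theorem exists_equiv_enlarge_of_eq (B : BMObj k r n) (hB : B.B12 = F.J) :
    ∃ A, BMEquiv B (F.enlarge A) := by
  refine ⟨⟨F.K' * (B.B1 * F.K), F.K' * (B.B1 * F.J), F.J' * (B.B1 * F.J) + B.B2⟩,
    ⟨1, F.J' * (B.B1 * F.K) * F.K' - B.B2 * F.J', 1, ?_, ?_, ?_⟩, isUnit_one, isUnit_one⟩
  · apply F.ext_block <;>
    simp [enlarge, Matrix.mul_add, Matrix.add_mul, Matrix.mul_sub, Matrix.sub_mul,
      Matrix.mul_assoc, J'_J_mul, K'_K_mul, J'_K_mul, K'_J_mul, J'_J, J'_K, K'_J, K'_K]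
  · simp [enlarge, hB]
  · simp [enlarge, hB, Matrix.sub_mul, Matrix.mul_assoc, K'_J, J'_J]

theorem exists_equiv_enlarge (B : BMObj k r n) (G : BlockFrame k r n m) (hB : G.J = B.B12) :
    ∃ A, BMEquiv B (F.enlarge A) := by
  have hS : (F.J * G.J' + F.K * G.K') * (G.J * F.J' + G.K * F.K') = 1 := by
    simp [Matrix.mul_add, Matrix.add_mul, Matrix.mul_assoc, J'_J_mul, K'_K_mul, J'_K_mul,
      K'_J_mul, F.sum_eq]
  have hS' := mul_eq_one_comm.1 hS
  have hSJ : (F.J * G.J' + F.K * G.K') * B.B12 = F.J := by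
    simp [← hB, Matrix.add_mul, Matrix.mul_assoc, J'_J, K'_J]
  generalize F.J * G.J' + F.K * G.K' = S at *
  generalize G.J * F.J' + G.K * F.K' = T at *
  obtain ⟨A, hA⟩ := F.exists_equiv_enlarge_of_eq ⟨S * B.B1 * T, F.J, B.B2⟩ rfl
  refine ⟨A, BMEquiv.trans ⟨⟨S, 0, 1, ?_, ?_, ?_⟩, IsUnit.of_mul_eq_one _ hS, isUnit_one⟩ hA⟩
  · simp [Matrix.mul_assoc, hS']
  · simp [hSJ]
  · simp

end BlockFrame

/-- If `r₂ < r₁`, then `B₁₂` has full column rank for every simple object. -/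
theorem BMObj.Simple.mulVec_injective {k : Type*} [Field k] {r₁ r₂ : ℕ} (h : r₂ < r₁)
    {B : BMObj k r₁ r₂} (hB : B.Simple) : Function.Injective B.B12.mulVec := by
  by_contra hinj
  have hker : LinearMap.ker B.B12.mulVecLin ≠ ⊥ := fun h0 => hinj (LinearMap.ker_eq_bot.1 h0)
  obtain ⟨v, hv, hv0⟩ := Submodule.exists_mem_ne_zero_of_ne_bot hker
  have hker' : LinearMap.ker B.B12.transpose.mulVecLin ≠ ⊥ :=
    LinearMap.ker_ne_bot_of_finrank_lt (by simpa using h)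
  obtain ⟨w, hw, hw0⟩ := Submodule.exists_mem_ne_zero_of_ne_bot hker'
  have hv' : B.B12.mulVec v = 0 := hv
  have hw' : Matrix.vecMul w B.B12 = 0 := by
    rw [← Matrix.mulVec_transpose]; exact hw
  obtain ⟨-, -, h21, -⟩ := hB ⟨0, Matrix.vecMulVec v w, 0,
    by simp [Matrix.mul_vecMulVec, hv'], by simp, by simp [Matrix.vecMulVec_mul, hw']⟩
  obtain ⟨i, hi⟩ := Function.ne_iff.1 hv0
  obtain ⟨j, hj⟩ := Function.ne_iff.1 hw0
  exact mul_ne_zero hi hj (congrFun (congrFun h21 i) j)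

theorem BMSimpleClasses.nonempty_equiv_sub (k : Type*) [Field k] {r₁ r₂ : ℕ} (h : r₂ < r₁) :
    Nonempty (BMSimpleClasses k r₁ r₂ ≃ BMSimpleClasses k (r₁ - r₂) r₂) := by
  have hr : r₂ + (r₁ - r₂) = r₁ := by omega
  obtain ⟨F⟩ := BlockFrame.nonempty (k := k) hr
  obtain ⟨e⟩ := nonempty_equiv F.enlarge F.enlarge_simple_iff F.enlarge_equiv_iff fun B hB => by
    obtain ⟨G, hG⟩ := BlockFrame.exists_of_injective hr B.B12 (hB.mulVec_injective h)
    exact F.exists_equiv_enlarge B G hG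
  exact ⟨e.symm⟩

/-- **Self-reproduction of the matrix problem `BM`**: over an algebraically closed field,
if `r₁ > r₂` then the equivalence classes of simple objects of `BM(r₁,r₂)` are in
bijection with those of `BM(r₁−r₂,r₂)`; symmetrically, if `r₂ > r₁` then the equivalence
classes of simple objects of `BM(r₁,r₂)` are in bijection with those of `BM(r₁,r₂−r₁)`. -/
theorem bm_self_reproduction (k : Type*) [Field k] [IsAlgClosed k]
    (r₁ r₂ : ℕ) (hr₁ : 0 < r₁) (hr₂ : 0 < r₂) :
    (r₂ < r₁ → Nonempty (BMSimpleClasses k r₁ r₂ ≃ BMSimpleClasses k (r₁ - r₂) r₂)) ∧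
    (r₁ < r₂ → Nonempty (BMSimpleClasses k r₁ r₂ ≃ BMSimpleClasses k r₁ (r₂ - r₁))) := by
  refine ⟨BMSimpleClasses.nonempty_equiv_sub k, fun h => ?_⟩
  obtain ⟨e₁⟩ := BMSimpleClasses.nonempty_equiv_swap k r₁ r₂
  obtain ⟨e₂⟩ := BMSimpleClasses.nonempty_equiv_sub k h
  obtain ⟨e₃⟩ := BMSimpleClasses.nonempty_equiv_swap k (r₂ - r₁) r₁
  exact ⟨e₁.trans (e₂.trans e₃)⟩
end

section
/- Let k be an algebraically closed field and R = k⟦x,y⟧/(xy), the complete local ring of a nodal plane curve singularity. Then every indecomposable R-module of finite length that is generated by a single element is isomorphic either to R/(xⁿ + λyᵐ) for some integers n, m ≥ 1 and some λ ∈ k∖{0}, or to R/(x^{n+1}, y^{m+1}) for some integers n, m ≥ 0. -/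
/-- The complete local ring `k⟦x,y⟧/(xy)` of a nodal plane curve singularity. -/
abbrev NodalRing (k : Type) [Field k] : Type :=
  MvPowerSeries (Fin 2) k ⧸
    Ideal.span {(MvPowerSeries.X 0 : MvPowerSeries (Fin 2) k) * MvPowerSeries.X 1}

/-- The image of `x` in `k⟦x,y⟧/(xy)`. -/
noncomputable def NodalRing.x (k : Type) [Field k] : NodalRing k :=
  Ideal.Quotient.mk _ (MvPowerSeries.X 0)

/-- The image of `y` in `k⟦x,y⟧/(xy)`. -/
noncomputable def NodalRing.y (k : Type) [Field k] : NodalRing k :=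
  Ideal.Quotient.mk _ (MvPowerSeries.X 1)

/-- In a ring which behaves like `k⟦x,y⟧/(xy)`, if `x ^ i ∉ I` for `i ≤ n`, then the `x`-part of
every element of `I` without constant term is divisible by `x ^ n`. -/
theorem Ideal.exists_eq_pow_succ_mul_of_mem {k R : Type*} [Field k] [CommRing R] [Algebra k R]
    {x y : R} (hxy : x * y = 0)
    (hdec : ∀ r : R, ∃ (c : k) (a b : R), r = algebraMap k R c + x * a + y * b)
    (hunit : ∀ c : k, c ≠ 0 → ∀ a b : R, IsUnit (algebraMap k R c + x * a + y * b))
    {I : Ideal R} {n : ℕ} (hn : ∀ i ≤ n, x ^ i ∉ I) {a b : R} (hf : x * a + y * b ∈ I) :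
    ∀ i < n, ∃ a' : R, x * a = x ^ (i + 1) * a' := by
  intro i
  induction i with
  | zero => exact fun _ => ⟨a, by ring⟩
  | succ i ih =>
    intro hi
    obtain ⟨a', ha'⟩ := ih (by omega)
    obtain ⟨c, u, v, huv⟩ := hdec a'
    have hc : c = 0 := by
      by_contra hc
      have hmem : x ^ (i + 2) * a' ∈ I := by
        have := I.mul_mem_left x hf
        have h : x * (x * a + y * b) = x ^ (i + 2) * a' := by
          linear_combination x * ha' + b * hxy
        rwa [h] at this
      rw [huv] at hmem
      exact hn (i + 2) (by omega) ((Ideal.mul_unit_mem_iff_mem I (hunit c hc u v)).1 hmem)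
    refine ⟨u, ?_⟩
    rw [ha', huv, hc, map_zero]
    linear_combination x ^ i * v * hxy

/-- If `I` contains a power of `x`, then there is an exponent at which the powers of `x`
start to lie in `I`. -/
theorem Ideal.exists_pow_succ_mem_forall_notMem {R : Type*} [CommRing R] {I : Ideal R}
    (hI : I ≠ ⊤) {x : R} (hx : ∃ N, x ^ N ∈ I) :
    ∃ n, x ^ (n + 1) ∈ I ∧ ∀ i ≤ n, x ^ i ∉ I := by
  classical
  have h0 : Nat.find hx ≠ 0 := by
    intro h
    have := Nat.find_spec hx
    rw [h, pow_zero] at this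
    exact hI ((Ideal.eq_top_iff_one I).2 this)
  obtain ⟨n, hn⟩ := Nat.exists_eq_succ_of_ne_zero h0
  refine ⟨n, ?_, fun i hi => Nat.find_min hx (by omega)⟩
  have := Nat.find_spec hx
  rwa [hn] at this

/-- The proper ideals containing powers of `x` and `y`, in a ring which behaves like
`k⟦x,y⟧/(xy)`. -/
theorem Ideal.eq_span_binomial_or_eq_span_powers {k R : Type*} [Field k] [CommRing R] [Algebra k R]
    {x y : R} (hxy : x * y = 0)
    (hdec : ∀ r : R, ∃ (c : k) (a b : R), r = algebraMap k R c + x * a + y * b)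
    (hunit : ∀ c : k, c ≠ 0 → ∀ a b : R, IsUnit (algebraMap k R c + x * a + y * b))
    {I : Ideal R} (hI : I ≠ ⊤) (hx : ∃ N, x ^ N ∈ I) (hy : ∃ N, y ^ N ∈ I) :
    (∃ (n m : ℕ) (lam : k), 1 ≤ n ∧ 1 ≤ m ∧ lam ≠ 0 ∧
      I = Ideal.span {x ^ n + algebraMap k R lam * y ^ m}) ∨
    (∃ n m : ℕ, I = Ideal.span {x ^ (n + 1), y ^ (m + 1)}) := by
  obtain ⟨n, hxn, hn⟩ := Ideal.exists_pow_succ_mem_forall_notMem hI hx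
  obtain ⟨m, hym, hm⟩ := Ideal.exists_pow_succ_mem_forall_notMem hI hy
  have hyx : y * x = 0 := by rw [mul_comm, hxy]
  have hdec' : ∀ r : R, ∃ (c : k) (a b : R), r = algebraMap k R c + y * a + x * b := fun r => by
    obtain ⟨c, a, b, h⟩ := hdec r
    exact ⟨c, b, a, by rw [h]; ring⟩
  have hunit' : ∀ c : k, c ≠ 0 → ∀ a b : R, IsUnit (algebraMap k R c + y * a + x * b) :=
    fun c hc a b => by
      have := hunit c hc b a
      rwa [add_right_comm] at this
  have hcunit : ∀ c : k, c ≠ 0 → IsUnit (algebraMap k R c) := fun c hc =>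
    (IsUnit.mk0 c hc).map (algebraMap k R)
  have hle : Ideal.span {x ^ (n + 1), y ^ (m + 1)} ≤ I := by
    rw [Ideal.span_le, Set.insert_subset_iff, Set.singleton_subset_iff]
    exact ⟨hxn, hym⟩
  have hxa : ∀ {a b : R}, x * a + y * b ∈ I → ∃ (c : k) (u : R),
      x * a = algebraMap k R c * x ^ n + x ^ (n + 1) * u ∧ (n = 0 → c = 0) := by
    intro a b hf
    rcases Nat.eq_zero_or_pos n with rfl | hpos
    · exact ⟨0, a, by simp, fun _ => rfl⟩
    obtain ⟨a', ha'⟩ :=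
      Ideal.exists_eq_pow_succ_mul_of_mem hxy hdec hunit hn hf (n - 1) (by omega)
    rw [Nat.sub_add_cancel hpos] at ha'
    obtain ⟨c, u, v, huv⟩ := hdec a'
    refine ⟨c, u, ?_, by omega⟩
    obtain ⟨l, rfl⟩ := Nat.exists_eq_add_of_le' hpos
    rw [ha', huv]
    linear_combination x ^ l * v * hxy
  have hyb : ∀ {a b : R}, x * a + y * b ∈ I → ∃ (c : k) (u : R),
      y * b = algebraMap k R c * y ^ m + y ^ (m + 1) * u ∧ (m = 0 → c = 0) := by
    intro a b hf
    rcases Nat.eq_zero_or_pos m with rfl | hpos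
    · exact ⟨0, b, by simp, fun _ => rfl⟩
    rw [add_comm] at hf
    obtain ⟨b', hb'⟩ :=
      Ideal.exists_eq_pow_succ_mul_of_mem hyx hdec' hunit' hm hf (m - 1) (by omega)
    rw [Nat.sub_add_cancel hpos] at hb'
    obtain ⟨c, u, v, huv⟩ := hdec' b'
    refine ⟨c, u, ?_, by omega⟩
    obtain ⟨l, rfl⟩ := Nat.exists_eq_add_of_le' hpos
    rw [hb', huv]
    linear_combination y ^ l * v * hyx
  have hform : ∀ f ∈ I, ∃ c d : k,
      f - (algebraMap k R c * x ^ n + algebraMap k R d * y ^ m) ∈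
        Ideal.span {x ^ (n + 1), y ^ (m + 1)} ∧ (n = 0 → c = 0) ∧ (m = 0 → d = 0) := by
    intro f hf
    obtain ⟨e, a, b, hab⟩ := hdec f
    have he : e = 0 := by
      by_contra he
      exact hI (Ideal.eq_top_of_isUnit_mem I hf (hab ▸ hunit e he a b))
    rw [he, map_zero, zero_add] at hab
    rw [hab] at hf
    obtain ⟨c, u, hu, hc⟩ := hxa hf
    obtain ⟨d, v, hv, hd⟩ := hyb hf
    refine ⟨c, d, Ideal.mem_span_pair.2 ⟨u, v, ?_⟩, hc, hd⟩
    rw [hab, hu, hv]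
    ring
  have hsub : ∀ f ∈ I, ∀ {g : R}, f - g ∈ Ideal.span {x ^ (n + 1), y ^ (m + 1)} → g ∈ I :=
    fun f hf g hg => (Submodule.sub_mem_iff_right I hf).1 (hle hg)
  by_cases hJ : I ≤ Ideal.span {x ^ (n + 1), y ^ (m + 1)}
  · exact Or.inr ⟨n, m, le_antisymm hJ hle⟩
  left
  obtain ⟨f, hf, hfJ⟩ := SetLike.not_le_iff_exists.1 hJ
  obtain ⟨c, d, hcd, hcn, hdm⟩ := hform f hf
  have hmem := hsub f hf hcd
  have hd : d ≠ 0 := by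
    rintro rfl
    rw [map_zero, zero_mul, add_zero] at hmem hcd
    rcases eq_or_ne c 0 with rfl | hc
    · rw [map_zero, zero_mul, sub_zero] at hcd
      exact hfJ hcd
    · exact hn n le_rfl ((Ideal.unit_mul_mem_iff_mem I (hcunit c hc)).1 hmem)
  have hc : c ≠ 0 := by
    rintro rfl
    rw [map_zero, zero_mul, zero_add] at hmem
    exact hm m le_rfl ((Ideal.unit_mul_mem_iff_mem I (hcunit d hd)).1 hmem)
  have hn1 : 1 ≤ n := Nat.one_le_iff_ne_zero.2 fun h => hc (hcn h)
  have hm1 : 1 ≤ m := Nat.one_le_iff_ne_zero.2 fun h => hd (hdm h)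
  have hlam : d / c ≠ 0 := div_ne_zero hd hc
  have hgI : x ^ n + algebraMap k R (d / c) * y ^ m ∈ I := by
    refine (Ideal.unit_mul_mem_iff_mem I (hcunit c hc)).1 ?_
    rwa [mul_add, ← mul_assoc, ← map_mul, mul_div_cancel₀ _ hc]
  have hJg : Ideal.span {x ^ (n + 1), y ^ (m + 1)} ≤
      Ideal.span {x ^ n + algebraMap k R (d / c) * y ^ m} := by
    obtain ⟨p, rfl⟩ := Nat.exists_eq_add_of_le' hn1
    obtain ⟨q, rfl⟩ := Nat.exists_eq_add_of_le' hm1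
    rw [Ideal.span_le, Set.insert_subset_iff, Set.singleton_subset_iff]
    refine ⟨Ideal.mem_span_singleton'.2 ⟨x, ?_⟩,
      (Ideal.unit_mul_mem_iff_mem _ (hcunit _ hlam)).1 (Ideal.mem_span_singleton'.2 ⟨y, ?_⟩)⟩
    · linear_combination algebraMap k R (d / c) * y ^ q * hxy
    · linear_combination x ^ p * hxy
  refine ⟨n, m, d / c, hn1, hm1, hlam, le_antisymm (fun h hh => ?_) ?_⟩
  · obtain ⟨c', d', hcd', -, -⟩ := hform h hh
    have hdiff : algebraMap k R (d' - c' * (d / c)) * y ^ m ∈ I := by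
      have := I.sub_mem (hsub h hh hcd') (I.mul_mem_left (algebraMap k R c') hgI)
      convert this using 1
      rw [map_sub, map_mul]
      ring
    have hzero : d' - c' * (d / c) = 0 := by
      by_contra hne
      exact hm m le_rfl ((Ideal.unit_mul_mem_iff_mem I (hcunit _ hne)).1 hdiff)
    have hsplit : h = (h - (algebraMap k R c' * x ^ n + algebraMap k R d' * y ^ m)) +
        algebraMap k R c' * (x ^ n + algebraMap k R (d / c) * y ^ m) := by
      rw [sub_eq_zero.1 hzero, map_mul]
      ring
    rw [hsplit]
    exact add_mem (hJg hcd') (Ideal.mul_mem_left _ _ (Ideal.mem_span_singleton_self _))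
  · rwa [Ideal.span_singleton_le_iff_mem]

/-- A power series in two variables is its constant term plus multiples of the variables. -/
theorem MvPowerSeries.exists_eq_C_add_X_mul_add_X_mul {R : Type*} [CommRing R]
    (F : MvPowerSeries (Fin 2) R) :
    ∃ (c : R) (A B : MvPowerSeries (Fin 2) R), F = C c + X 0 * A + X 1 * B := by
  classical
  let G : MvPowerSeries (Fin 2) R := fun e => if e 0 = 0 then 0 else coeff e F
  have hG : ∀ e, coeff e G = if e 0 = 0 then 0 else coeff e F := fun _ => rfl
  obtain ⟨A, hA⟩ : X 0 ∣ G := X_dvd_iff.2 fun e he => by rw [hG, if_pos he]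
  obtain ⟨B, hB⟩ : X 1 ∣ F - C (constantCoeff F) - G := by
    refine X_dvd_iff.2 fun e he => ?_
    rw [map_sub, map_sub, hG, coeff_C]
    by_cases h0 : e 0 = 0
    · obtain rfl : e = 0 := by
        ext i
        fin_cases i
        exacts [h0, he]
      simp
    · have : e ≠ 0 := fun h => h0 (by rw [h]; rfl)
      simp [h0, this]
  exact ⟨constantCoeff F, A, B, by rw [← hA, ← hB]; ring⟩

namespace NodalRing

variable (k : Type) [Field k]

theorem x_mul_y : x k * y k = 0 := by
  rw [x, y, ← map_mul]
  exact Ideal.Quotient.eq_zero_iff_mem.2 (Ideal.mem_span_singleton_self _)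

variable {k}

theorem exists_eq_algebraMap_add (r : NodalRing k) :
    ∃ (c : k) (a b : NodalRing k), r = algebraMap k (NodalRing k) c + x k * a + y k * b := by
  obtain ⟨F, rfl⟩ := Ideal.Quotient.mk_surjective r
  obtain ⟨c, A, B, h⟩ := F.exists_eq_C_add_X_mul_add_X_mul
  refine ⟨c, Ideal.Quotient.mk _ A, Ideal.Quotient.mk _ B, ?_⟩
  rw [h, map_add, map_add, map_mul, map_mul]
  rfl

theorem isUnit_algebraMap_add {c : k} (hc : c ≠ 0) (a b : NodalRing k) :
    IsUnit (algebraMap k (NodalRing k) c + x k * a + y k * b) := by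
  obtain ⟨A, rfl⟩ := Ideal.Quotient.mk_surjective a
  obtain ⟨B, rfl⟩ := Ideal.Quotient.mk_surjective b
  have h : IsUnit (MvPowerSeries.C c + MvPowerSeries.X 0 * A + MvPowerSeries.X 1 * B :
      MvPowerSeries (Fin 2) k) := by
    rw [MvPowerSeries.isUnit_iff_constantCoeff]
    simpa using hc
  have h' := h.map (Ideal.Quotient.mk (Ideal.span
    {(MvPowerSeries.X 0 : MvPowerSeries (Fin 2) k) * MvPowerSeries.X 1}))
  rw [map_add, map_add, map_mul, map_mul] at h'
  exact h'

end NodalRing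

/-- In an Artinian quotient ring, an element `r` with every `1 - r * a` invertible is nilpotent. -/
theorem Ideal.exists_pow_mem_of_isArtinian {R : Type*} [CommRing R] {I : Ideal R}
    [IsArtinian R (R ⧸ I)] {r : R} (hr : ∀ a, IsUnit (1 - r * a)) : ∃ N, r ^ N ∈ I := by
  obtain ⟨N, z, hz⟩ := IsArtinian.exists_pow_succ_smul_dvd r (1 : R ⧸ I)
  obtain ⟨a, rfl⟩ := Ideal.Quotient.mk_surjective z
  refine ⟨N, (Ideal.mul_unit_mem_iff_mem I (hr a)).1 ?_⟩
  have h : Ideal.Quotient.mk I (r ^ (N + 1) * a) = Ideal.Quotient.mk I (r ^ N * 1) := hz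
  rw [Ideal.Quotient.eq, ← neg_mem_iff] at h
  convert h using 1
  ring

/-- Over an algebraically closed field `k`, every indecomposable finite length module
over `R = k⟦x,y⟧/(xy)` which is generated by a single element is isomorphic either to
`R/(xⁿ + λyᵐ)` for some `n, m ≥ 1` and `λ ∈ k \ {0}`, or to `R/(x^{n+1}, y^{m+1})` for
some `n, m ≥ 0`. -/
theorem nodal_cyclic_indecomposable_classification
    (k : Type) [Field k] [IsAlgClosed k]
    (M : Type) [AddCommGroup M] [Module (NodalRing k) M]
    (hlen : IsFiniteLength (NodalRing k) M)
    (hnz : Nontrivial M)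
    (hind : ∀ N₁ N₂ : Submodule (NodalRing k) M, IsCompl N₁ N₂ → N₁ = ⊥ ∨ N₂ = ⊥)
    (hcyc : ∃ m₀ : M, Submodule.span (NodalRing k) {m₀} = ⊤) :
    (∃ (n m : ℕ) (lam : k), 1 ≤ n ∧ 1 ≤ m ∧ lam ≠ 0 ∧
      Nonempty (M ≃ₗ[NodalRing k] (NodalRing k ⧸ Ideal.span
        {NodalRing.x k ^ n + algebraMap k (NodalRing k) lam * NodalRing.y k ^ m}))) ∨
    (∃ n m : ℕ,
      Nonempty (M ≃ₗ[NodalRing k] (NodalRing k ⧸ Ideal.span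
        {NodalRing.x k ^ (n + 1), NodalRing.y k ^ (m + 1)}))) := by
  obtain ⟨m₀, hm₀⟩ := hcyc
  have hsurj : LinearMap.range (LinearMap.toSpanSingleton (NodalRing k) M m₀) = ⊤ := by
    rw [LinearMap.range_toSpanSingleton, hm₀]
  set I : Ideal (NodalRing k) := LinearMap.ker (LinearMap.toSpanSingleton (NodalRing k) M m₀)
  let φ : M ≃ₗ[NodalRing k] (NodalRing k ⧸ I) :=
    (LinearMap.quotKerEquivOfSurjective _ (LinearMap.range_eq_top.1 hsurj)).symm
  have hI : I ≠ ⊤ := fun h => by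
    have := φ.symm.surjective.nontrivial
    exact Ideal.Quotient.nontrivial_iff.1 this h
  have : IsArtinian (NodalRing k) M := (isFiniteLength_iff_isNoetherian_isArtinian.1 hlen).2
  have : IsArtinian (NodalRing k) (NodalRing k ⧸ I) := isArtinian_of_linearEquiv φ
  have hx : ∃ N, NodalRing.x k ^ N ∈ I := Ideal.exists_pow_mem_of_isArtinian fun a => by
    convert NodalRing.isUnit_algebraMap_add (one_ne_zero (α := k)) (-a) 0 using 1
    rw [map_one]
    ring
  have hy : ∃ N, NodalRing.y k ^ N ∈ I := Ideal.exists_pow_mem_of_isArtinian fun a => by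
    convert NodalRing.isUnit_algebraMap_add (one_ne_zero (α := k)) 0 (-a) using 1
    rw [map_one]
    ring
  rcases Ideal.eq_span_binomial_or_eq_span_powers (NodalRing.x_mul_y k)
    NodalRing.exists_eq_algebraMap_add (fun _ => NodalRing.isUnit_algebraMap_add) hI hx hy with
    ⟨n, m, lam, hn, hm, hlam, h⟩ | ⟨n, m, h⟩
  · exact Or.inl ⟨n, m, lam, hn, hm, hlam, ⟨φ.trans (Submodule.quotEquivOfEq _ _ h)⟩⟩
  · exact Or.inr ⟨n, m, ⟨φ.trans (Submodule.quotEquivOfEq _ _ h)⟩⟩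
end
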